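/- arXiv:2204.01170 — 5 statements merged into one kernel-verified Lean document; each statement's English description precedes it below -/
import Mathlib

section
/- Sharp rate for the vanishing viscosity limit up to the first shock time (Corollary 1.2): There exists a constant C ≥ 1, depending only on ů, such that for every ν ∈ (0,1] and every solution u^ν as in the context, C⁻¹·ν^(1/4) ≤ sup_{(t,x) ∈ [t₀,0)×ℝ} |u^ν(t,x) − u⁰(t,x)| ≤ C·ν^(1/4). -/
open Set MeasureTheory

/-- A continuous function of at most exponential growth. -/
def ExpGrowth (F : ℝ → ℝ) : Prop :=
  Continuous F ∧ ∃ A B : ℝ, 0 ≤ A ∧ 0 ≤ B ∧ ∀ y, |F y| ≤ A * Real.exp (B * |y|)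

/-- The unnormalized average of `F` against a Gaussian of standard deviation `σ` centred at `x`. -/
noncomputable def gaussAvg (F : ℝ → ℝ) (σ x : ℝ) : ℝ :=
  ∫ z, F (x + σ * z) * Real.exp (-(1 / 2) * z ^ 2)

namespace ExpGrowth

variable {F G : ℝ → ℝ}

theorem continuous (hF : ExpGrowth F) : Continuous F := hF.1

theorem of_bounded (hF : Continuous F) {M : ℝ} (hM : ∀ y, |F y| ≤ M) : ExpGrowth F := by
  refine ⟨hF, M, 0, (abs_nonneg _).trans (hM 0), le_rfl, fun y => ?_⟩
  simpa using hM y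

theorem id_sub (c : ℝ) : ExpGrowth (fun y => y - c) := by
  refine ⟨by fun_prop, 1 + |c|, 1, by positivity, zero_le_one, fun y => ?_⟩
  have h1 : |y - c| ≤ |y| + |c| := abs_sub _ _
  have h2 := Real.add_one_le_exp |y|
  have h3 : 0 ≤ |c| := abs_nonneg c
  have h4 : 0 ≤ |y| := abs_nonneg y
  rw [one_mul]
  nlinarith

theorem mul (hF : ExpGrowth F) (hG : ExpGrowth G) : ExpGrowth (fun y => F y * G y) := by
  obtain ⟨cF, A, B, hA, hB, h⟩ := hF
  obtain ⟨cG, A', B', hA', hB', h'⟩ := hG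
  refine ⟨cF.mul cG, A * A', B + B', by positivity, by positivity, fun y => ?_⟩
  calc |F y * G y| = |F y| * |G y| := abs_mul _ _
    _ ≤ (A * Real.exp (B * |y|)) * (A' * Real.exp (B' * |y|)) :=
      mul_le_mul (h y) (h' y) (abs_nonneg _) (by positivity)
    _ = A * A' * Real.exp ((B + B') * |y|) := by rw [add_mul, Real.exp_add]; ring

theorem add (hF : ExpGrowth F) (hG : ExpGrowth G) : ExpGrowth (fun y => F y + G y) := by
  obtain ⟨cF, A, B, hA, hB, h⟩ := hF
  obtain ⟨cG, A', B', hA', hB', h'⟩ := hG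
  refine ⟨cF.add cG, A + A', B + B', by positivity, by positivity, fun y => ?_⟩
  have e1 : Real.exp (B * |y|) ≤ Real.exp ((B + B') * |y|) := by gcongr; linarith
  have e2 : Real.exp (B' * |y|) ≤ Real.exp ((B + B') * |y|) := by gcongr; linarith
  calc |F y + G y| ≤ |F y| + |G y| := abs_add_le _ _
    _ ≤ A * Real.exp (B * |y|) + A' * Real.exp (B' * |y|) := add_le_add (h y) (h' y)
    _ ≤ A * Real.exp ((B + B') * |y|) + A' * Real.exp ((B + B') * |y|) := by gcongr
    _ = _ := by ring

theorem const_mul (hF : ExpGrowth F) (c : ℝ) : ExpGrowth (fun y => c * F y) :=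
  (of_bounded (M := |c|) continuous_const fun _ => le_rfl).mul hF

theorem gauss_bound (hF : ExpGrowth F) (R : ℝ) :
    ∃ D : ℝ, ∀ x σ z : ℝ, |x| ≤ R → |σ| ≤ R →
      (1 + |z|) * |F (x + σ * z) * Real.exp (-(1 / 2) * z ^ 2)|
        ≤ D * Real.exp (-(1 / 4) * z ^ 2) := by
  obtain ⟨cF, A, B, hA, hB, h⟩ := hF
  refine ⟨A * Real.exp (B * R + (B * R + 1) ^ 2), fun x σ z hx hσ => ?_⟩
  have hz := abs_nonneg z
  have h1 : |x + σ * z| ≤ R + R * |z| := by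
    calc |x + σ * z| ≤ |x| + |σ * z| := abs_add_le _ _
      _ = |x| + |σ| * |z| := by rw [abs_mul]
      _ ≤ _ := by gcongr
  have h2 : 1 + |z| ≤ Real.exp |z| := by linarith [Real.add_one_le_exp |z|]
  have h3 : |F (x + σ * z)| ≤ A * Real.exp (B * (R + R * |z|)) :=
    (h _).trans (by gcongr)
  rw [abs_mul, abs_of_pos (Real.exp_pos _)]
  calc (1 + |z|) * (|F (x + σ * z)| * Real.exp (-(1 / 2) * z ^ 2))
      ≤ Real.exp |z| * ((A * Real.exp (B * (R + R * |z|))) * Real.exp (-(1 / 2) * z ^ 2)) := by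
        gcongr
    _ = A * Real.exp (|z| + B * (R + R * |z|) + -(1 / 2) * z ^ 2) := by
        rw [Real.exp_add, Real.exp_add]; ring
    _ ≤ A * Real.exp (B * R + (B * R + 1) ^ 2 + -(1 / 4) * z ^ 2) := by
        refine mul_le_mul_of_nonneg_left (Real.exp_le_exp.2 ?_) hA
        have := sq_abs z
        nlinarith [sq_nonneg (|z| / 2 - (B * R + 1))]
    _ = _ := by rw [Real.exp_add]; ring

theorem integrable_gauss_mul (hF : ExpGrowth F) (x σ : ℝ) :
    Integrable (fun z => z * (F (x + σ * z) * Real.exp (-(1 / 2) * z ^ 2))) := by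
  obtain ⟨D, hD⟩ := hF.gauss_bound (max |x| |σ|)
  have := hF.continuous
  refine ((integrable_exp_neg_mul_sq (b := 1 / 4) (by norm_num)).const_mul D).mono'
    (Continuous.aestronglyMeasurable (by fun_prop)) (Filter.Eventually.of_forall fun z => ?_)
  refine le_trans ?_ (hD x σ z (le_max_left _ _) (le_max_right _ _))
  rw [Real.norm_eq_abs, abs_mul]
  gcongr
  linarith

theorem integrable_gauss (hF : ExpGrowth F) (x σ : ℝ) :
    Integrable (fun z => F (x + σ * z) * Real.exp (-(1 / 2) * z ^ 2)) := by
  obtain ⟨D, hD⟩ := hF.gauss_bound (max |x| |σ|)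
  have := hF.continuous
  refine ((integrable_exp_neg_mul_sq (b := 1 / 4) (by norm_num)).const_mul D).mono'
    (Continuous.aestronglyMeasurable (by fun_prop)) (Filter.Eventually.of_forall fun z => ?_)
  refine le_trans ?_ (hD x σ z (le_max_left _ _) (le_max_right _ _))
  rw [Real.norm_eq_abs]
  exact le_mul_of_one_le_left (abs_nonneg _) (by linarith [abs_nonneg z])

theorem continuous_gaussAvg (hF : ExpGrowth F) :
    Continuous (fun p : ℝ × ℝ => gaussAvg F p.1 p.2) := by
  have hc := hF.continuous
  refine continuous_iff_continuousAt.2 fun p₀ => ?_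
  obtain ⟨D, hD⟩ := hF.gauss_bound (‖p₀‖ + 1)
  refine continuousAt_of_dominated (bound := fun z => D * Real.exp (-(1 / 4) * z ^ 2))
    (Filter.Eventually.of_forall fun p => Continuous.aestronglyMeasurable (by fun_prop)) ?_
    ((integrable_exp_neg_mul_sq (by norm_num)).const_mul D)
    (Filter.Eventually.of_forall fun z => Continuous.continuousAt (by fun_prop))
  filter_upwards [Metric.ball_mem_nhds p₀ one_pos] with p hp
  have hp' : ‖p‖ ≤ ‖p₀‖ + 1 := by
    have h1 := norm_le_norm_add_norm_sub p₀ p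
    rw [← dist_eq_norm, dist_comm] at h1
    linarith [Metric.mem_ball.1 hp]
  refine Filter.Eventually.of_forall fun z => ?_
  refine le_trans ?_ (hD p.2 p.1 z ((norm_snd_le p).trans hp') ((norm_fst_le p).trans hp'))
  rw [Real.norm_eq_abs]
  exact le_mul_of_one_le_left (abs_nonneg _) (by linarith [abs_nonneg z])

/-- Differentiation under the integral along the line with direction `(β, α)`. -/
theorem hasDerivAt_gaussAvg_line {F' : ℝ → ℝ} (hF : ExpGrowth F) (hF' : ExpGrowth F')
    (hd : ∀ y, HasDerivAt F (F' y) y) (α β σ x : ℝ) :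
    HasDerivAt (fun τ => gaussAvg F (σ + β * τ) (x + α * τ))
      (∫ z, (α + β * z) * (F' (x + σ * z) * Real.exp (-(1 / 2) * z ^ 2))) 0 := by
  have hc := hF.continuous
  have hc' := hF'.continuous
  set R := |x| + |α| + |σ| + |β| with hR
  obtain ⟨D, hD⟩ := hF'.gauss_bound R
  have key := hasDerivAt_integral_of_dominated_loc_of_deriv_le (μ := volume) (x₀ := (0 : ℝ))
    (s := Metric.ball 0 1)
    (F := fun τ z => F ((x + α * τ) + (σ + β * τ) * z) * Real.exp (-(1 / 2) * z ^ 2))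
    (F' := fun τ z => (α + β * z) *
      (F' ((x + α * τ) + (σ + β * τ) * z) * Real.exp (-(1 / 2) * z ^ 2)))
    (bound := fun z => (|α| + |β|) * (D * Real.exp (-(1 / 4) * z ^ 2)))
    (Metric.ball_mem_nhds _ one_pos)
    (Filter.Eventually.of_forall fun τ => Continuous.aestronglyMeasurable (by fun_prop))
    (by simpa using hF.integrable_gauss x σ)
    (Continuous.aestronglyMeasurable (by fun_prop))
    (Filter.Eventually.of_forall fun z τ hτ => ?_)
    (((integrable_exp_neg_mul_sq (by norm_num)).const_mul D).const_mul _)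
    (Filter.Eventually.of_forall fun z τ hτ => ?_)
  · simpa [gaussAvg] using key.2
  · have hτ' : |τ| ≤ 1 := by simpa using (Metric.mem_ball.1 hτ).le
    have b1 : ∀ p q : ℝ, |p + q * τ| ≤ |p| + |q| := fun p q => by
      calc |p + q * τ| ≤ |p| + |q * τ| := abs_add_le _ _
        _ = |p| + |q| * |τ| := by rw [abs_mul]
        _ ≤ _ := by nlinarith [abs_nonneg q]
    have b2 : |x + α * τ| ≤ R := by
      have := b1 x α; have := abs_nonneg σ; have := abs_nonneg β; linarith
    have b3 : |σ + β * τ| ≤ R := by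
      have := b1 σ β; have := abs_nonneg x; have := abs_nonneg α; linarith
    have b4 := hD _ _ z b2 b3
    have b5 : |α + β * z| ≤ (|α| + |β|) * (1 + |z|) := by
      calc |α + β * z| ≤ |α| + |β * z| := abs_add_le _ _
        _ = |α| + |β| * |z| := by rw [abs_mul]
        _ ≤ _ := by nlinarith [abs_nonneg α, abs_nonneg β, abs_nonneg z,
          mul_nonneg (abs_nonneg α) (abs_nonneg z)]
    rw [Real.norm_eq_abs, abs_mul]
    calc _ ≤ ((|α| + |β|) * (1 + |z|)) * _ := mul_le_mul_of_nonneg_right b5 (abs_nonneg _)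
      _ = (|α| + |β|) * ((1 + |z|) * _) := by rw [mul_assoc]
      _ ≤ _ := by gcongr
  · have h1 : HasDerivAt (fun τ : ℝ => (x + α * τ) + (σ + β * τ) * z) (α + β * z) τ := by
      have e1 := ((hasDerivAt_id τ).const_mul α).const_add x
      have e2 := (((hasDerivAt_id τ).const_mul β).const_add σ).mul_const z
      exact (e1.add e2).congr_deriv (by simp)
    have h2 := ((hd _).comp τ h1).mul_const (Real.exp (-(1 / 2) * z ^ 2))
    refine h2.congr_deriv ?_
    ring

theorem hasDerivAt_gaussAvg_right {F' : ℝ → ℝ} (hF : ExpGrowth F) (hF' : ExpGrowth F')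
    (hd : ∀ y, HasDerivAt F (F' y) y) (σ x : ℝ) :
    HasDerivAt (fun x => gaussAvg F σ x) (gaussAvg F' σ x) x := by
  have h := hasDerivAt_gaussAvg_line hF hF' hd 1 0 σ x
  simp only [zero_mul, add_zero, one_mul] at h
  have h' : HasDerivAt (fun τ => gaussAvg F σ (x + τ)) (gaussAvg F' σ x) (x - x) := by
    simpa [gaussAvg] using h
  simpa using h'.comp_sub_const x x

/-- Gaussian integration by parts. -/
theorem integral_mul_gauss {F' : ℝ → ℝ} (hF : ExpGrowth F) (hF' : ExpGrowth F')
    (hd : ∀ y, HasDerivAt F (F' y) y) (σ x : ℝ) :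
    ∫ z, z * (F (x + σ * z) * Real.exp (-(1 / 2) * z ^ 2)) = σ * gaussAvg F' σ x := by
  have hu : ∀ z, HasDerivAt (fun z => F (x + σ * z)) (F' (x + σ * z) * σ) z := fun z => by
    have e1 : HasDerivAt (fun z : ℝ => x + σ * z) σ z := by
      simpa using ((hasDerivAt_id z).const_mul σ).const_add x
    exact (hd _).comp z e1
  have hv : ∀ z : ℝ, HasDerivAt (fun z : ℝ => Real.exp (-(1 / 2) * z ^ 2))
      (Real.exp (-(1 / 2) * z ^ 2) * (-z)) z := fun z => by
    have e1 : HasDerivAt (fun z : ℝ => -(1 / 2) * z ^ 2) (-z) z := by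
      refine ((hasDerivAt_pow 2 z).const_mul (-(1 / 2) : ℝ)).congr_deriv ?_
      norm_num
      ring
    exact e1.exp
  have key := integral_mul_deriv_eq_deriv_mul_of_integrable (u := fun z => F (x + σ * z))
    (v := fun z : ℝ => Real.exp (-(1 / 2) * z ^ 2)) (fun z _ => hu z) (fun z _ => hv z)
    ((hF.integrable_gauss_mul x σ).neg.congr (Filter.Eventually.of_forall fun z => by
      simp only [Pi.neg_apply, Pi.mul_apply]; ring))
    (((hF'.integrable_gauss x σ).const_mul σ).congr (Filter.Eventually.of_forall fun z => by
      simp only [Pi.mul_apply]; ring))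
    (hF.integrable_gauss x σ)
  have e1 : ∫ z, F (x + σ * z) * (Real.exp (-(1 / 2) * z ^ 2) * (-z))
      = -∫ z, z * (F (x + σ * z) * Real.exp (-(1 / 2) * z ^ 2)) := by
    rw [← integral_neg]; congr 1; ext z; ring
  have e2 : ∫ z, F' (x + σ * z) * σ * Real.exp (-(1 / 2) * z ^ 2) = σ * gaussAvg F' σ x := by
    rw [gaussAvg, ← integral_const_mul]; congr 1; ext z; ring
  rw [e1, e2] at key
  linarith

theorem hasDerivAt_gaussAvg_left {F' F'' : ℝ → ℝ} (hF : ExpGrowth F) (hF' : ExpGrowth F')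
    (hF'' : ExpGrowth F'') (hd : ∀ y, HasDerivAt F (F' y) y)
    (hd' : ∀ y, HasDerivAt F' (F'' y) y) (σ x : ℝ) :
    HasDerivAt (fun σ => gaussAvg F σ x) (σ * gaussAvg F'' σ x) σ := by
  have h := hasDerivAt_gaussAvg_line hF hF' hd 0 1 σ x
  simp only [zero_mul, add_zero, one_mul, zero_add] at h
  rw [hF'.integral_mul_gauss hF'' hd'] at h
  have h' : HasDerivAt (fun τ => gaussAvg F (σ + τ) x) (σ * gaussAvg F'' σ x) (σ - σ) := by
    simpa using h
  simpa using h'.comp_sub_const σ σ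

/-- Gaussian averages solve the heat equation. -/
theorem hasDerivAt_gaussAvg_sqrt {F' F'' : ℝ → ℝ} (hF : ExpGrowth F) (hF' : ExpGrowth F')
    (hF'' : ExpGrowth F'') (hd : ∀ y, HasDerivAt F (F' y) y)
    (hd' : ∀ y, HasDerivAt F' (F'' y) y) {ν s : ℝ} (hν : 0 < ν) (hs : 0 < s) (x : ℝ) :
    HasDerivAt (fun s => gaussAvg F √(2 * ν * s) x) (ν * gaussAvg F'' √(2 * ν * s) x) s := by
  have hpos : 0 < 2 * ν * s := by positivity
  have e1 : HasDerivAt (fun s => 2 * ν * s) (2 * ν) s := by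
    simpa using (hasDerivAt_id s).const_mul (2 * ν)
  have e2 := e1.sqrt hpos.ne'
  have e3 := (hasDerivAt_gaussAvg_left hF hF' hF'' hd hd' √(2 * ν * s) x).comp s e2
  refine e3.congr_deriv ?_
  have := Real.sqrt_pos.2 hpos
  field_simp

end ExpGrowth
/-- Second derivative test: the second derivative is nonpositive at a maximum. -/
theorem IsLocalMax.hasDerivAt_hasDerivAt_nonpos {f f' : ℝ → ℝ} {x d : ℝ} (h : IsLocalMax f x)
    (hf : ∀ y, HasDerivAt f (f' y) y) (hf' : HasDerivAt f' d x) : d ≤ 0 := by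
  by_contra! hd
  have e1 : deriv f = f' := funext fun y => (hf y).deriv
  have h1 : IsLocalMin f x := isLocalMin_of_deriv_deriv_pos (by rw [e1, hf'.deriv]; exact hd)
    h.deriv_eq_zero (hf x).continuousAt
  have h2 : f =ᶠ[nhds x] fun _ => f x := by
    filter_upwards [h, h1] with y hy hy' using le_antisymm hy hy'
  have h3 : f' =ᶠ[nhds x] fun _ => 0 := by
    filter_upwards [h2.eventuallyEq_nhds] with y hy
    rw [← (hf y).deriv, hy.deriv_eq, deriv_const]
  have h4 : d = 0 := by rw [← hf'.deriv, h3.deriv_eq, deriv_const]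
  exact hd.ne' h4

/-- Weak maximum principle on a strip for linear parabolic inequalities with bounded coefficients. -/
theorem parabolic_max_principle {τ₀ τ₁ ν K M : ℝ} {w wt wx wxx b c : ℝ → ℝ → ℝ} (hν : 0 < ν)
    (hcont : ContinuousOn (fun p : ℝ × ℝ => w p.1 p.2) (Icc τ₀ τ₁ ×ˢ univ))
    (hbd : ∀ t ∈ Icc τ₀ τ₁, ∀ x, w t x ≤ M)
    (ht : ∀ t ∈ Ioc τ₀ τ₁, ∀ x, HasDerivAt (fun s => w s x) (wt t x) t)
    (hx : ∀ t ∈ Ioc τ₀ τ₁, ∀ x, HasDerivAt (w t) (wx t x) x)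
    (hxx : ∀ t ∈ Ioc τ₀ τ₁, ∀ x, HasDerivAt (wx t) (wxx t x) x)
    (hpde : ∀ t ∈ Ioc τ₀ τ₁, ∀ x, wt t x ≤ ν * wxx t x - b t x * wx t x - c t x * w t x)
    (hb : ∀ t ∈ Ioc τ₀ τ₁, ∀ x, |b t x| ≤ K) (hc : ∀ t ∈ Ioc τ₀ τ₁, ∀ x, |c t x| ≤ K)
    (hinit : ∀ x, w τ₀ x ≤ 0) :
    ∀ t ∈ Icc τ₀ τ₁, ∀ x, w t x ≤ 0 := by
  set l := 2 * ν + 3 * |K| + 1 with hl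
  have main : ∀ ε > 0, ∀ t ∈ Icc τ₀ τ₁, ∀ x, Real.exp (-l * (t - τ₀)) * w t x ≤ ε * (1 + x ^ 2) := by
    intro ε hε t₁ ht₁ x₁
    by_contra! hcon
    set z : ℝ × ℝ → ℝ := fun p => Real.exp (-l * (p.1 - τ₀)) * w p.1 p.2 - ε * (1 + p.2 ^ 2) with hz
    have hzc : ContinuousOn z (Icc τ₀ τ₁ ×ˢ univ) :=
      (ContinuousOn.mul (Continuous.continuousOn (by fun_prop)) hcont).sub
        (Continuous.continuousOn (by fun_prop))
    set R := |x₁| + |M| / ε + 1 with hR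
    have hMe : 0 ≤ |M| / ε := by positivity
    have hout : ∀ t ∈ Icc τ₀ τ₁, ∀ x, R ≤ |x| → z (t, x) ≤ 0 := by
      intro t ht x hx
      have h1 : Real.exp (-l * (t - τ₀)) * w t x ≤ |M| := by
        have e1 : Real.exp (-l * (t - τ₀)) ≤ 1 := by
          rw [Real.exp_le_one_iff]
          have := sub_nonneg.2 ht.1
          nlinarith [abs_nonneg K]
        calc _ ≤ Real.exp (-l * (t - τ₀)) * |M| :=
              mul_le_mul_of_nonneg_left ((hbd t ht x).trans (le_abs_self M)) (Real.exp_pos _).le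
          _ ≤ 1 * |M| := by gcongr
          _ = _ := one_mul _
      have h2 : |M| / ε ≤ 1 + x ^ 2 := by
        have := abs_nonneg x₁
        rw [← sq_abs x]; nlinarith
      rw [div_le_iff₀ hε] at h2
      simp only [hz]; linarith
    obtain ⟨⟨t, x⟩, ⟨htm, hxm⟩, hmax⟩ := (isCompact_Icc.prod isCompact_Icc).exists_isMaxOn
      (s := Icc τ₀ τ₁ ×ˢ Icc (-R) R)
      ⟨(t₁, x₁), ht₁, abs_le.1 (by linarith)⟩ (hzc.mono (prod_mono le_rfl (subset_univ _)))
    have hz1 : 0 < z (t₁, x₁) := by simp only [hz]; linarith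
    have hzpos : 0 < z (t, x) :=
      hz1.trans_le (hmax (a := (t₁, x₁)) ⟨ht₁, abs_le.1 (by linarith)⟩)
    have hglob : ∀ t' ∈ Icc τ₀ τ₁, ∀ x', z (t', x') ≤ z (t, x) := by
      intro t' ht' x'
      by_cases hx' : R ≤ |x'|
      · exact (hout t' ht' x' hx').trans hzpos.le
      · exact hmax (a := (t', x')) ⟨ht', abs_le.1 (le_of_not_ge hx')⟩
    have htI : t ∈ Ioc τ₀ τ₁ := by
      refine ⟨lt_of_le_of_ne htm.1 fun h => ?_, htm.2⟩
      have h1 := hinit x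
      simp only [hz, ← h, sub_self, mul_zero, Real.exp_zero, one_mul] at hzpos
      nlinarith [sq_nonneg x]
    set e := Real.exp (-l * (t - τ₀)) with he
    have hepos : 0 < e := Real.exp_pos _
    -- first and second space derivatives of the penalized function
    have d1 : ∀ y, HasDerivAt (fun y => z (t, y)) (e * wx t y - ε * (2 * y)) y := fun y => by
      have h1 := ((hasDerivAt_pow 2 y).const_add 1).const_mul ε
      exact (((hx t htI y).const_mul e).sub h1).congr_deriv (by norm_num)
    have d2 : HasDerivAt (fun y => e * wx t y - ε * (2 * y)) (e * wxx t x - ε * 2) x := by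
      have h1 := ((hasDerivAt_id x).const_mul 2).const_mul ε
      exact (((hxx t htI x).const_mul e).sub h1).congr_deriv (by norm_num)
    have hlm : IsLocalMax (fun y => z (t, y)) x := Filter.Eventually.of_forall fun y => hglob t htm y
    have q1 : e * wx t x - ε * (2 * x) = 0 := hlm.hasDerivAt_eq_zero (d1 x)
    have q2 : e * wxx t x - ε * 2 ≤ 0 := hlm.hasDerivAt_hasDerivAt_nonpos d1 d2
    have d3 : HasDerivAt (fun s => z (s, x)) (e * (-l) * w t x + e * wt t x) t := by
      have h1 : HasDerivAt (fun s : ℝ => Real.exp (-l * (s - τ₀))) (e * (-l)) t := by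
        have := ((hasDerivAt_id t).sub_const τ₀).const_mul (-l)
        rw [mul_one] at this
        exact this.exp
      exact (h1.mul (ht t htI x)).sub_const (ε * (1 + x ^ 2))
    have q3 : 0 ≤ e * (-l) * w t x + e * wt t x := by
      have hs := (hasDerivWithinAt_iff_tendsto_slope' (s := Iio t) (by simp)).1
        d3.hasDerivWithinAt
      refine ge_of_tendsto hs ?_
      filter_upwards [Ioo_mem_nhdsLT htI.1] with s hs'
      rw [slope_def_field]
      exact div_nonneg_of_nonpos
        (sub_nonpos.2 (hglob s ⟨hs'.1.le, hs'.2.le.trans htI.2⟩ x)) (sub_nonpos.2 hs'.2.le)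
    have q4 := mul_le_mul_of_nonneg_left (hpde t htI x) hepos.le
    have hbK := (hb t htI x).trans (le_abs_self K)
    have hcK := (hc t htI x).trans (le_abs_self K)
    have hE : ε * (1 + x ^ 2) < e * w t x := by simp only [hz, ← he] at hzpos; linarith
    set W := e * w t x with hW
    have q5 : ν * (e * wxx t x) ≤ ν * (ε * 2) := by
      apply mul_le_mul_of_nonneg_left _ hν.le; linarith
    have q6 : -(b t x * (e * wx t x)) ≤ |K| * (ε * (1 + x ^ 2)) := by
      have h1 : e * wx t x = ε * (2 * x) := by linarith
      rw [h1]
      have h2 : |2 * x| ≤ 1 + x ^ 2 := abs_le.2 ⟨by nlinarith [sq_nonneg (x + 1)],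
        by nlinarith [sq_nonneg (x - 1)]⟩
      calc -(b t x * (ε * (2 * x))) ≤ |b t x * (ε * (2 * x))| := neg_le_abs _
        _ = |b t x| * (ε * |2 * x|) := by rw [abs_mul, abs_mul, abs_of_pos hε]
        _ ≤ _ := by gcongr
    have hWpos : 0 < W := lt_of_le_of_lt (by positivity) hE
    have q7 : -(c t x * W) ≤ |K| * W := by
      nlinarith [neg_abs_le (c t x)]
    have q8 : l * W ≤ ν * (ε * 2) + |K| * (ε * (1 + x ^ 2)) + |K| * W := by
      rw [hW] at *; nlinarith
    have q9 : ν * (ε * 2) ≤ 2 * ν * W := by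
      have : ε ≤ W := by nlinarith [sq_nonneg x]
      nlinarith
    have q10 : |K| * (ε * (1 + x ^ 2)) ≤ |K| * W := by gcongr
    rw [hl] at q8
    nlinarith [abs_nonneg K, mul_nonneg (abs_nonneg K) hWpos.le]
  intro t ht' x
  have hlim : Real.exp (-l * (t - τ₀)) * w t x ≤ 0 := by
    refine le_of_forall_pos_le_add fun δ hδ => ?_
    have hp : 0 < 1 + x ^ 2 := by positivity
    have := main (δ / (1 + x ^ 2)) (by positivity) t ht' x
    rwa [div_mul_cancel₀ _ hp.ne', ← zero_add δ] at this
  by_contra! h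
  exact absurd hlim (not_le.2 (mul_pos (Real.exp_pos _) h))

/-- Classical solutions of the inviscid Burgers equation are constant along characteristics. -/
theorem inviscid_burgers_characteristics {t₀ : ℝ} {a : ℝ → ℝ} {v : ℝ → ℝ → ℝ}
    (hsmooth : ContDiffOn ℝ (⊤ : ℕ∞) (fun p : ℝ × ℝ => v p.1 p.2) (Ico t₀ 0 ×ˢ univ))
    (hpde : ∀ t ∈ Ico t₀ (0 : ℝ), ∀ x : ℝ,
      deriv (fun s => v s x) t = -(v t x) * deriv (fun y => v t y) x)
    (hinit : ∀ x, v t₀ x = a x) {t : ℝ} (ht : t ∈ Ico t₀ 0) (y : ℝ) :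
    v t (y + (t - t₀) * a y) = a y := by
  set S : Set (ℝ × ℝ) := Ico t₀ 0 ×ˢ univ with hS
  set V : ℝ × ℝ → ℝ := fun p => v p.1 p.2 with hV
  set γ : ℝ → ℝ × ℝ := fun s => (s, y + (s - t₀) * a y) with hγ
  have hγc : Continuous γ := by fun_prop
  have hmaps : MapsTo γ (Icc t₀ t) S := fun s hs => ⟨⟨hs.1, hs.2.trans_lt ht.2⟩, mem_univ _⟩
  have hUD : UniqueDiffOn ℝ S := (uniqueDiffOn_Ico t₀ 0).prod uniqueDiffOn_univ
  have hfd : ContinuousOn (fun s => fderivWithin ℝ V S (γ s) (0, 1)) (Icc t₀ t) :=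
    ((hsmooth.continuousOn_fderivWithin hUD (by simp)).comp hγc.continuousOn hmaps).clm_apply
      continuousOn_const
  obtain ⟨K, hK⟩ := isCompact_Icc.exists_bound_of_continuousOn hfd
  have hderiv : ∀ s ∈ Ioo t₀ t, ∃ q : ℝ, |q| ≤ K ∧
      HasDerivAt (fun s => V (γ s) - a y) (-(V (γ s) - a y) * q) s := by
    intro s hs
    have hs0 : s < 0 := hs.2.trans ht.2
    have hnhds : S ∈ nhds (γ s) := prod_mem_nhds (Ico_mem_nhds hs.1 hs0) Filter.univ_mem
    have hD : HasFDerivAt V (fderiv ℝ V (γ s)) (γ s) :=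
      ((hsmooth.contDiffAt hnhds).differentiableAt (by simp)).hasFDerivAt
    refine ⟨fderiv ℝ V (γ s) (0, 1), ?_, ?_⟩
    · rw [← fderivWithin_of_mem_nhds hnhds]
      exact hK s ⟨hs.1.le, hs.2.le⟩
    have h1 : HasDerivAt (fun r => V (r, (γ s).2)) (fderiv ℝ V (γ s) (1, 0)) s :=
      HasFDerivAt.comp_hasDerivAt (f := fun r => (r, (γ s).2)) s hD
        ((hasDerivAt_id s).prodMk (hasDerivAt_const s (γ s).2))
    have h2 : HasDerivAt (fun r => V (s, r)) (fderiv ℝ V (γ s) (0, 1)) (γ s).2 :=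
      hD.comp_hasDerivAt (γ s).2 ((hasDerivAt_const (γ s).2 s).prodMk (hasDerivAt_id (γ s).2))
    have h3 := hpde s ⟨hs.1.le, hs0⟩ (γ s).2
    rw [show deriv (fun r => v r (γ s).2) s = fderiv ℝ V (γ s) (1, 0) from h1.deriv,
      show deriv (fun r => v s r) (γ s).2 = fderiv ℝ V (γ s) (0, 1) from h2.deriv] at h3
    have h4 : HasDerivAt γ (1, a y) s := by
      refine (hasDerivAt_id s).prodMk ?_
      simpa using (((hasDerivAt_id s).sub_const t₀).mul_const (a y)).const_add y
    refine ((hD.comp_hasDerivAt s h4).sub_const (a y)).congr_deriv ?_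
    have h5 : ((1, a y) : ℝ × ℝ) = (1, 0) + a y • (0, 1) := by simp
    rw [h5, map_add, map_smul, h3, smul_eq_mul]
    change -(V (γ s)) * _ + _ = _
    ring
  have hanti : AntitoneOn (fun s => Real.exp (-(2 * K) * s) * (V (γ s) - a y) ^ 2) (Icc t₀ t) := by
    have hd : ∀ s ∈ Ioo t₀ t, ∃ d ≤ 0,
        HasDerivAt (fun s => Real.exp (-(2 * K) * s) * (V (γ s) - a y) ^ 2) d s := by
      intro s hs
      obtain ⟨q, hq, hd⟩ := hderiv s hs
      have h1 : HasDerivAt (fun s : ℝ => Real.exp (-(2 * K) * s))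
          (Real.exp (-(2 * K) * s) * (-(2 * K))) s := by
        simpa using ((hasDerivAt_id s).const_mul (-(2 * K))).exp
      have h2 : 0 ≤ Real.exp (-(2 * K) * s) * (V (γ s) - a y) ^ 2 * (2 * K + 2 * q) := by
        have := neg_le_of_abs_le hq
        exact mul_nonneg (by positivity) (by linarith)
      exact ⟨_, neg_nonpos.2 h2, (h1.mul (hd.pow 2)).congr_deriv (by norm_num; ring)⟩
    refine antitoneOn_of_deriv_nonpos (convex_Icc _ _) ?_ ?_ ?_
    · exact (Continuous.continuousOn (by fun_prop)).mul
        (((hsmooth.continuousOn.comp hγc.continuousOn hmaps).sub continuousOn_const).pow 2)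
    · rw [interior_Icc]
      intro s hs
      obtain ⟨d, _, hd⟩ := hd s hs
      exact hd.differentiableAt.differentiableWithinAt
    · rw [interior_Icc]
      intro s hs
      obtain ⟨d, h, hd⟩ := hd s hs
      rwa [hd.deriv]
  have h := hanti (left_mem_Icc.2 ht.1) (right_mem_Icc.2 ht.1) ht.1
  have h0 : V (γ t₀) - a y = 0 := by simp [hV, hγ, hinit]
  simp only [h0, zero_pow two_ne_zero, mul_zero] at h
  have h1 : (V (γ t) - a y) ^ 2 ≤ 0 := by
    by_contra! hc
    have := mul_pos (Real.exp_pos (-(2 * K) * t)) hc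
    linarith
  have h2 : V (γ t) - a y = 0 := by nlinarith
  exact sub_eq_zero.1 h2

/-- Quantitative description of data whose derivative has a unique nondegenerate minimum `-T⁻¹`
at the origin. -/
structure ShockProfile (a a₁ a₂ : ℝ → ℝ) (T M K c : ℝ) : Prop where
  T_pos : 0 < T
  c_pos : 0 < c
  hasDerivAt : ∀ y, HasDerivAt a (a₁ y) y
  hasDerivAt_deriv : ∀ y, HasDerivAt a₁ (a₂ y) y
  continuous_snd : Continuous a₂
  abs_apply_le : ∀ y, |a y| ≤ M
  abs_fst_le : ∀ y, |a₁ y| ≤ M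
  abs_snd_le : ∀ y, |a₂ y| ≤ M
  lower : ∀ y, -T⁻¹ + c * min 1 (y ^ 2) ≤ a₁ y
  upper : ∀ y, a₁ y ≤ -T⁻¹ + K * y ^ 2

theorem Continuous.exists_abs_le_of_eq_const {f : ℝ → ℝ} (hf : Continuous f) {L d : ℝ}
    (h : ∀ x ∉ Icc (-L) L, f x = d) : ∃ M, ∀ x, |f x| ≤ M := by
  obtain ⟨M, hM⟩ := (isCompact_Icc (a := -L) (b := L)).exists_bound_of_continuousOn hf.continuousOn
  refine ⟨max M |d|, fun x => ?_⟩
  by_cases hx : x ∈ Icc (-L) L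
  · exact (hM x hx).trans (le_max_left _ _)
  · rw [h x hx]; exact le_max_right _ _

theorem deriv_eq_zero_of_eq_const {f : ℝ → ℝ} {L d : ℝ}
    (h : ∀ x ∉ Icc (-L) L, f x = d) : ∀ x ∉ Icc (-L) L, deriv f x = 0 := by
  intro x hx
  have : f =ᶠ[nhds x] fun _ => d := by
    filter_upwards [isClosed_Icc.isOpen_compl.mem_nhds hx] with y hy using h y hy
  rw [this.deriv_eq, deriv_const]

/-- Quadratic growth near a nondegenerate critical point. -/
theorem exists_quadratic_lower_bound {k k₁ : ℝ → ℝ} {q : ℝ} (hk : ∀ y, HasDerivAt k (k₁ y) y)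
    (h0 : k₁ 0 = 0) (hk₁ : HasDerivAt k₁ q 0) (hq : 0 < q) :
    ∃ δ > 0, ∀ y, |y| < δ → k 0 + q / 4 * y ^ 2 ≤ k y := by
  have hs := (hasDerivAt_iff_tendsto_slope.1 hk₁).eventually (lt_mem_nhds (half_lt_self hq))
  obtain ⟨δ, hδ, h⟩ := Metric.eventually_nhds_iff.1 (eventually_nhdsWithin_iff.1 hs)
  have h' : ∀ y, |y| < δ → 0 ≤ (k₁ y - q / 2 * y) * y := by
    intro y hy
    rcases eq_or_ne y 0 with rfl | hy0
    · simp
    have := h (by simpa using hy) hy0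
    rw [slope_def_field, h0, sub_zero, sub_zero] at this
    have h2 : 0 < y ^ 2 := by positivity
    have h3 : k₁ y * y = k₁ y / y * y ^ 2 := by field_simp
    nlinarith
  have hd : ∀ y, HasDerivAt (fun y => k y - q / 4 * y ^ 2) (k₁ y - q / 2 * y) y := fun y =>
    ((hk y).sub ((hasDerivAt_pow 2 y).const_mul (q / 4))).congr_deriv (by norm_num; ring)
  have hcont : Continuous (fun y => k y - q / 4 * y ^ 2) :=
    continuous_iff_continuousAt.2 fun y => (hd y).continuousAt
  refine ⟨δ, hδ, fun y hy => ?_⟩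
  obtain ⟨hy1, hy2⟩ := abs_lt.1 hy
  suffices h : k 0 - q / 4 * 0 ^ 2 ≤ k y - q / 4 * y ^ 2 by linarith
  rcases lt_trichotomy y 0 with h0 | h0 | h0
  · obtain ⟨ξ, hξ, he⟩ := exists_hasDerivAt_eq_slope (fun y => k y - q / 4 * y ^ 2) _ h0
      hcont.continuousOn fun x _ => hd x
    have h1 := h' ξ (abs_lt.2 ⟨hy1.trans hξ.1, hξ.2.trans hδ⟩)
    have h2 : k₁ ξ - q / 2 * ξ ≤ 0 := by
      by_contra! hc
      nlinarith [mul_neg_of_pos_of_neg hc hξ.2]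
    rw [he, div_le_iff₀ (by linarith)] at h2
    linarith
  · rw [h0]
  · obtain ⟨ξ, hξ, he⟩ := exists_hasDerivAt_eq_slope (fun y => k y - q / 4 * y ^ 2) _ h0
      hcont.continuousOn fun x _ => hd x
    have h1 := h' ξ (abs_lt.2 ⟨by linarith [hξ.1], hξ.2.trans hy2⟩)
    have h2 : 0 ≤ k₁ ξ - q / 2 * ξ := by
      by_contra! hc
      nlinarith [mul_neg_of_neg_of_pos hc hξ.1]
    rw [he, le_div_iff₀ (by linarith)] at h2
    linarith

theorem exists_shockProfile {a : ℝ → ℝ} {d L : ℝ}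
    (hsm : ContDiff ℝ (⊤ : ℕ∞) a) (hconst : ∀ x ∉ Icc (-L) L, a x = d) (hneg : deriv a 0 < 0)
    (hmin : ∀ x, deriv a 0 ≤ deriv a x) (huniq : ∀ x, deriv a x = deriv a 0 → x = 0)
    (hnd : 0 < iteratedDeriv 3 a 0) :
    ∃ M K c, ShockProfile a (deriv a) (deriv (deriv a)) (-(deriv a 0)⁻¹) M K c := by
  have hsm1 : ContDiff ℝ (⊤ : ℕ∞) (deriv a) := (contDiff_infty_iff_deriv.1 hsm).2
  have hsm2 : ContDiff ℝ (⊤ : ℕ∞) (deriv (deriv a)) := (contDiff_infty_iff_deriv.1 hsm1).2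
  have hsm3 : ContDiff ℝ (⊤ : ℕ∞) (deriv (deriv (deriv a))) := (contDiff_infty_iff_deriv.1 hsm2).2
  have hd : ∀ y, HasDerivAt a (deriv a y) y := fun y =>
    (hsm.differentiable (by simp) y).hasDerivAt
  have hd1 : ∀ y, HasDerivAt (deriv a) (deriv (deriv a) y) y := fun y =>
    (hsm1.differentiable (by simp) y).hasDerivAt
  have hd2 : ∀ y, HasDerivAt (deriv (deriv a)) (deriv (deriv (deriv a)) y) y := fun y =>
    (hsm2.differentiable (by simp) y).hasDerivAt
  have z1 := deriv_eq_zero_of_eq_const hconst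
  have z2 := deriv_eq_zero_of_eq_const z1
  have z3 := deriv_eq_zero_of_eq_const z2
  obtain ⟨M0, hM0⟩ := hsm.continuous.exists_abs_le_of_eq_const hconst
  obtain ⟨M1, hM1⟩ := hsm1.continuous.exists_abs_le_of_eq_const z1
  obtain ⟨M2, hM2⟩ := hsm2.continuous.exists_abs_le_of_eq_const z2
  obtain ⟨K, hK⟩ := hsm3.continuous.exists_abs_le_of_eq_const z3
  have hcrit : deriv (deriv a) 0 = 0 :=
    IsLocalMin.deriv_eq_zero (Filter.Eventually.of_forall hmin)
  have hnd' : 0 < deriv (deriv (deriv a)) 0 := by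
    simpa [iteratedDeriv_succ, iteratedDeriv_zero] using hnd
  obtain ⟨δ, hδ, hloc⟩ := exists_quadratic_lower_bound hd1 hcrit (hd2 0) hnd'
  set q := deriv (deriv (deriv a)) 0
  obtain ⟨m', hm', hcpt⟩ := ((isCompact_Icc (a := -L) (b := L)).inter_right
    (isClosed_le continuous_const continuous_abs : IsClosed {y : ℝ | δ ≤ |y|})).exists_forall_le'
    hsm1.continuous.continuousOn (a := deriv a 0) (fun y hy =>
      lt_of_le_of_ne (hmin y) fun h => by
        have h2 : δ ≤ |y| := hy.2
        rw [huniq y h.symm, abs_zero] at h2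
        linarith)
  have hT : -(-(deriv a 0)⁻¹)⁻¹ = deriv a 0 := by rw [inv_neg, inv_inv, neg_neg]
  refine ⟨max M0 (max M1 M2), K, min (q / 4) (min (m' - deriv a 0) (-deriv a 0)), ?_⟩
  have c1 : min (q / 4) (min (m' - deriv a 0) (-deriv a 0)) ≤ q / 4 := min_le_left _ _
  have c2 : min (q / 4) (min (m' - deriv a 0) (-deriv a 0)) ≤ m' - deriv a 0 :=
    (min_le_right _ _).trans (min_le_left _ _)
  have c3 : min (q / 4) (min (m' - deriv a 0) (-deriv a 0)) ≤ -deriv a 0 :=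
    (min_le_right _ _).trans (min_le_right _ _)
  have c0 : 0 < min (q / 4) (min (m' - deriv a 0) (-deriv a 0)) :=
    lt_min (by positivity) (lt_min (by linarith) (by linarith))
  set c := min (q / 4) (min (m' - deriv a 0) (-deriv a 0))
  refine ⟨neg_pos.2 (inv_lt_zero.2 hneg), c0, hd, hd1, hsm2.continuous,
    fun y => (hM0 y).trans (le_max_left _ _),
    fun y => (hM1 y).trans ((le_max_left _ _).trans (le_max_right _ _)),
    fun y => (hM2 y).trans ((le_max_right _ _).trans (le_max_right _ _)), fun y => ?_, fun y => ?_⟩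
  · rw [hT]
    have b1 : min 1 (y ^ 2) ≤ 1 := min_le_left _ _
    have b2 : min 1 (y ^ 2) ≤ y ^ 2 := min_le_right _ _
    have b3 : 0 ≤ min 1 (y ^ 2) := le_min zero_le_one (sq_nonneg y)
    by_cases hy : |y| < δ
    · have := hloc y hy
      nlinarith [mul_le_mul c1 b2 b3 (by positivity)]
    · by_cases hyL : y ∈ Icc (-L) L
      · have := hcpt y ⟨hyL, not_lt.1 hy⟩
        nlinarith
      · rw [z1 y hyL]
        nlinarith
  · rw [hT]
    have hL2 : ∀ x, |deriv (deriv a) x| ≤ K * |x| := fun x => by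
      have := convex_univ.norm_image_sub_le_of_norm_deriv_le (f := deriv (deriv a)) (C := K)
        (fun x _ => (hd2 x).differentiableAt) (fun x _ => hK x) (mem_univ 0) (mem_univ x)
      simpa [hcrit] using this
    have hball : ∀ x ∈ Metric.closedBall (0 : ℝ) |y|, ‖deriv (deriv a) x‖ ≤ K * |y| := by
      intro x hx
      have hx' : |x| ≤ |y| := by simpa using hx
      have hK0 : 0 ≤ K := (abs_nonneg _).trans (hK 0)
      exact (hL2 x).trans (by gcongr)
    have := (convex_closedBall (0 : ℝ) |y|).norm_image_sub_le_of_norm_deriv_le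
      (fun x _ => (hd1 x).differentiableAt) hball (x := 0) (y := y) (by simp) (by simp)
    rw [Real.norm_eq_abs, Real.norm_eq_abs, sub_zero, mul_assoc, abs_mul_abs_self] at this
    nlinarith [le_abs_self (deriv a y - deriv a 0)]

theorem gaussAvg_mono {F G : ℝ → ℝ} (hF : ExpGrowth F) (hG : ExpGrowth G) (h : ∀ y, F y ≤ G y)
    (σ x : ℝ) : gaussAvg F σ x ≤ gaussAvg G σ x :=
  integral_mono (hF.integrable_gauss x σ) (hG.integrable_gauss x σ) fun _ =>
    mul_le_mul_of_nonneg_right (h _) (Real.exp_pos _).le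

theorem gaussAvg_add {F G : ℝ → ℝ} (hF : ExpGrowth F) (hG : ExpGrowth G) (σ x : ℝ) :
    gaussAvg (fun y => F y + G y) σ x = gaussAvg F σ x + gaussAvg G σ x := by
  simp only [gaussAvg, add_mul]
  exact integral_add (hF.integrable_gauss x σ) (hG.integrable_gauss x σ)

theorem gaussAvg_const_mul (F : ℝ → ℝ) (c σ x : ℝ) :
    gaussAvg (fun y => c * F y) σ x = c * gaussAvg F σ x := by
  simp only [gaussAvg, mul_assoc, integral_const_mul]

/-- The initial datum of the heat equation in the Cole-Hopf transformation. -/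
noncomputable def coleHopfWeight (a : ℝ → ℝ) (ν y : ℝ) : ℝ :=
  Real.exp (-(1 / (2 * ν)) * ∫ r in (0 : ℝ)..y, a r)

/-- The Cole-Hopf solution of the viscous Burgers equation with datum `a` at time `0`. -/
noncomputable def coleHopf (a : ℝ → ℝ) (ν s x : ℝ) : ℝ :=
  gaussAvg (fun y => a y * coleHopfWeight a ν y) √(2 * ν * s) x /
    gaussAvg (coleHopfWeight a ν) √(2 * ν * s) x

/-- The formula for the space derivative of `coleHopf`; `a₁` is the derivative of `a`. -/
noncomputable def coleHopfDx (a a₁ : ℝ → ℝ) (ν s x : ℝ) : ℝ :=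
  (gaussAvg (fun y => (a₁ y + -(1 / (2 * ν)) * (a y * a y)) * coleHopfWeight a ν y) √(2 * ν * s) x
      * gaussAvg (coleHopfWeight a ν) √(2 * ν * s) x
    - -(1 / (2 * ν)) * gaussAvg (fun y => a y * coleHopfWeight a ν y) √(2 * ν * s) x ^ 2) /
    gaussAvg (coleHopfWeight a ν) √(2 * ν * s) x ^ 2

namespace ShockProfile

variable {a a₁ a₂ : ℝ → ℝ} {T M K c ν : ℝ}

theorem continuous (h : ShockProfile a a₁ a₂ T M K c) : Continuous a :=
  continuous_iff_continuousAt.2 fun y => (h.hasDerivAt y).continuousAt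

theorem continuous_fst (h : ShockProfile a a₁ a₂ T M K c) : Continuous a₁ :=
  continuous_iff_continuousAt.2 fun y => (h.hasDerivAt_deriv y).continuousAt

theorem expGrowth (h : ShockProfile a a₁ a₂ T M K c) : ExpGrowth a :=
  .of_bounded h.continuous h.abs_apply_le

theorem expGrowth_fst (h : ShockProfile a a₁ a₂ T M K c) : ExpGrowth a₁ :=
  .of_bounded h.continuous_fst h.abs_fst_le

theorem expGrowth_snd (h : ShockProfile a a₁ a₂ T M K c) : ExpGrowth a₂ :=
  .of_bounded h.continuous_snd h.abs_snd_le

theorem hasDerivAt_weight (h : ShockProfile a a₁ a₂ T M K c) (ν y : ℝ) :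
    HasDerivAt (coleHopfWeight a ν) (-(1 / (2 * ν)) * (a y * coleHopfWeight a ν y)) y := by
  have h1 := (h.continuous.integral_hasStrictDerivAt 0 y).hasDerivAt
  refine (h1.const_mul (-(1 / (2 * ν)))).exp.congr_deriv ?_
  simp only [coleHopfWeight]; ring

theorem expGrowth_weight (h : ShockProfile a a₁ a₂ T M K c) (ν : ℝ) :
    ExpGrowth (coleHopfWeight a ν) := by
  have hM : 0 ≤ M := (abs_nonneg _).trans (h.abs_apply_le 0)
  refine ⟨continuous_iff_continuousAt.2 fun y => (h.hasDerivAt_weight ν y).continuousAt,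
    1, |1 / (2 * ν)| * M, zero_le_one, by positivity, fun y => ?_⟩
  rw [coleHopfWeight, abs_of_pos (Real.exp_pos _), one_mul, Real.exp_le_exp, mul_assoc]
  have h1 : |∫ r in (0 : ℝ)..y, a r| ≤ M * |y| := by
    simpa using intervalIntegral.norm_integral_le_of_norm_le_const (a := (0 : ℝ)) (b := y)
      (C := M) (f := a) fun x _ => h.abs_apply_le x
  calc _ ≤ |-(1 / (2 * ν)) * ∫ r in (0 : ℝ)..y, a r| := le_abs_self _
    _ = |1 / (2 * ν)| * |∫ r in (0 : ℝ)..y, a r| := by rw [abs_mul, abs_neg]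
    _ ≤ _ := by gcongr

theorem hasDerivAt_mul_weight (h : ShockProfile a a₁ a₂ T M K c) {b : ℝ → ℝ} {b' y : ℝ}
    (hb : HasDerivAt b b' y) :
    HasDerivAt (fun y => b y * coleHopfWeight a ν y)
      ((b' + -(1 / (2 * ν)) * (a y * b y)) * coleHopfWeight a ν y) y :=
  (hb.mul (h.hasDerivAt_weight ν y)).congr_deriv (by ring)

theorem gaussAvg_weight_pos (h : ShockProfile a a₁ a₂ T M K c) (ν σ x : ℝ) :
    0 < gaussAvg (coleHopfWeight a ν) σ x := by
  have h1 := (h.expGrowth_weight ν).integrable_gauss x σ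
  simp only [gaussAvg, coleHopfWeight, ← Real.exp_add] at h1 ⊢
  exact integral_exp_pos h1

theorem abs_coleHopf_le (h : ShockProfile a a₁ a₂ T M K c) (ν s x : ℝ) :
    |coleHopf a ν s x| ≤ M := by
  have hP := h.gaussAvg_weight_pos ν √(2 * ν * s) x
  have hw := h.expGrowth_weight ν
  have hw0 : ∀ y, 0 ≤ coleHopfWeight a ν y := fun y => (Real.exp_pos _).le
  rw [coleHopf, abs_div, abs_of_pos hP, div_le_iff₀ hP, abs_le, ← neg_mul, ← gaussAvg_const_mul,
    ← gaussAvg_const_mul]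
  exact ⟨gaussAvg_mono (hw.const_mul _) (h.expGrowth.mul hw) (fun y =>
      mul_le_mul_of_nonneg_right (abs_le.1 (h.abs_apply_le y)).1 (hw0 y)) _ _,
    gaussAvg_mono (h.expGrowth.mul hw) (hw.const_mul _) (fun y =>
      mul_le_mul_of_nonneg_right (abs_le.1 (h.abs_apply_le y)).2 (hw0 y)) _ _⟩

theorem coleHopf_zero (h : ShockProfile a a₁ a₂ T M K c) (ν x : ℝ) :
    coleHopf a ν 0 x = a x := by
  have hP := h.gaussAvg_weight_pos ν √(2 * ν * 0) x
  rw [coleHopf, div_eq_iff hP.ne']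
  simp [gaussAvg, mul_assoc, integral_const_mul]

theorem continuous_coleHopf (h : ShockProfile a a₁ a₂ T M K c) (ν : ℝ) :
    Continuous (fun p : ℝ × ℝ => coleHopf a ν p.1 p.2) := by
  have hw := h.expGrowth_weight ν
  have hφ : Continuous (fun p : ℝ × ℝ => (√(2 * ν * p.1), p.2)) := by fun_prop
  exact ((h.expGrowth.mul hw).continuous_gaussAvg.comp hφ).div
    (hw.continuous_gaussAvg.comp hφ) fun p => (h.gaussAvg_weight_pos ν _ _).ne'

theorem hasDerivAt_coleHopf_right (h : ShockProfile a a₁ a₂ T M K c) (ν s x : ℝ) :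
    HasDerivAt (coleHopf a ν s) (coleHopfDx a a₁ ν s x) x := by
  have hw := h.expGrowth_weight ν
  have hP := h.gaussAvg_weight_pos ν √(2 * ν * s) x
  have ha := h.expGrowth
  have hb := h.expGrowth_fst.add ((ha.mul ha).const_mul (-(1 / (2 * ν))))
  have d1 := hw.hasDerivAt_gaussAvg_right ((ha.mul hw).const_mul _) (h.hasDerivAt_weight ν)
    √(2 * ν * s) x
  have d2 := (ha.mul hw).hasDerivAt_gaussAvg_right (hb.mul hw)
    (fun y => h.hasDerivAt_mul_weight (h.hasDerivAt y)) √(2 * ν * s) x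
  rw [gaussAvg_const_mul] at d1
  refine (d2.div d1 hP.ne').congr_deriv ?_
  rw [coleHopfDx]; congr 1; ring

/-- The Cole-Hopf formula solves the viscous Burgers equation. -/
theorem coleHopf_pde (h : ShockProfile a a₁ a₂ T M K c) (hν : 0 < ν) {s : ℝ} (hs : 0 < s) (x : ℝ) :
    ∃ p q : ℝ, HasDerivAt (fun s => coleHopf a ν s x) p s ∧
      HasDerivAt (coleHopfDx a a₁ ν s) q x ∧
      p = ν * q - coleHopf a ν s x * coleHopfDx a a₁ ν s x := by
  have hw := h.expGrowth_weight ν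
  have hP := h.gaussAvg_weight_pos ν √(2 * ν * s) x
  have ha := h.expGrowth
  have ha1 := h.expGrowth_fst
  have hb := ha1.add ((ha.mul ha).const_mul (-(1 / (2 * ν))))
  have hb2 := (h.expGrowth_snd.add (((ha1.mul ha).add (ha.mul ha1)).const_mul (-(1 / (2 * ν))))).add
    ((ha.mul hb).const_mul (-(1 / (2 * ν))))
  have e1 := h.hasDerivAt_weight ν
  have e2 := fun y => h.hasDerivAt_mul_weight (ν := ν) (h.hasDerivAt y)
  have e3 := fun y => h.hasDerivAt_mul_weight (ν := ν) ((h.hasDerivAt_deriv y).add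
    (((h.hasDerivAt y).mul (h.hasDerivAt y)).const_mul (-(1 / (2 * ν)))))
  have dP := hw.hasDerivAt_gaussAvg_right ((ha.mul hw).const_mul _) e1 √(2 * ν * s) x
  have dQ := (ha.mul hw).hasDerivAt_gaussAvg_right (hb.mul hw) e2 √(2 * ν * s) x
  have dR := (hb.mul hw).hasDerivAt_gaussAvg_right (hb2.mul hw) e3 √(2 * ν * s) x
  have tP := hw.hasDerivAt_gaussAvg_sqrt ((ha.mul hw).const_mul _) ((hb.mul hw).const_mul _) e1
    (fun y => (e2 y).const_mul _) hν hs x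
  have tQ := (ha.mul hw).hasDerivAt_gaussAvg_sqrt (hb.mul hw) (hb2.mul hw) e2 e3 hν hs x
  rw [gaussAvg_const_mul] at dP tP
  refine ⟨_, _, tQ.div tP hP.ne', ((dR.mul dP).sub ((dQ.pow 2).const_mul _)).div (dP.pow 2)
    (pow_ne_zero 2 hP.ne'), ?_⟩
  simp only [coleHopf, coleHopfDx, Pi.mul_apply, Pi.pow_apply, Pi.sub_apply]
  generalize gaussAvg (coleHopfWeight a ν) √(2 * ν * s) x = P at hP ⊢
  generalize gaussAvg (fun y => a y * coleHopfWeight a ν y) √(2 * ν * s) x = Q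
  generalize gaussAvg (fun y => (a₁ y + -(1 / (2 * ν)) * (a y * a y)) * coleHopfWeight a ν y)
    √(2 * ν * s) x = R
  generalize gaussAvg _ √(2 * ν * s) x = S
  field_simp
  ring

theorem le_deriv_characteristic (h : ShockProfile a a₁ a₂ T M K c) {s : ℝ} (hs : 0 ≤ s)
    (hsT : s ≤ T) (y : ℝ) : min 1 (c * T) * min 1 (y ^ 2) ≤ 1 + s * a₁ y := by
  have hT := h.T_pos
  have hc := h.c_pos
  have h1 : 0 ≤ min 1 (y ^ 2) := le_min zero_le_one (sq_nonneg y)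
  have h2 : min 1 (y ^ 2) ≤ 1 := min_le_left _ _
  have h3 : min 1 (c * T) ≤ 1 := min_le_left _ _
  have h4 : min 1 (c * T) ≤ c * T := min_le_right _ _
  have h5 : 0 ≤ min 1 (c * T) := le_min zero_le_one (by positivity)
  rcases le_total 0 (a₁ y) with h0 | h0
  · nlinarith [mul_nonneg hs h0]
  · have h6 := mul_le_mul_of_nonneg_left (h.lower y) hT.le
    have h7 : T * (-T⁻¹ + c * min 1 (y ^ 2)) = -1 + c * T * min 1 (y ^ 2) := by
      field_simp
    nlinarith

theorem hasDerivAt_characteristic (h : ShockProfile a a₁ a₂ T M K c) (s y : ℝ) :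
    HasDerivAt (fun y => y + s * a y) (1 + s * a₁ y) y :=
  (hasDerivAt_id y).add ((h.hasDerivAt y).const_mul s)

/-- The characteristics separate at least cubically, up to and including the shock time. -/
theorem characteristic_sub_lower (h : ShockProfile a a₁ a₂ T M K c) {s : ℝ} (hs : 0 ≤ s)
    (hsT : s ≤ T) (y y' : ℝ) :
    min 1 (c * T) / 64 * ((y - y') ^ 2 * min 1 ((y - y') ^ 2)) ≤
      (y - y') * (y + s * a y - (y' + s * a y')) := by
  wlog hyy : y' < y generalizing y y'
  · rcases (not_lt.1 hyy).eq_or_lt with he | hl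
    · subst he; simp
    · have := this y' y hl
      rw [← neg_sub y y', neg_sq] at this
      linarith
  have hT := h.T_pos
  have hc := h.c_pos
  set k := min 1 (c * T)
  have hk : 0 ≤ k := le_min zero_le_one (by positivity)
  set X : ℝ → ℝ := fun y => y + s * a y with hX
  have hder := h.hasDerivAt_characteristic s
  have hcont : Continuous X := continuous_iff_continuousAt.2 fun y => (hder y).continuousAt
  have hgrow : ∀ m p q, p < q → 0 ≤ m → (∀ η ∈ Ioo p q, m ≤ min 1 (η ^ 2)) →
      k * m * (q - p) ≤ X q - X p := by
    intro m p q hpq hm hη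
    obtain ⟨ξ, hξ, he⟩ := exists_hasDerivAt_eq_slope X _ hpq hcont.continuousOn fun x _ => hder x
    have h1 := h.le_deriv_characteristic hs hsT ξ
    rw [he, le_div_iff₀ (by linarith)] at h1
    refine le_trans ?_ h1
    have : 0 ≤ q - p := by linarith
    gcongr
    exact hη ξ hξ
  have hmono : ∀ p q, p < q → 0 ≤ X q - X p := fun p q hpq => by
    simpa using hgrow 0 p q hpq le_rfl fun η _ => le_min zero_le_one (sq_nonneg η)
  set d := y - y' with hd
  have hd0 : 0 < d := by linarith
  set m := min 1 (d ^ 2 / 16) with hm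
  have hm0 : 0 ≤ m := le_min zero_le_one (by positivity)
  have key : k * m * (d / 4) ≤ X y - X y' := by
    rcases le_total 0 (y + y') with h0 | h0
    · have h1 := hgrow m (y - d / 4) y (by linarith) hm0 fun η hη => by
        refine min_le_min le_rfl ?_
        nlinarith [hη.1]
      have h2 := hmono y' (y - d / 4) (by linarith)
      rw [sub_sub_cancel] at h1
      linarith
    · have h1 := hgrow m y' (y' + d / 4) (by linarith) hm0 fun η hη => by
        refine min_le_min le_rfl ?_
        nlinarith [hη.2]
      have h2 := hmono (y' + d / 4) y (by linarith)
      rw [add_sub_cancel_left] at h1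
      linarith
  have hmm : min 1 (d ^ 2) / 16 ≤ m :=
    le_min (by linarith [min_le_left 1 (d ^ 2)]) (by linarith [min_le_right 1 (d ^ 2)])
  calc k / 64 * (d ^ 2 * min 1 (d ^ 2)) = d * (k * (min 1 (d ^ 2) / 16) * (d / 4)) := by ring
    _ ≤ d * (k * m * (d / 4)) := by gcongr
    _ ≤ d * (X y - X y') := by gcongr

/-- Gaussian integration by parts against the Cole-Hopf weight. -/
theorem gaussAvg_virial (h : ShockProfile a a₁ a₂ T M K c) (hν : 0 < ν) {s : ℝ} (hs : 0 ≤ s)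
    (x y' : ℝ) :
    gaussAvg (fun y => (y - y') * (y + s * a y - x) * coleHopfWeight a ν y) √(2 * ν * s) x
      = 2 * ν * s * gaussAvg (coleHopfWeight a ν) √(2 * ν * s) x := by
  have hw := h.expGrowth_weight ν
  have ha := h.expGrowth
  have hd := ExpGrowth.id_sub y'
  have h1 := (ExpGrowth.of_bounded (M := 1) (F := fun _ => 1) continuous_const (by simp)).add
    ((ha.mul hd).const_mul (-(1 / (2 * ν))))
  have key := (hd.mul hw).integral_mul_gauss (h1.mul hw)
    (fun y => h.hasDerivAt_mul_weight (ν := ν) ((hasDerivAt_id y).sub_const y')) √(2 * ν * s) x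
  set σ := √(2 * ν * s) with hσ
  have hσ2 : σ * σ = 2 * ν * s := Real.mul_self_sqrt (by positivity)
  have e1 : gaussAvg (fun y => (y - x) * ((y - y') * coleHopfWeight a ν y)) σ x
      = 2 * ν * s *
        gaussAvg (fun y => (1 + -(1 / (2 * ν)) * (a y * (y - y'))) * coleHopfWeight a ν y) σ x := by
    rw [← hσ2, mul_assoc, ← key, gaussAvg, ← integral_const_mul]
    congr 1; ext z; ring
  have e2 : (fun y => (1 + -(1 / (2 * ν)) * (a y * (y - y'))) * coleHopfWeight a ν y) =
      fun y => coleHopfWeight a ν y +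
        -(1 / (2 * ν)) * (a y * (y - y') * coleHopfWeight a ν y) := by
    ext y; ring
  have e3 : (fun y => (y - y') * (y + s * a y - x) * coleHopfWeight a ν y) =
      fun y => (y - x) * ((y - y') * coleHopfWeight a ν y) +
        s * (a y * (y - y') * coleHopfWeight a ν y) := by
    ext y; ring
  rw [e3, gaussAvg_add ((ExpGrowth.id_sub x).mul (hd.mul hw)) (((ha.mul hd).mul hw).const_mul s),
    e1, e2, gaussAvg_add hw (((ha.mul hd).mul hw).const_mul _), gaussAvg_const_mul,
    gaussAvg_const_mul]
  field_simp
  ring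

/-- The constant in the second moment bound. -/
noncomputable def _root_.momentConst (T c : ℝ) : ℝ := 1 + 128 * T / min 1 (c * T)

theorem gaussAvg_second_moment (h : ShockProfile a a₁ a₂ T M K c) {β : ℝ} (hβ : 0 < β)
    (hβ1 : β ≤ 1) {s : ℝ} (hs : 0 ≤ s) (hsT : s ≤ T) (y' : ℝ) :
    gaussAvg (fun y => (y - y') ^ 2 * coleHopfWeight a (β ^ 4) y) √(2 * β ^ 4 * s) (y' + s * a y')
      ≤ momentConst T c * β ^ 2 *
        gaussAvg (coleHopfWeight a (β ^ 4)) √(2 * β ^ 4 * s) (y' + s * a y') := by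
  have hν : 0 < β ^ 4 := by positivity
  have hw := h.expGrowth_weight (β ^ 4)
  have ha := h.expGrowth
  have hd := ExpGrowth.id_sub y'
  have hT := h.T_pos
  have hc := h.c_pos
  have hP := h.gaussAvg_weight_pos (β ^ 4) √(2 * β ^ 4 * s) (y' + s * a y')
  have hvir := h.gaussAvg_virial hν hs (y' + s * a y') y'
  set x := y' + s * a y' with hx
  set σ := √(2 * β ^ 4 * s)
  set k := min 1 (c * T) with hk
  have hk0 : 0 < k := lt_min one_pos (by positivity)
  have g1 : ExpGrowth fun y => (y - y') ^ 2 * coleHopfWeight a (β ^ 4) y := by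
    simpa [sq] using (hd.mul hd).mul hw
  have g2 : ExpGrowth fun y => (y - y') * (y + s * a y - x) * coleHopfWeight a (β ^ 4) y := by
    have : (fun y => (y - y') * (y + s * a y - x) * coleHopfWeight a (β ^ 4) y) =
      fun y => (y - y') * ((y - x) + s * a y) * coleHopfWeight a (β ^ 4) y := by ext y; ring
    rw [this]
    exact (hd.mul ((ExpGrowth.id_sub x).add (ha.const_mul s))).mul hw
  have key := gaussAvg_mono (g1.const_mul (β ^ 2)) ((hw.const_mul (β ^ 4)).add
    (g2.const_mul (64 / k))) (fun y => by
      have h1 := h.characteristic_sub_lower hs hsT y y'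
      have h2 : (y - y') ^ 2 * min 1 ((y - y') ^ 2) ≤ 64 / k * ((y - y') * (y + s * a y - x)) := by
        rw [div_mul_eq_mul_div, le_div_iff₀ hk0]
        linarith
      have h3 : β ^ 2 * (y - y') ^ 2 ≤ β ^ 4 + (y - y') ^ 2 * min 1 ((y - y') ^ 2) := by
        rcases le_total 1 ((y - y') ^ 2) with h4 | h4
        · rw [min_eq_left h4]
          nlinarith [sq_nonneg (y - y'), pow_le_one₀ hβ.le hβ1 (n := 2)]
        · rw [min_eq_right h4]
          nlinarith [sq_nonneg (β ^ 2 - (y - y') ^ 2), sq_nonneg (β ^ 2 + (y - y') ^ 2)]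
      have h5 := mul_le_mul_of_nonneg_right (h3.trans (add_le_add_right h2 _))
        (Real.exp_pos (-(1 / (2 * β ^ 4)) * ∫ r in (0 : ℝ)..y, a r)).le
      simp only [coleHopfWeight]
      linarith) σ x
  rw [gaussAvg_const_mul, gaussAvg_add (hw.const_mul _) (g2.const_mul _), gaussAvg_const_mul,
    gaussAvg_const_mul, hvir] at key
  set P := gaussAvg (coleHopfWeight a (β ^ 4)) σ x
  have h6 : 64 / k * (2 * β ^ 4 * s * P) ≤ 64 / k * (2 * β ^ 4 * T * P) := by gcongr
  have h7 : β ^ 4 * P + 64 / k * (2 * β ^ 4 * T * P) =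
      β ^ 2 * (momentConst T c * β ^ 2 * P) := by
    rw [momentConst, ← hk]; ring
  exact le_of_mul_le_mul_left (by linarith) (by positivity : 0 < β ^ 2)

theorem abs_sub_le (h : ShockProfile a a₁ a₂ T M K c) (y y' : ℝ) : |a y - a y'| ≤ M * |y - y'| :=
  convex_univ.norm_image_sub_le_of_norm_deriv_le (fun x _ => (h.hasDerivAt x).differentiableAt)
    (fun x _ => by rw [(h.hasDerivAt x).deriv]; exact h.abs_fst_le x) (mem_univ y') (mem_univ y)

/-- Rate of convergence of the Cole-Hopf solution along characteristics. -/
theorem abs_coleHopf_sub_le (h : ShockProfile a a₁ a₂ T M K c) {β : ℝ} (hβ : 0 < β)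
    (hβ1 : β ≤ 1) {s : ℝ} (hs : 0 ≤ s) (hsT : s ≤ T) (y' : ℝ) :
    |coleHopf a (β ^ 4) s (y' + s * a y') - a y'| ≤ M * (1 + momentConst T c) / 2 * β := by
  have hmom := h.gaussAvg_second_moment hβ hβ1 hs hsT y'
  have hP := h.gaussAvg_weight_pos (β ^ 4) √(2 * β ^ 4 * s) (y' + s * a y')
  have hw := h.expGrowth_weight (β ^ 4)
  have hM : 0 ≤ M := (abs_nonneg _).trans (h.abs_apply_le 0)
  have hd := ExpGrowth.id_sub y'
  have g1 : ExpGrowth fun y => (y - y') ^ 2 * coleHopfWeight a (β ^ 4) y := by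
    simpa [sq] using (hd.mul hd).mul hw
  rw [coleHopf]
  set x := y' + s * a y'
  set σ := √(2 * β ^ 4 * s)
  set P := gaussAvg (coleHopfWeight a (β ^ 4)) σ x with hPdef
  set Q := gaussAvg (fun y => a y * coleHopfWeight a (β ^ 4) y) σ x with hQdef
  set D := gaussAvg (fun y => (y - y') ^ 2 * coleHopfWeight a (β ^ 4) y) σ x with hDdef
  have hpt : ∀ y, |a y - a y'| * coleHopfWeight a (β ^ 4) y ≤
      M / (2 * β) * (β ^ 2 * coleHopfWeight a (β ^ 4) y
        + (y - y') ^ 2 * coleHopfWeight a (β ^ 4) y) := fun y => by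
    have h1 : |y - y'| ≤ (β ^ 2 + (y - y') ^ 2) / (2 * β) := by
      rw [le_div_iff₀ (by positivity), ← sq_abs (y - y')]
      nlinarith [sq_nonneg (β - |y - y'|)]
    have h2 := (h.abs_sub_le y y').trans (mul_le_mul_of_nonneg_left h1 hM)
    have h3 := mul_le_mul_of_nonneg_right h2
      (Real.exp_pos (-(1 / (2 * β ^ 4)) * ∫ r in (0 : ℝ)..y, a r)).le
    refine h3.trans (le_of_eq ?_)
    simp only [coleHopfWeight]
    ring
  have hG := ((hw.const_mul (β ^ 2)).add g1).const_mul (M / (2 * β))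
  have hGv : gaussAvg (fun y => M / (2 * β) * (β ^ 2 * coleHopfWeight a (β ^ 4) y
        + (y - y') ^ 2 * coleHopfWeight a (β ^ 4) y)) σ x = M / (2 * β) * (β ^ 2 * P + D) := by
    rw [gaussAvg_const_mul, gaussAvg_add (hw.const_mul _) g1, gaussAvg_const_mul]
  have hw0 : ∀ y, 0 < coleHopfWeight a (β ^ 4) y := fun y => Real.exp_pos _
  have haw := h.expGrowth.mul hw
  have up := gaussAvg_mono haw ((hw.const_mul (a y')).add hG) (fun y => by
    nlinarith [hpt y, le_abs_self (a y - a y'), hw0 y]) σ x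
  have lo := gaussAvg_mono (hw.const_mul (a y')) (haw.add hG) (fun y => by
    nlinarith [hpt y, neg_abs_le (a y - a y'), hw0 y]) σ x
  rw [gaussAvg_add (hw.const_mul _) hG, gaussAvg_const_mul, hGv] at up
  rw [gaussAvg_add haw hG, gaussAvg_const_mul, hGv] at lo
  have hfin : M / (2 * β) * (β ^ 2 * P + D) ≤ M * (1 + momentConst T c) / 2 * β * P := by
    calc _ ≤ M / (2 * β) * (β ^ 2 * P + momentConst T c * β ^ 2 * P) := by gcongr
      _ = _ := by field_simp
  have e1 : Q / P - a y' = (Q - a y' * P) / P := by field_simp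
  rw [e1, abs_div, abs_of_pos hP, div_le_iff₀ hP, abs_le]
  exact ⟨by linarith, by linarith⟩

/-- The Cole-Hopf solution has slope at least of order `-ν^(-1/2)`. -/
theorem coleHopfDx_lower (h : ShockProfile a a₁ a₂ T M K c) {β : ℝ} (hβ : 0 < β)
    (hβ1 : β ≤ 1) {s : ℝ} (hs : 0 ≤ s) (hsT : s ≤ T) (y' : ℝ) :
    -((M + M ^ 2 * momentConst T c / 2) / β ^ 2) ≤
      coleHopfDx a a₁ (β ^ 4) s (y' + s * a y') := by
  have hmom := h.gaussAvg_second_moment hβ hβ1 hs hsT y'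
  have hP := h.gaussAvg_weight_pos (β ^ 4) √(2 * β ^ 4 * s) (y' + s * a y')
  have hw := h.expGrowth_weight (β ^ 4)
  have hM : 0 ≤ M := (abs_nonneg _).trans (h.abs_apply_le 0)
  have hd := ExpGrowth.id_sub y'
  have ha := h.expGrowth
  have ha1 := h.expGrowth_fst
  have g1 : ExpGrowth fun y => (y - y') ^ 2 * coleHopfWeight a (β ^ 4) y := by
    simpa [sq] using (hd.mul hd).mul hw
  have hw0 : ∀ y, 0 < coleHopfWeight a (β ^ 4) y := fun y => Real.exp_pos _
  rw [coleHopfDx]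
  set x := y' + s * a y'
  set σ := √(2 * β ^ 4 * s)
  set P := gaussAvg (coleHopfWeight a (β ^ 4)) σ x with hPdef
  set Q := gaussAvg (fun y => a y * coleHopfWeight a (β ^ 4) y) σ x with hQdef
  set D := gaussAvg (fun y => (y - y') ^ 2 * coleHopfWeight a (β ^ 4) y) σ x with hDdef
  have haw := ha.mul hw
  set R₂ := gaussAvg (fun y => a y * (a y * coleHopfWeight a (β ^ 4) y)) σ x with hR2
  have hR : gaussAvg (fun y => (a₁ y + -(1 / (2 * β ^ 4)) * (a y * a y)) *
      coleHopfWeight a (β ^ 4) y) σ x =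
      gaussAvg (fun y => a₁ y * coleHopfWeight a (β ^ 4) y) σ x + -(1 / (2 * β ^ 4)) * R₂ := by
    rw [hR2, ← gaussAvg_const_mul, ← gaussAvg_add (ha1.mul hw) ((ha.mul haw).const_mul _)]
    congr 1; ext y; ring
  have hR1 := gaussAvg_mono (hw.const_mul (-M)) (ha1.mul hw) (fun y =>
    mul_le_mul_of_nonneg_right (abs_le.1 (h.abs_fst_le y)).1 (hw0 y).le) σ x
  rw [gaussAvg_const_mul] at hR1
  have hV := gaussAvg_mono (((ha.mul haw).add (haw.const_mul (-(2 * a y')))).add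
    (hw.const_mul (a y' ^ 2))) (g1.const_mul (M ^ 2)) (fun y => by
      have h1 := sq_le_sq' (neg_le_of_abs_le (h.abs_sub_le y y') |>.trans' le_rfl)
        (le_of_abs_le (h.abs_sub_le y y'))
      rw [mul_pow, sq_abs] at h1
      nlinarith [hw0 y]) σ x
  rw [gaussAvg_add ((ha.mul haw).add (haw.const_mul _)) (hw.const_mul _),
    gaussAvg_add (ha.mul haw) (haw.const_mul _), gaussAvg_const_mul, gaussAvg_const_mul,
    gaussAvg_const_mul] at hV
  rw [hR, le_div_iff₀ (by positivity)]
  set R₁ := gaussAvg (fun y => a₁ y * coleHopfWeight a (β ^ 4) y) σ x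
  have hvar : R₂ * P - Q ^ 2 ≤ M ^ 2 * (momentConst T c * β ^ 2 * P) * P := by
    have h1 : R₂ + -(2 * a y') * Q + a y' ^ 2 * P ≤ M ^ 2 * (momentConst T c * β ^ 2 * P) :=
      hV.trans (by gcongr)
    nlinarith [mul_le_mul_of_nonneg_right h1 hP.le, sq_nonneg (Q - a y' * P)]
  have h2 : 1 / (2 * β ^ 4) * (R₂ * P - Q ^ 2) ≤ M ^ 2 * momentConst T c / 2 / β ^ 2 * P ^ 2 := by
    calc _ ≤ 1 / (2 * β ^ 4) * (M ^ 2 * (momentConst T c * β ^ 2 * P) * P) := by gcongr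
      _ = _ := by field_simp
  have h3 : -(M / β ^ 2) * P ^ 2 ≤ R₁ * P := by
    have h4 : M ≤ M / β ^ 2 := le_div_self hM (by positivity) (pow_le_one₀ hβ.le hβ1)
    nlinarith [mul_le_mul_of_nonneg_right hR1 hP.le, sq_nonneg P]
  rw [add_div]
  linarith

theorem exists_characteristic_eq (h : ShockProfile a a₁ a₂ T M K c) {s : ℝ} (hs : 0 ≤ s)
    (x : ℝ) : ∃ y, y + s * a y = x := by
  have hc := h.continuous
  have hl := fun y => (abs_le.1 (h.abs_apply_le y)).1
  have hu := fun y => (abs_le.1 (h.abs_apply_le y)).2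
  refine mem_range_of_exists_le_of_exists_ge (by fun_prop) ⟨x - s * M, ?_⟩ ⟨x + s * M, ?_⟩
  · nlinarith [hu (x - s * M)]
  · nlinarith [hl (x + s * M)]

/-- Lower bound for the growth of the Cole-Hopf solution between two points. -/
theorem coleHopf_sub_lower (h : ShockProfile a a₁ a₂ T M K c) {β : ℝ} (hβ : 0 < β)
    (hβ1 : β ≤ 1) {s : ℝ} (hs : 0 ≤ s) (hsT : s ≤ T) {x₁ x₂ : ℝ} (hx : x₁ ≤ x₂) :
    -((M + M ^ 2 * momentConst T c / 2) / β ^ 2) * (x₂ - x₁) ≤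
      coleHopf a (β ^ 4) s x₂ - coleHopf a (β ^ 4) s x₁ := by
  have hd := h.hasDerivAt_coleHopf_right (β ^ 4) s
  refine mul_sub_le_image_sub_of_le_deriv (fun x => (hd x).differentiableAt) (fun x => ?_) hx
  rw [(hd x).deriv]
  obtain ⟨y, rfl⟩ := h.exists_characteristic_eq hs x
  exact h.coleHopfDx_lower hβ hβ1 hs hsT y

/-- Bounded classical solutions of the viscous Burgers equation are given by the Cole-Hopf
formula. -/
theorem eq_coleHopf (h : ShockProfile a a₁ a₂ T M K c) (hν : 0 < ν) {t₀ B B₁ : ℝ}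
    {u : ℝ → ℝ → ℝ}
    (hsmooth : ContDiffOn ℝ (⊤ : ℕ∞) (fun p : ℝ × ℝ => u p.1 p.2) (Ico t₀ 0 ×ˢ univ))
    (hpde : ∀ t ∈ Ico t₀ (0 : ℝ), ∀ x : ℝ, deriv (fun s => u s x) t
      = ν * deriv (deriv (fun y => u t y)) x - u t x * deriv (fun y => u t y) x)
    (hinit : ∀ x, u t₀ x = a x) (hB : ∀ t ∈ Ico t₀ 0, ∀ x, |u t x| ≤ B)
    (hB₁ : ∀ t ∈ Ico t₀ 0, ∀ x, |deriv (u t) x| ≤ B₁) {t : ℝ} (ht : t ∈ Ico t₀ 0) (x : ℝ) :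
    u t x = coleHopf a ν (t - t₀) x := by
  have hut : ∀ r ∈ Ioc t₀ t, ∀ x, HasDerivAt (fun s => u s x) (deriv (fun s => u s x) r) r := by
    intro r hr x
    have hnhds : Ico t₀ 0 ×ˢ (univ : Set ℝ) ∈ nhds (r, x) :=
      prod_mem_nhds (Ico_mem_nhds hr.1 (hr.2.trans_lt ht.2)) Filter.univ_mem
    have hD := (hsmooth.contDiffAt hnhds).differentiableAt (by simp)
    exact (hD.comp r (f := fun s : ℝ => (s, x)) (by fun_prop)).hasDerivAt
  have hus : ∀ r ∈ Ioc t₀ t, ContDiff ℝ (⊤ : ℕ∞) (u r) := by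
    intro r hr
    have hmem : r ∈ Ico t₀ 0 := ⟨hr.1.le, hr.2.trans_lt ht.2⟩
    exact contDiffOn_univ.1 (hsmooth.comp (f := fun y : ℝ => (r, y))
      (by fun_prop : ContDiff ℝ (⊤ : ℕ∞) fun y : ℝ => (r, y)).contDiffOn
      fun y _ => ⟨hmem, mem_univ y⟩)
  have hux : ∀ r ∈ Ioc t₀ t, ∀ x, HasDerivAt (u r) (deriv (u r) x) x := fun r hr x =>
    ((hus r hr).differentiable (by simp) x).hasDerivAt
  have huxx : ∀ r ∈ Ioc t₀ t, ∀ x, HasDerivAt (deriv (u r)) (deriv (deriv (u r)) x) x :=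
    fun r hr x =>
      ((contDiff_infty_iff_deriv.1 (hus r hr)).2.differentiable (by simp) x).hasDerivAt
  have hex : ∀ r x, ∃ pq : ℝ × ℝ, t₀ < r →
      HasDerivAt (fun s => coleHopf a ν (s - t₀) x) pq.1 r ∧
      HasDerivAt (coleHopfDx a a₁ ν (r - t₀)) pq.2 x ∧
      pq.1 = ν * pq.2 - coleHopf a ν (r - t₀) x * coleHopfDx a a₁ ν (r - t₀) x := by
    intro r x
    by_cases hr : t₀ < r
    · obtain ⟨p, q, hp, hq, he⟩ := h.coleHopf_pde hν (sub_pos.2 hr) x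
      exact ⟨(p, q), fun _ => ⟨hp.comp_sub_const r t₀, hq, he⟩⟩
    · exact ⟨0, fun hr' => absurd hr' hr⟩
  choose pq hpq using hex
  have hcont : ContinuousOn (fun p : ℝ × ℝ => u p.1 p.2) (Icc t₀ t ×ˢ univ) :=
    hsmooth.continuousOn.mono (prod_mono (fun r hr => ⟨hr.1, hr.2.trans_lt ht.2⟩) le_rfl)
  have hcont' : Continuous (fun p : ℝ × ℝ => coleHopf a ν (p.1 - t₀) p.2) :=
    (h.continuous_coleHopf ν).comp (f := fun p : ℝ × ℝ => (p.1 - t₀, p.2)) (by fun_prop)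
  have hmem : ∀ r ∈ Icc t₀ t, r ∈ Ico t₀ 0 := fun r hr => ⟨hr.1, hr.2.trans_lt ht.2⟩
  have hv : ∀ r x, |coleHopf a ν r x| ≤ M := h.abs_coleHopf_le ν
  have hvx := fun r => h.hasDerivAt_coleHopf_right ν (r - t₀)
  have hbK : ∀ r ∈ Ioc t₀ t, ∀ x, |coleHopf a ν (r - t₀) x| ≤ max M B₁ := fun r _ x =>
    (hv _ x).trans (le_max_left _ _)
  have hcK : ∀ r ∈ Ioc t₀ t, ∀ x, |deriv (u r) x| ≤ max M B₁ := fun r hr x =>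
    (hB₁ r (hmem r (Ioc_subset_Icc_self hr)) x).trans (le_max_right _ _)
  have hle := parabolic_max_principle hν (M := B + M) (hcont.sub hcont'.continuousOn)
    (fun r hr x => (le_abs_self _).trans ((abs_sub _ _).trans
      (add_le_add (hB r (hmem r hr) x) (hv _ x))))
    (fun r hr x => (hut r hr x).sub (hpq r x hr.1).1) (fun r hr x => (hux r hr x).sub (hvx r x))
    (fun r hr x => (huxx r hr x).sub (hpq r x hr.1).2.1)
    (fun r hr x => by
      rw [hpde r (hmem r (Ioc_subset_Icc_self hr)) x, (hpq r x hr.1).2.2]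
      exact le_of_eq (by ring)) hbK hcK (fun x => by simp [hinit, h.coleHopf_zero])
  have hge := parabolic_max_principle hν (M := M + B) (hcont'.continuousOn.sub hcont)
    (fun r hr x => (le_abs_self _).trans ((abs_sub _ _).trans
      (add_le_add (hv _ x) (hB r (hmem r hr) x))))
    (fun r hr x => (hpq r x hr.1).1.sub (hut r hr x)) (fun r hr x => (hvx r x).sub (hux r hr x))
    (fun r hr x => (hpq r x hr.1).2.1.sub (huxx r hr x))
    (fun r hr x => by
      rw [hpde r (hmem r (Ioc_subset_Icc_self hr)) x, (hpq r x hr.1).2.2]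
      exact le_of_eq (by ring)) hbK hcK (fun x => by simp [hinit, h.coleHopf_zero])
  have ht' := right_mem_Icc.2 ht.1
  linarith [hle t ht' x, hge t ht' x]

/-- Just before the shock time, the Cole-Hopf solution cannot be close to the inviscid solution
at both of two points at distance of order `ν^(3/4)`. -/
theorem exists_lower_bound (h : ShockProfile a a₁ a₂ T M K c) :
    ∃ κ > 0, ∀ β : ℝ, 0 < β → β ≤ 1 → ∃ s ∈ Ico 0 T, ∃ y₁ y₂ : ℝ, κ * β ≤
      (a y₁ - coleHopf a (β ^ 4) s (y₁ + s * a y₁)) -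
        (a y₂ - coleHopf a (β ^ 4) s (y₂ + s * a y₂)) := by
  have hT := h.T_pos
  have hc := h.c_pos
  have hM : 0 ≤ M := (abs_nonneg _).trans (h.abs_apply_le 0)
  have hK : 0 ≤ K := by
    have h1 := h.lower 1
    have h2 := h.upper 1
    norm_num at h1 h2
    linarith
  have hm : 0 ≤ momentConst T c := by
    have : 0 < min 1 (c * T) := lt_min one_pos (by positivity)
    unfold momentConst
    positivity
  set Λ := M + M ^ 2 * momentConst T c / 2 with hΛ
  have hΛ0 : 0 ≤ Λ := by positivity
  set A := 1 + 2 * K * T + 4 * Λ * (1 + T * K) * T with hA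
  have hA1 : 1 ≤ A := by
    have : 0 ≤ 2 * K * T + 4 * Λ * (1 + T * K) * T := by positivity
    linarith
  set κ := A⁻¹ with hκ
  have hκ0 : 0 < κ := by positivity
  have hκA : κ * A = 1 := inv_mul_cancel₀ (by positivity)
  have hκ1 : κ ≤ 1 := inv_le_one_of_one_le₀ hA1
  have hκ2 : κ ^ 2 * A ≤ 1 := by nlinarith
  have k1 : 2 * K * T * κ ^ 2 ≤ 1 := by
    have : 0 ≤ κ ^ 2 * (1 + 4 * Λ * (1 + T * K) * T) := by positivity
    rw [hA] at hκ2; linarith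
  have k2 : 4 * Λ * (1 + T * K) * T * κ ^ 2 ≤ 1 := by
    have : 0 ≤ κ ^ 2 * (1 + 2 * K * T) := by positivity
    rw [hA] at hκ2; linarith
  refine ⟨κ / (2 * T), by positivity, fun β hβ hβ1 => ?_⟩
  set y₀ := κ * β with hy0
  have hy0pos : 0 < y₀ := by positivity
  have hy1 : y₀ ≤ 1 := mul_le_one₀ hκ1 hβ.le hβ1
  have hs : T - T * (y₀ ^ 2 / 2) ∈ Ico 0 T := by
    have h1 : y₀ ^ 2 ≤ 1 := pow_le_one₀ hy0pos.le hy1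
    constructor <;> nlinarith [mul_pos hT (pow_pos hy0pos 2)]
  set s := T - T * (y₀ ^ 2 / 2) with hsdef
  have hder := h.hasDerivAt_characteristic s
  -- the images of `±y₀` under the characteristic map
  have hXle : (y₀ + s * a y₀) - (-y₀ + s * a (-y₀)) ≤ (1 + T * K) * y₀ ^ 2 * (y₀ - -y₀) := by
    refine (convex_Icc (-y₀) y₀).image_sub_le_mul_sub_of_deriv_le
      (continuous_iff_continuousAt.2 fun y => (hder y).continuousAt).continuousOn
      (fun y _ => (hder y).differentiableAt.differentiableWithinAt) (fun y hy => ?_) _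
      (by simp [hy0pos.le]) _ (by simp [hy0pos.le]) (by linarith)
    rw [interior_Icc] at hy
    rw [(hder y).deriv]
    have h1 : y ^ 2 ≤ y₀ ^ 2 := sq_le_sq' hy.1.le hy.2.le
    have h2 := mul_le_mul_of_nonneg_left (h.upper y) hs.1
    have h3 : s * T⁻¹ = 1 - y₀ ^ 2 / 2 := by rw [hsdef]; field_simp
    have h4 : s * (K * y ^ 2) ≤ T * (K * y₀ ^ 2) := by
      have := hs.1
      have := hs.2.le
      gcongr
    nlinarith [sq_nonneg y₀]
  have hXge : -y₀ + s * a (-y₀) ≤ y₀ + s * a y₀ := by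
    have h1 := h.characteristic_sub_lower hs.1 hs.2.le y₀ (-y₀)
    have h2 : 0 ≤ min 1 (c * T) / 64 * ((y₀ - -y₀) ^ 2 * min 1 ((y₀ - -y₀) ^ 2)) := by positivity
    have h3 := nonneg_of_mul_nonneg_right (h2.trans h1) (by linarith)
    linarith
  have ha : a y₀ - a (-y₀) ≤ -(2 * T)⁻¹ * (y₀ - -y₀) := by
    refine (convex_Icc (-y₀) y₀).image_sub_le_mul_sub_of_deriv_le h.continuous.continuousOn
      (fun y _ => (h.hasDerivAt y).differentiableAt.differentiableWithinAt) (fun y hy => ?_) _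
      (by simp [hy0pos.le]) _ (by simp [hy0pos.le]) (by linarith)
    rw [interior_Icc] at hy
    rw [(h.hasDerivAt y).deriv]
    have h1 : y ^ 2 ≤ κ ^ 2 := sq_le_sq' (by nlinarith [hy.1]) (by nlinarith [hy.2])
    have h2 : K * y ^ 2 ≤ (2 * T)⁻¹ := by
      rw [← one_div, le_div_iff₀ (by positivity)]
      nlinarith [mul_le_mul_of_nonneg_left h1 (by positivity : 0 ≤ 2 * K * T)]
    have h3 : -T⁻¹ = -(2 * T)⁻¹ - (2 * T)⁻¹ := by field_simp; norm_num
    linarith [h.upper y]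
  have hu := h.coleHopf_sub_lower hβ hβ1 hs.1 hs.2.le hXge
  refine ⟨s, hs, -y₀, y₀, ?_⟩
  have h1 : Λ / β ^ 2 * ((y₀ + s * a y₀) - (-y₀ + s * a (-y₀))) ≤ κ / (2 * T) * β := by
    calc _ ≤ Λ / β ^ 2 * ((1 + T * K) * y₀ ^ 2 * (y₀ - -y₀)) := by gcongr
      _ = 4 * Λ * (1 + T * K) * T * κ ^ 2 * (κ / (2 * T) * β) := by
        rw [hy0]; field_simp; ring
      _ ≤ 1 * (κ / (2 * T) * β) := by gcongr
      _ = _ := one_mul _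
  have h2 : (2 * T)⁻¹ * (y₀ - -y₀) = 2 * (κ / (2 * T) * β) := by rw [hy0]; field_simp; ring
  linarith

end ShockProfile

/-- Corollary 1.2: sharp `ν^(1/4)` rate for the vanishing viscosity limit up to
the first shock time. -/
theorem statement0
    (uInit : ℝ → ℝ) (cInit LInit : ℝ) (hL : 0 < LInit)
    (h_smooth : ContDiff ℝ (⊤ : ℕ∞) uInit)
    (h_const : ∀ x : ℝ, x ∉ Set.Icc (-LInit) LInit → uInit x = cInit)
    (h_neg : deriv uInit 0 < 0)
    (h_min : ∀ x : ℝ, deriv uInit 0 ≤ deriv uInit x)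
    (h_uniq : ∀ x : ℝ, deriv uInit x = deriv uInit 0 → x = 0)
    (h_nondeg : 0 < iteratedDeriv 3 uInit 0)
    (h_val : uInit 0 = 0)
    (t₀ : ℝ) (ht₀ : t₀ = (deriv uInit 0)⁻¹)
    (u0 : ℝ → ℝ → ℝ)
    (hu0_smooth : ContDiffOn ℝ (⊤ : ℕ∞) (fun p : ℝ × ℝ => u0 p.1 p.2)
      (Set.Ico t₀ 0 ×ˢ (Set.univ : Set ℝ)))
    (hu0_pde : ∀ t ∈ Set.Ico t₀ (0:ℝ), ∀ x : ℝ,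
      deriv (fun s => u0 s x) t = -(u0 t x) * deriv (fun y => u0 t y) x)
    (hu0_init : ∀ x : ℝ, u0 t₀ x = uInit x) :
    ∃ C : ℝ, 1 ≤ C ∧
      ∀ ν ∈ Set.Ioc (0:ℝ) 1, ∀ u : ℝ → ℝ → ℝ,
        ContDiffOn ℝ (⊤ : ℕ∞) (fun p : ℝ × ℝ => u p.1 p.2)
          (Set.Ico t₀ 0 ×ˢ (Set.univ : Set ℝ)) →
        (∀ t ∈ Set.Ico t₀ (0:ℝ), ∀ x : ℝ,
          deriv (fun s => u s x) t
            = ν * deriv (deriv (fun y => u t y)) x - u t x * deriv (fun y => u t y) x) →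
        (∀ x : ℝ, u t₀ x = uInit x) →
        (∀ n : ℕ, ∃ M : ℝ, ∀ t ∈ Set.Ico t₀ (0:ℝ), ∀ x : ℝ,
          |iteratedDeriv n (u t) x| ≤ M) →
        (C⁻¹ * ν ^ ((1:ℝ)/4)
            ≤ sSup {y : ℝ | ∃ t ∈ Set.Ico t₀ (0:ℝ), ∃ x : ℝ, y = |u t x - u0 t x|} ∧
          sSup {y : ℝ | ∃ t ∈ Set.Ico t₀ (0:ℝ), ∃ x : ℝ, y = |u t x - u0 t x|}
            ≤ C * ν ^ ((1:ℝ)/4)) := by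
  obtain ⟨M, K, c, h⟩ := exists_shockProfile h_smooth h_const h_neg h_min h_uniq h_nondeg
  rw [← ht₀] at h
  have hT : t₀ < 0 := neg_pos.1 h.T_pos
  obtain ⟨κ, hκ, hlow⟩ := h.exists_lower_bound
  refine ⟨max 1 (max (M * (1 + momentConst (-t₀) c) / 2) (2 / κ)), le_max_left _ _, ?_⟩
  have C1 : M * (1 + momentConst (-t₀) c) / 2 ≤
    max 1 (max (M * (1 + momentConst (-t₀) c) / 2) (2 / κ)) :=
    (le_max_left _ _).trans (le_max_right _ _)
  have C2 : 2 / κ ≤ max 1 (max (M * (1 + momentConst (-t₀) c) / 2) (2 / κ)) :=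
    (le_max_right _ _).trans (le_max_right _ _)
  set C := max 1 (max (M * (1 + momentConst (-t₀) c) / 2) (2 / κ))
  rintro ν ⟨hν, hν1⟩ u hu hpde hinit hbd
  have hβ : 0 < ν ^ ((1 : ℝ) / 4) := Real.rpow_pos_of_pos hν _
  have hβ1 : ν ^ ((1 : ℝ) / 4) ≤ 1 := Real.rpow_le_one hν.le hν1 (by norm_num)
  have hβ4 : (ν ^ ((1 : ℝ) / 4)) ^ 4 = ν := by
    rw [← Real.rpow_natCast, ← Real.rpow_mul hν.le]; norm_num
  set β := ν ^ ((1 : ℝ) / 4)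
  obtain ⟨B, hB⟩ := hbd 0
  obtain ⟨B₁, hB₁⟩ := hbd 1
  simp only [iteratedDeriv_zero] at hB
  simp only [iteratedDeriv_one] at hB₁
  have hueq : ∀ t ∈ Ico t₀ 0, ∀ x, u t x = coleHopf uInit (β ^ 4) (t - t₀) x := fun t ht x => by
    rw [hβ4]
    exact h.eq_coleHopf hν hu hpde hinit hB hB₁ ht x
  have hu0eq : ∀ t ∈ Ico t₀ 0, ∀ y, u0 t (y + (t - t₀) * uInit y) = uInit y := fun t ht y =>
    inviscid_burgers_characteristics hu0_smooth hu0_pde hu0_init ht y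
  have hup : ∀ y ∈ {y : ℝ | ∃ t ∈ Ico t₀ (0:ℝ), ∃ x : ℝ, y = |u t x - u0 t x|}, y ≤ C * β := by
    rintro _ ⟨t, ht, x, rfl⟩
    have hs : 0 ≤ t - t₀ := sub_nonneg.2 ht.1
    obtain ⟨y, rfl⟩ := h.exists_characteristic_eq hs x
    rw [hueq t ht, hu0eq t ht]
    exact (h.abs_coleHopf_sub_le hβ hβ1 hs (by linarith [ht.2]) y).trans (by gcongr)
  refine ⟨?_, csSup_le ⟨_, t₀, ⟨le_rfl, hT⟩, 0, rfl⟩ hup⟩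
  obtain ⟨s, hs, y₁, y₂, hy⟩ := hlow β hβ hβ1
  have ht : s + t₀ ∈ Ico t₀ 0 := ⟨by linarith [hs.1], by linarith [hs.2]⟩
  have hsup : ∀ y, |coleHopf uInit (β ^ 4) s (y + s * uInit y) - uInit y| ≤
      sSup {y : ℝ | ∃ t ∈ Ico t₀ (0:ℝ), ∃ x : ℝ, y = |u t x - u0 t x|} := fun y => by
    refine le_csSup ⟨_, hup⟩ ⟨s + t₀, ht, y + s * uInit y, ?_⟩
    have h0 := hu0eq _ ht y
    rw [add_sub_cancel_right] at h0
    rw [hueq _ ht, h0, add_sub_cancel_right]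
  have h1 := neg_le_of_abs_le (hsup y₁)
  have h2 := le_of_abs_le (hsup y₂)
  have h3 : C⁻¹ ≤ κ / 2 := by
    rw [← inv_div]
    exact inv_anti₀ (by positivity) C2
  nlinarith [mul_le_mul_of_nonneg_right h3 hβ.le]
end

section
/- Blow-up of the C^(1/2) Hölder seminorm in the vanishing viscosity limit (first half of (1.6) in Theorem 1.1): For every M > 0 there exists ν₀ ∈ (0,1] such that for every ν ∈ (0,ν₀) and every solution u^ν as in the context, there exist t ∈ [t₀,0) and points x ≠ y in ℝ with |u^ν(t,x) − u^ν(t,y)| > M·|x−y|^(1/2). Equivalently, sup_{t∈[t₀,0)} of the 1/2-Hölder seminorm of u^ν(t,·) tends to ∞ as ν → 0⁺. -/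
open Set

/-- The second derivative is nonpositive at a local maximum. -/
theorem second_deriv_nonpos_of_isLocalMax {h h' : ℝ → ℝ} {h'' x : ℝ}
    (hd : ∀ y, HasDerivAt h (h' y) y) (hd' : HasDerivAt h' h'' x) (hmax : IsLocalMax h x) :
    h'' ≤ 0 := by
  by_contra! hpos
  have hderiv : deriv h = h' := funext fun y => (hd y).deriv
  have hmin : IsLocalMin h x :=
    isLocalMin_of_deriv_deriv_pos (by rwa [hderiv, hd'.deriv])
      hmax.deriv_eq_zero (hd x).continuousAt
  have hconst : h =ᶠ[nhds x] fun _ => h x := by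
    filter_upwards [hmax, hmin] with y h₁ h₂ using le_antisymm h₁ h₂
  have h0 : deriv (deriv h) x = 0 := by
    rw [hconst.deriv.deriv_eq]; simp
  rw [hderiv, hd'.deriv] at h0
  exact hpos.ne' h0

/-- The derivative is nonnegative at a maximum approached from the left. -/
theorem deriv_nonneg_of_le_left {φ : ℝ → ℝ} {d a t : ℝ} (hat : a < t)
    (hd : HasDerivAt φ d t) (hle : ∀ s ∈ Icc a t, φ s ≤ φ t) : 0 ≤ d := by
  have hs := (hasDerivAt_iff_tendsto_slope_left_right.1 hd).1
  refine ge_of_tendsto hs ?_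
  filter_upwards [Ioo_mem_nhdsLT hat] with s hs
  rw [slope_def_field]
  exact div_nonneg_of_nonpos (by linarith [hle s ⟨hs.1.le, hs.2.le⟩]) (by linarith [hs.2])

set_option maxHeartbeats 1000000 in
/-- One-sided comparison of a viscous Burgers solution with the inviscid one, in Lagrangian
coordinates. -/
theorem burgers_upper_comparison {f : ℝ → ℝ} (hf : ContDiff ℝ 2 f) {t₀ T ν K K₂ δ B : ℝ}
    (htT : t₀ < T) (hT : T < 0) (hν : 0 < ν) (hK : ∀ y, |deriv f y| ≤ K)
    (hK₂ : ∀ y, |deriv (deriv f) y| ≤ K₂) (hδ : 0 < δ)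
    (hX : ∀ t ∈ Icc t₀ T, ∀ y, δ ≤ 1 + (t - t₀) * deriv f y) {u : ℝ → ℝ → ℝ}
    (hu : ContDiffOn ℝ (⊤ : ℕ∞) (fun p : ℝ × ℝ => u p.1 p.2) (Ico t₀ 0 ×ˢ univ))
    (hpde : ∀ t ∈ Ioo t₀ (0 : ℝ), ∀ x : ℝ, deriv (fun s => u s x) t
      = ν * deriv (deriv (fun y => u t y)) x - u t x * deriv (fun y => u t y) x)
    (hinit : ∀ x, u t₀ x = f x) (hB : ∀ t ∈ Ico t₀ (0 : ℝ), ∀ x, |u t x| ≤ B)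
    {t : ℝ} (ht : t ∈ Icc t₀ T) (y : ℝ) :
    u t (y + (t - t₀) * f y) - f y ≤
      ν * (Real.exp ((K + 1) / δ * (T - t₀)) *
        (2 * ((K₂ + 1 + (K + 1) / δ * (T - t₀) * K₂) / δ ^ 2) * (T - t₀))) := by
  set l := (K + 1) / δ with hl
  set C := (K₂ + 1 + l * (T - t₀) * K₂) / δ ^ 2 with hC
  set S := T - t₀ with hS
  have hS0 : 0 < S := by linarith
  have hK0 : 0 ≤ K := (abs_nonneg _).trans (hK 0)
  have hK₂0 : 0 ≤ K₂ := (abs_nonneg _).trans (hK₂ 0)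
  have hl0 : 0 < l := by positivity
  have hC0 : 0 < C := by positivity
  have hB0 : 0 ≤ B := (abs_nonneg _).trans (hB t₀ ⟨le_rfl, by linarith⟩ 0)
  have hfB : ∀ x, |f x| ≤ B := fun x => hinit x ▸ hB t₀ ⟨le_rfl, by linarith⟩ x
  set G := Real.exp (l * S) with hG
  have hG1 : 1 ≤ G := Real.one_le_exp (by positivity)
  have hfd : ∀ z, HasDerivAt f (deriv f z) z := fun z =>
    (hf.differentiable (by norm_num) z).hasDerivAt
  have hf1 : ContDiff ℝ 1 (deriv f) := (contDiff_succ_iff_deriv (n := 1)).1 hf |>.2.2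
  have hfd2 : ∀ z, HasDerivAt (deriv f) (deriv (deriv f) z) z := fun z =>
    (hf1.differentiable (by norm_num) z).hasDerivAt
  -- the penalised estimate
  have key : ∀ ε : ℝ, 0 < ε → 2 * ε * G ≤ 1 → 8 * ε * G ^ 2 * B ≤ 1 → ∀ t ∈ Icc t₀ T, ∀ y,
      Real.exp (-l * (t - t₀)) * (u t (y + (t - t₀) * f y) - f y) - ε * y ^ 2
        - 2 * C * ν * (t - t₀) ≤ 0 := by
    intro ε hε hε1 hε2
    set H : ℝ → ℝ → ℝ := fun t y => Real.exp (-l * (t - t₀)) *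
      (u t (y + (t - t₀) * f y) - f y) - ε * y ^ 2 - 2 * C * ν * (t - t₀) with hH
    have hE1 : ∀ t ∈ Icc t₀ T, Real.exp (-l * (t - t₀)) ≤ 1 := fun t ht =>
      Real.exp_le_one_iff.2 (by nlinarith [ht.1])
    have hWB : ∀ t ∈ Icc t₀ T, ∀ y, |u t (y + (t - t₀) * f y) - f y| ≤ 2 * B := fun t ht y => by
      have h1 := abs_le.1 (hB t ⟨ht.1, ht.2.trans_lt hT⟩ (y + (t - t₀) * f y))
      have h2 := abs_le.1 (hfB y)
      exact abs_le.2 ⟨by linarith, by linarith⟩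
    have hHle : ∀ t ∈ Icc t₀ T, ∀ y, H t y ≤ 2 * B - ε * y ^ 2 := fun t ht y => by
      have h1 := abs_le.1 (hWB t ht y)
      have h2 := hE1 t ht
      have h3 := Real.exp_pos (-l * (t - t₀))
      have h4 : 0 ≤ 2 * C * ν * (t - t₀) := mul_nonneg (by positivity) (by linarith [ht.1])
      have h5 : Real.exp (-l * (t - t₀)) * (u t (y + (t - t₀) * f y) - f y) ≤ 2 * B := by
        nlinarith
      simp only [hH]; linarith
    intro t₁ ht₁ y₁
    change H t₁ y₁ ≤ 0
    by_contra! hpos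
    -- a maximum point
    set R := |y₁| + 2 * B / ε + 1 with hR
    have hR1 : 1 ≤ R := by
      have := abs_nonneg y₁
      have : 0 ≤ 2 * B / ε := by positivity
      linarith
    have hcont : ContinuousOn (fun p : ℝ × ℝ => H p.1 p.2) (Icc t₀ T ×ˢ Icc (-R) R) := by
      have hfc := hf.continuous
      have h1 : ContinuousOn (fun p : ℝ × ℝ => u p.1 (p.2 + (p.1 - t₀) * f p.2))
          (Icc t₀ T ×ˢ Icc (-R) R) := by
        refine hu.continuousOn.comp (f := fun p : ℝ × ℝ => (p.1, p.2 + (p.1 - t₀) * f p.2))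
          (by fun_prop) ?_
        rintro ⟨a, b⟩ ⟨ha, -⟩
        exact ⟨⟨ha.1, ha.2.trans_lt hT⟩, mem_univ _⟩
      have h2 : Continuous (fun p : ℝ × ℝ => Real.exp (-l * (p.1 - t₀))) := by fun_prop
      have h3 : Continuous (fun p : ℝ × ℝ => f p.2) := by fun_prop
      have h4 : Continuous (fun p : ℝ × ℝ => ε * p.2 ^ 2) := by fun_prop
      have h5 : Continuous (fun p : ℝ × ℝ => 2 * C * ν * (p.1 - t₀)) := by fun_prop
      exact ((h2.continuousOn.mul (h1.sub h3.continuousOn)).sub h4.continuousOn).sub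
        h5.continuousOn
    obtain ⟨⟨s, z⟩, ⟨hs, hz⟩, hmax⟩ := (isCompact_Icc.prod isCompact_Icc).exists_isMaxOn
      ⟨(t₁, y₁), ht₁, abs_le.1 (by
        have : 0 ≤ 2 * B / ε := by positivity
        linarith : |y₁| ≤ R)⟩ hcont
    simp only at hs hz
    have hmem1 : y₁ ∈ Icc (-R) R := abs_le.1 (by
        have : 0 ≤ 2 * B / ε := by positivity
        linarith : |y₁| ≤ R)
    have hHs : 0 < H s z := hpos.trans_le (hmax (⟨ht₁, hmem1⟩ : (t₁, y₁) ∈ Icc t₀ T ×ˢ Icc (-R) R))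
    have hout : ∀ w, 0 < H s w → |w| < R := by
      intro w hw
      by_contra! hw'
      have h1 := hHle s hs w
      have h2 : ε * w ^ 2 < 2 * B := by linarith
      have h3 : 2 * B / ε < R := by rw [hR]; linarith [abs_nonneg y₁]
      have h4 : 2 * B < R * ε := (div_lt_iff₀ hε).1 h3
      have h5 : R ≤ w ^ 2 := by rw [← sq_abs]; nlinarith
      nlinarith
    have hzR := abs_lt.1 (hout z hHs)
    have hst : t₀ < s := by
      refine lt_of_le_of_ne hs.1 ?_
      rintro rfl
      simp only [hH, sub_self, zero_mul, add_zero, hinit, mul_zero] at hHs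
      nlinarith [sq_nonneg z]
    have hs0 : s < 0 := hs.2.trans_lt hT
    -- derivatives of `u` at the maximum point
    set x := z + (s - t₀) * f z with hx
    have hus : ContDiff ℝ (⊤ : ℕ∞) (u s) := by
      rw [← contDiffOn_univ]
      exact hu.comp (f := fun y : ℝ => (s, y)) (by fun_prop)
        (fun y _ => ⟨⟨hs.1, hs0⟩, mem_univ _⟩)
    have hus1 : ContDiff ℝ (⊤ : ℕ∞) (deriv (u s)) := (contDiff_infty_iff_deriv.1 hus).2
    have hud : ∀ w, HasDerivAt (u s) (deriv (u s) w) w := fun w =>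
      (hus.differentiable (by simp) w).hasDerivAt
    have hud2 : ∀ w, HasDerivAt (deriv (u s)) (deriv (deriv (u s)) w) w := fun w =>
      (hus1.differentiable (by simp) w).hasDerivAt
    have hUd : DifferentiableAt ℝ (fun p : ℝ × ℝ => u p.1 p.2) (s, x) :=
      (hu.contDiffAt (prod_mem_nhds (Ico_mem_nhds hst hs0) Filter.univ_mem)).differentiableAt
        (by simp)
    set L := fderiv ℝ (fun p : ℝ × ℝ => u p.1 p.2) (s, x)
    have hL1 : deriv (fun r => u r x) s = L (1, 0) := by
      have := hUd.hasFDerivAt.comp_hasDerivAt_of_eq (f := fun r : ℝ => (r, x)) s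
        ((hasDerivAt_id s).prodMk (hasDerivAt_const s x)) rfl
      exact this.deriv
    have hL2 : deriv (u s) x = L (0, 1) := by
      have := hUd.hasFDerivAt.comp_hasDerivAt_of_eq (f := fun r : ℝ => (s, r)) x
        ((hasDerivAt_const x s).prodMk (hasDerivAt_id x)) rfl
      exact this.deriv
    have hXt : HasDerivAt (fun r : ℝ => z + (r - t₀) * f z) (f z) s := by
      simpa using (((hasDerivAt_id s).sub_const t₀).mul_const (f z)).const_add z
    have hVt : HasDerivAt (fun r => u r (z + (r - t₀) * f z))
        (L (1, 0) + f z * L (0, 1)) s := by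
      have := hUd.hasFDerivAt.comp_hasDerivAt_of_eq
        (f := fun r : ℝ => (r, z + (r - t₀) * f z)) s ((hasDerivAt_id s).prodMk hXt) rfl
      have e : ((1 : ℝ), f z) = (1, 0) + f z • (0, 1) := by simp
      rw [e, map_add, map_smul, smul_eq_mul] at this
      exact this
    set W := u s x - f z with hW
    set E := Real.exp (-l * (s - t₀)) with hE
    have hE0 : 0 < E := Real.exp_pos _
    have hEG : E⁻¹ ≤ G := by
      rw [hE, ← Real.exp_neg, hG]
      exact Real.exp_le_exp.2 (by nlinarith [hs.2])
    have hEle : E ≤ 1 := hE1 s hs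
    have hEt : HasDerivAt (fun r : ℝ => Real.exp (-l * (r - t₀))) (E * -l) s := by
      exact (((hasDerivAt_id s).sub_const t₀).const_mul (-l)).exp.congr_deriv (by simp [hE])
    have hHt : HasDerivAt (fun r => H r z)
        (E * -l * W + E * (L (1, 0) + f z * L (0, 1)) - 2 * C * ν) s := by
      have h1 := ((hEt.mul (hVt.sub_const (f z))).sub_const (ε * z ^ 2)).sub
        (((hasDerivAt_id s).sub_const t₀).const_mul (2 * C * ν))
      exact h1.congr_deriv (by simp only [hW, hE, hx, mul_one])
    have hHt0 := deriv_nonneg_of_le_left hst hHt fun r hr =>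
      hmax (⟨⟨hr.1, hr.2.trans hs.2⟩, hz⟩ : (r, z) ∈ Icc t₀ T ×ˢ Icc (-R) R)
    have hXy : ∀ w, HasDerivAt (fun w : ℝ => w + (s - t₀) * f w) (1 + (s - t₀) * deriv f w) w :=
      fun w => (hasDerivAt_id w).add ((hfd w).const_mul _)
    have hHy : ∀ w, HasDerivAt (H s) (E * (deriv (u s) (w + (s - t₀) * f w) *
        (1 + (s - t₀) * deriv f w) - deriv f w) - ε * (2 * w)) w := fun w => by
      have h1 := (((((hud _).comp w (hXy w)).sub (hfd w)).const_mul E).sub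
        ((hasDerivAt_pow 2 w).const_mul ε)).sub_const (2 * C * ν * (s - t₀))
      exact h1.congr_deriv (by simp)
    have hHyy : HasDerivAt (fun w => E * (deriv (u s) (w + (s - t₀) * f w) *
        (1 + (s - t₀) * deriv f w) - deriv f w) - ε * (2 * w))
        (E * (deriv (deriv (u s)) x * (1 + (s - t₀) * deriv f z) * (1 + (s - t₀) * deriv f z)
          + deriv (u s) x * ((s - t₀) * deriv (deriv f) z) - deriv (deriv f) z) - ε * 2) z := by
      have h1 := (((((hud2 _).comp z (hXy z)).mul
        (((hfd2 z).const_mul (s - t₀)).const_add 1)).sub (hfd2 z)).const_mul E).sub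
        (((hasDerivAt_id z).const_mul 2).const_mul ε)
      exact h1.congr_deriv (by simp [hx])
    have hloc : IsLocalMax (H s) z := by
      filter_upwards [Ioo_mem_nhds hzR.1 hzR.2] with w hw
      exact hmax (⟨hs, hw.1.le, hw.2.le⟩ : (s, w) ∈ Icc t₀ T ×ˢ Icc (-R) R)
    have hy0 := hloc.hasDerivAt_eq_zero (hHy z)
    have hyy0 := second_deriv_nonpos_of_isLocalMax hHy hHyy hloc
    rw [← hx] at hy0
    have hp := hpde s ⟨hst, hs0⟩ x
    rw [hL1] at hp
    change L (1, 0) = ν * deriv (deriv (u s)) x - u s x * deriv (u s) x at hp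
    rw [← hL2, hp] at hHt0
    set ux := deriv (u s) x
    set uxx := deriv (deriv (u s)) x
    set J := 1 + (s - t₀) * deriv f z with hJ
    have hJδ : δ ≤ J := hX s hs z
    have hd1 := abs_le.1 (hK z)
    have hd2 := abs_le.1 (hK₂ z)
    have hWpos : 0 < W := by
      have h4 : 0 ≤ 2 * C * ν * (s - t₀) := mul_nonneg (by positivity) (by linarith)
      have h5 : 0 < E * W := by
        have : H s z = E * W - ε * z ^ 2 - 2 * C * ν * (s - t₀) := rfl
        linarith [mul_nonneg hε.le (sq_nonneg z)]
      exact pos_of_mul_pos_right h5 hE0.le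
    -- first derivative bound
    have hEi : E * E⁻¹ = 1 := mul_inv_cancel₀ hE0.ne'
    have hEi0 : 0 < E⁻¹ := inv_pos.2 hE0
    have hεz : |E⁻¹ * (ε * (2 * z))| ≤ 1 := by
      rw [← sq_le_one_iff_abs_le_one]
      have h1 := hHle s hs z
      have h2 : ε * z ^ 2 ≤ 2 * B := by linarith
      have h3 : E⁻¹ ^ 2 ≤ G ^ 2 := by gcongr
      calc (E⁻¹ * (ε * (2 * z))) ^ 2 = E⁻¹ ^ 2 * (4 * ε * (ε * z ^ 2)) := by ring
        _ ≤ G ^ 2 * (4 * ε * (2 * B)) := by gcongr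
        _ = 8 * ε * G ^ 2 * B := by ring
        _ ≤ 1 := hε2
    have huxJ : ux * J = deriv f z + E⁻¹ * (ε * (2 * z)) := by
      have : E⁻¹ * (E * (ux * J - deriv f z) - ε * (2 * z)) = 0 := by rw [hy0, mul_zero]
      linear_combination this - (ux * J - deriv f z) * hEi
    have hux : |ux| ≤ l := by
      rw [hl, le_div_iff₀ hδ]
      calc |ux| * δ ≤ |ux| * J := by gcongr
        _ = |ux * J| := by rw [abs_mul, abs_of_pos (hδ.trans_le hJδ)]
        _ ≤ |deriv f z| + |E⁻¹ * (ε * (2 * z))| := huxJ ▸ abs_add_le _ _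
        _ ≤ K + 1 := add_le_add (hK z) hεz
    -- time derivative gives a lower bound on `uxx`
    have huxx : 2 * C ≤ uxx := by
      have h1 : 2 * C * ν ≤ E * (ν * uxx - W * (ux + l)) := by
        rw [hW]; rw [hW] at hHt0; linarith
      have h2 : 0 ≤ W * (ux + l) := mul_nonneg hWpos.le (by linarith [(abs_le.1 hux).1])
      have h3 : 2 * C * ν ≤ E * (ν * uxx) := h1.trans (by gcongr; linarith)
      have h4 : 0 < ν * uxx := pos_of_mul_pos_right ((by positivity : 0 < 2 * C * ν).trans_le h3)
        hE0.le
      have h5 : ν * (2 * C) ≤ ν * uxx := by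
        linarith [mul_le_of_le_one_left h4.le hEle]
      exact le_of_mul_le_mul_left h5 hν
    have hupp : uxx * J * J ≤ K₂ + 1 + l * S * K₂ := by
      have h1 : uxx * J * J + ux * ((s - t₀) * deriv (deriv f) z) - deriv (deriv f) z
          ≤ E⁻¹ * (ε * 2) := by
        have := mul_le_mul_of_nonneg_left hyy0 hEi0.le
        linear_combination this - (uxx * J * J + ux * ((s - t₀) * deriv (deriv f) z)
          - deriv (deriv f) z) * hEi
      have h2 : E⁻¹ * (ε * 2) ≤ 1 := calc
        E⁻¹ * (ε * 2) ≤ G * (ε * 2) := by gcongr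
        _ = 2 * ε * G := by ring
        _ ≤ 1 := hε1
      have h3 : |ux * ((s - t₀) * deriv (deriv f) z)| ≤ l * (S * K₂) := by
        rw [abs_mul, abs_mul, abs_of_pos (by linarith : 0 < s - t₀)]
        have : s - t₀ ≤ S := by linarith [hs.2]
        have := hK₂ z
        gcongr
      have := (abs_le.1 h3).1
      linarith
    have hCδ : C * δ ^ 2 = K₂ + 1 + l * S * K₂ := by rw [hC]; field_simp
    have h6 : δ ^ 2 ≤ J * J := by rw [← sq]; gcongr
    have h7 : 2 * C * δ ^ 2 ≤ uxx * (J * J) :=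
      mul_le_mul huxx h6 (sq_nonneg δ) (by linarith)
    have : 0 < C * δ ^ 2 := by positivity
    linarith
  -- let `ε → 0`
  set W := u t (y + (t - t₀) * f y) - f y
  have hlim : Real.exp (-l * (t - t₀)) * W ≤ 2 * C * ν * (t - t₀) := by
    have h1 : Filter.Tendsto (fun ε : ℝ => ε * y ^ 2 + 2 * C * ν * (t - t₀)) (nhdsWithin 0 (Ioi 0))
        (nhds (0 * y ^ 2 + 2 * C * ν * (t - t₀))) :=
      (Continuous.tendsto (by fun_prop) 0).mono_left nhdsWithin_le_nhds
    rw [zero_mul, zero_add] at h1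
    refine ge_of_tendsto h1 ?_
    have e1 : ∀ᶠ ε : ℝ in nhds 0, 2 * ε * G < 1 :=
      (Continuous.tendsto' (by fun_prop) 0 0 (by simp)).eventually_lt_const one_pos
    have e2 : ∀ᶠ ε : ℝ in nhds 0, 8 * ε * G ^ 2 * B < 1 :=
      (Continuous.tendsto' (by fun_prop) 0 0 (by simp)).eventually_lt_const one_pos
    filter_upwards [self_mem_nhdsWithin, nhdsWithin_le_nhds e1, nhdsWithin_le_nhds e2]
      with ε h0 h1 h2
    have := key ε h0 h1.le h2.le t ht y
    linarith
  have ht1 : t - t₀ ≤ S := by linarith [ht.2]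
  have ht2 : 0 ≤ t - t₀ := by linarith [ht.1]
  calc W = Real.exp (l * (t - t₀)) * (Real.exp (-l * (t - t₀)) * W) := by
        rw [← mul_assoc, ← Real.exp_add]; simp
    _ ≤ Real.exp (l * (t - t₀)) * (2 * C * ν * (t - t₀)) := by gcongr
    _ ≤ G * (2 * C * ν * S) := by rw [hG]; gcongr
    _ = ν * (G * (2 * C * S)) := by ring

/-- The reflected form of `burgers_upper_comparison`. -/
theorem burgers_lower_comparison {f : ℝ → ℝ} (hf : ContDiff ℝ 2 f) {t₀ T ν K K₂ δ B : ℝ}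
    (htT : t₀ < T) (hT : T < 0) (hν : 0 < ν) (hK : ∀ y, |deriv f y| ≤ K)
    (hK₂ : ∀ y, |deriv (deriv f) y| ≤ K₂) (hδ : 0 < δ)
    (hX : ∀ t ∈ Icc t₀ T, ∀ y, δ ≤ 1 + (t - t₀) * deriv f y) {u : ℝ → ℝ → ℝ}
    (hu : ContDiffOn ℝ (⊤ : ℕ∞) (fun p : ℝ × ℝ => u p.1 p.2) (Ico t₀ 0 ×ˢ univ))
    (hpde : ∀ t ∈ Ioo t₀ (0 : ℝ), ∀ x : ℝ, deriv (fun s => u s x) t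
      = ν * deriv (deriv (fun y => u t y)) x - u t x * deriv (fun y => u t y) x)
    (hinit : ∀ x, u t₀ x = f x) (hB : ∀ t ∈ Ico t₀ (0 : ℝ), ∀ x, |u t x| ≤ B)
    {t : ℝ} (ht : t ∈ Icc t₀ T) (y : ℝ) :
    f y - u t (y + (t - t₀) * f y) ≤
      ν * (Real.exp ((K + 1) / δ * (T - t₀)) *
        (2 * ((K₂ + 1 + (K + 1) / δ * (T - t₀) * K₂) / δ ^ 2) * (T - t₀))) := by
  have hd : ∀ g : ℝ → ℝ, deriv (fun x => -g (-x)) = fun x => deriv g (-x) := fun g => by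
    ext x
    rw [deriv.fun_neg, deriv_comp_neg, neg_neg]
  have hd2 : ∀ g : ℝ → ℝ, deriv (deriv (fun x => -g (-x))) = fun x => -deriv (deriv g) (-x) :=
    fun g => by
      rw [hd]; ext x; rw [deriv_comp_neg]
  have h := burgers_upper_comparison (f := fun y => -f (-y)) (u := fun t x => -u t (-x))
    (K := K) (K₂ := K₂) (δ := δ) (B := B) (ν := ν)
    (by fun_prop) htT hT hν (fun y => by rw [hd]; exact hK _)
    (fun y => by rw [hd2, abs_neg]; exact hK₂ _) hδ (fun t ht y => by rw [hd]; exact hX t ht _)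
    (hu.comp (f := fun p : ℝ × ℝ => (p.1, -p.2)) (by fun_prop)
      (fun p hp => ⟨hp.1, mem_univ _⟩)).neg
    (fun t ht x => by
      rw [hd2, hd, deriv.fun_neg, hpde t ht (-x)]; ring)
    (fun x => by rw [hinit]) (fun t ht x => by rw [abs_neg]; exact hB t ht _) ht (-y)
  simp only [neg_neg, mul_neg, neg_add_rev] at h
  rw [add_comm _ y] at h
  linarith

/-- Blow-up of the `C^(1/2)` Hölder seminorm of `u^ν` as `ν → 0⁺` (first half of
(1.6) in Theorem 1.1). -/
theorem statement1
    (uInit : ℝ → ℝ) (cInit LInit : ℝ) (hL : 0 < LInit)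
    (h_smooth : ContDiff ℝ (⊤ : ℕ∞) uInit)
    (h_const : ∀ x : ℝ, x ∉ Set.Icc (-LInit) LInit → uInit x = cInit)
    (h_neg : deriv uInit 0 < 0)
    (h_min : ∀ x : ℝ, deriv uInit 0 ≤ deriv uInit x)
    (h_uniq : ∀ x : ℝ, deriv uInit x = deriv uInit 0 → x = 0)
    (h_nondeg : 0 < iteratedDeriv 3 uInit 0)
    (h_val : uInit 0 = 0)
    (t₀ : ℝ) (ht₀ : t₀ = (deriv uInit 0)⁻¹) :
    ∀ M : ℝ, 0 < M → ∃ ν₀ ∈ Set.Ioc (0:ℝ) 1, ∀ ν ∈ Set.Ioo (0:ℝ) ν₀,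
      ∀ u : ℝ → ℝ → ℝ,
        ContDiffOn ℝ (⊤ : ℕ∞) (fun p : ℝ × ℝ => u p.1 p.2)
          (Set.Ico t₀ 0 ×ˢ (Set.univ : Set ℝ)) →
        (∀ t ∈ Set.Ico t₀ (0:ℝ), ∀ x : ℝ,
          deriv (fun s => u s x) t
            = ν * deriv (deriv (fun y => u t y)) x - u t x * deriv (fun y => u t y) x) →
        (∀ x : ℝ, u t₀ x = uInit x) →
        (∀ n : ℕ, ∃ Mb : ℝ, ∀ t ∈ Set.Ico t₀ (0:ℝ), ∀ x : ℝ,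
          |iteratedDeriv n (u t) x| ≤ Mb) →
        ∃ t ∈ Set.Ico t₀ (0:ℝ), ∃ x y : ℝ, x ≠ y ∧
          M * |x - y| ^ ((1:ℝ)/2) < |u t x - u t y| := by
  intro M hM
  set f := uInit
  set a := -deriv f 0 with ha
  have ha0 : 0 < a := by linarith
  have ht₀a : t₀ * a = -1 := by
    rw [ha, ht₀, mul_neg, inv_mul_cancel₀ h_neg.ne]
  have ht₀neg : t₀ < 0 := by rw [ht₀]; exact inv_lt_zero.2 h_neg
  have hf2 : ContDiff ℝ 2 f := contDiff_infty.1 h_smooth 2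
  have hfd : ∀ z, HasDerivAt f (deriv f z) z := fun z =>
    (hf2.differentiable (by norm_num) z).hasDerivAt
  have hf1 : ContDiff ℝ 1 (deriv f) := (contDiff_succ_iff_deriv (n := 1)).1 hf2 |>.2.2
  -- global bounds on the derivatives of the initial datum
  have hsupp : HasCompactSupport (deriv f) := by
    refine HasCompactSupport.intro (isCompact_Icc (a := -LInit) (b := LInit)) fun x hx => ?_
    have : f =ᶠ[nhds x] fun _ => cInit := by
      filter_upwards [isClosed_Icc.isOpen_compl.mem_nhds hx] with z hz using h_const z hz
    rw [this.deriv_eq]; simp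
  obtain ⟨K, hK⟩ := hsupp.exists_bound_of_continuous hf1.continuous
  obtain ⟨K₂, hK₂⟩ := hsupp.deriv.exists_bound_of_continuous hf1.continuous_deriv_one
  simp only [Real.norm_eq_abs] at hK hK₂
  have hK0 : 0 ≤ K := (abs_nonneg _).trans (hK 0)
  have hK₂0 : 0 ≤ K₂ := (abs_nonneg _).trans (hK₂ 0)
  -- the derivative is flat at its minimum
  have hflat : HasDerivAt (deriv f) 0 0 := by
    have h1 := (hf1.differentiable (by norm_num) 0).hasDerivAt
    have h2 : IsLocalMin (deriv f) 0 := Filter.Eventually.of_forall h_min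
    rwa [h2.hasDerivAt_eq_zero h1] at h1
  obtain ⟨y, hy0, hyflat⟩ : ∃ y : ℝ, 0 < y ∧ ∀ z ∈ Icc (-y) y,
      deriv f z + a ≤ a ^ 3 / (16 * M ^ 2) * y ∧ deriv f z + a ≤ a / 2 := by
    have hη : 0 < a ^ 3 / (16 * M ^ 2) := by positivity
    have h1 := (hasDerivAt_iff_isLittleO.1 hflat).bound hη
    have h2 : ∀ᶠ z in nhds (0 : ℝ), deriv f z < -a / 2 :=
      hf1.continuous.continuousAt.eventually_lt_const (by linarith)
    obtain ⟨r, hr, hball⟩ := Metric.eventually_nhds_iff.1 (h1.and h2)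
    refine ⟨r / 2, by linarith, fun z hz => ?_⟩
    have hz' : |z| ≤ r / 2 := abs_le.2 hz
    obtain ⟨h3, h4⟩ := hball (show dist z 0 < r by rw [dist_zero_right, Real.norm_eq_abs]; linarith)
    refine ⟨?_, by linarith⟩
    simp only [smul_zero, sub_zero, Real.norm_eq_abs] at h3
    have h5 := (le_abs_self _).trans h3
    calc deriv f z + a = deriv f z - deriv f 0 := by rw [ha]; ring
      _ ≤ a ^ 3 / (16 * M ^ 2) * |z| := h5
      _ ≤ _ := by gcongr
  set Δ := f (-y) - f y with hΔ
  have hmvt : ∀ C : ℝ, (∀ z ∈ Icc (-y) y, deriv f z + a ≤ C) → 2 * a * y - Δ ≤ C * (2 * y) := by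
    intro C hC
    have := (convex_Icc (-y) y).image_sub_le_mul_sub_of_deriv_le (f := f) (C := C - a)
      hf2.continuous.continuousOn (hf2.differentiable (by norm_num)).differentiableOn
      (fun z hz => by linarith [hC z (interior_subset hz)]) (-y) (by simp [hy0.le])
      y (by simp [hy0.le]) (by linarith)
    rw [hΔ]; linarith
  have hΔ1 := hmvt _ fun z hz => (hyflat z hz).1
  have hΔ2 := hmvt _ fun z hz => (hyflat z hz).2
  have hΔy : a * y ≤ Δ := by linarith
  have hΔ0 : 0 < Δ := (mul_pos ha0 hy0).trans_le hΔy
  -- distance between the two characteristics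
  set D : ℝ → ℝ := fun t => 2 * y - (t - t₀) * Δ with hD
  have hD0 : M * √(D 0) < Δ / 2 := by
    have h1 : a * D 0 ≤ a ^ 3 / (16 * M ^ 2) * y * (2 * y) := by
      have : a * D 0 = 2 * a * y - Δ := by
        simp only [hD]; linear_combination Δ * ht₀a
      rw [this]; exact hΔ1
    have h2 : a * (M ^ 2 * D 0) ≤ a * ((a * y) ^ 2 / 8) := calc
      a * (M ^ 2 * D 0) = M ^ 2 * (a * D 0) := by ring
      _ ≤ M ^ 2 * (a ^ 3 / (16 * M ^ 2) * y * (2 * y)) := by gcongr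
      _ = a * ((a * y) ^ 2 / 8) := by field_simp; ring
    have h3 : M ^ 2 * D 0 < (Δ / 2) ^ 2 := by
      have h4 := le_of_mul_le_mul_left h2 ha0
      have h5 : (a * y) ^ 2 ≤ Δ ^ 2 := by gcongr
      have h6 : 0 < Δ ^ 2 := by positivity
      linarith
    have h7 : M * √(D 0) = √(M ^ 2 * D 0) := by
      rw [Real.sqrt_mul (sq_nonneg M), Real.sqrt_sq hM.le]
    rw [h7]
    exact (Real.sqrt_lt' (by linarith)).2 h3
  obtain ⟨T, ⟨hT1, hT2⟩, hDT⟩ : ∃ T ∈ Ioo t₀ 0, M * √(D T) < Δ / 2 := by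
    have hc : Continuous fun t => M * √(D t) := by simp only [hD]; fun_prop
    have h1 : ∀ᶠ t in nhdsWithin (0 : ℝ) (Iio 0), M * √(D t) < Δ / 2 :=
      nhdsWithin_le_nhds (hc.continuousAt.eventually_lt_const hD0)
    obtain ⟨T, h2, h3⟩ := (h1.and (Ioo_mem_nhdsLT ht₀neg)).exists
    exact ⟨T, h3, h2⟩
  have hδ : 0 < -T * a := by nlinarith
  have hX : ∀ t ∈ Icc t₀ T, ∀ z, -T * a ≤ 1 + (t - t₀) * deriv f z := fun t ht z => by
    have h1 : (t - t₀) * (-a) ≤ (t - t₀) * deriv f z :=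
      mul_le_mul_of_nonneg_left (by rw [ha, neg_neg]; exact h_min z) (by linarith [ht.1])
    have h2 : t * a ≤ T * a := by gcongr; exact ht.2
    linarith
  have hDpos : 0 < D T := by
    have h1 : Δ ≤ 2 * a * y := by
      have := (convex_Icc (-y) y).mul_sub_le_image_sub_of_le_deriv (f := f) (C := -a)
        hf2.continuous.continuousOn (hf2.differentiable (by norm_num)).differentiableOn
        (fun z hz => by rw [ha, neg_neg]; exact h_min z) (-y) (by simp [hy0.le])
        y (by simp [hy0.le]) (by linarith)
      rw [hΔ]; linarith
    have h2 : (T - t₀) * Δ ≤ (T - t₀) * (2 * a * y) := by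
      gcongr
    have h3 : 0 < -T * a * (2 * y) := by positivity
    have h4 : D T = 2 * y - (T - t₀) * Δ := rfl
    have h5 : 2 * y - (T - t₀) * (2 * a * y) = -T * a * (2 * y) := by
      linear_combination (2 * y) * ht₀a
    linarith
  set Q := Real.exp ((K + 1) / (-T * a) * (T - t₀)) *
    (2 * ((K₂ + 1 + (K + 1) / (-T * a) * (T - t₀) * K₂) / (-T * a) ^ 2) * (T - t₀)) with hQ
  have hQ0 : 0 < Q := by
    have : 0 < T - t₀ := by linarith
    positivity
  refine ⟨min 1 (Δ / (4 * Q)), ⟨by positivity, min_le_left _ _⟩, ?_⟩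
  rintro ν ⟨hν0, hν⟩ u hu hpde hinit hbd
  have hνQ : ν * Q < Δ / 4 := by
    have := (lt_div_iff₀ (by positivity)).1 (hν.trans_le (min_le_right _ _))
    linarith
  obtain ⟨B, hB⟩ := hbd 0
  simp only [iteratedDeriv_zero] at hB
  have hpde' : ∀ t ∈ Ioo t₀ (0 : ℝ), ∀ x : ℝ, deriv (fun s => u s x) t
      = ν * deriv (deriv (fun y => u t y)) x - u t x * deriv (fun y => u t y) x :=
    fun t ht => hpde t ⟨ht.1.le, ht.2⟩
  have hTm : T ∈ Icc t₀ T := ⟨hT1.le, le_rfl⟩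
  have hup := burgers_upper_comparison hf2 hT1 hT2 hν0 hK hK₂ hδ hX hu hpde' hinit hB hTm y
  have hlow := burgers_lower_comparison hf2 hT1 hT2 hν0 hK hK₂ hδ hX hu hpde' hinit hB hTm (-y)
  rw [← hQ] at hup hlow
  have hdist : (y + (T - t₀) * f y) - (-y + (T - t₀) * f (-y)) = D T := by
    simp only [hD, hΔ]; ring
  refine ⟨T, ⟨hT1.le, hT2⟩, y + (T - t₀) * f y, -y + (T - t₀) * f (-y), ?_, ?_⟩
  · rw [← sub_ne_zero, hdist]; exact hDpos.ne'
  · rw [hdist, abs_of_pos hDpos, ← Real.sqrt_eq_rpow, abs_sub_comm]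
    refine lt_of_lt_of_le ?_ (le_abs_self _)
    linarith
end

section
/- Uniqueness of the leading inner profile (uniqueness part of Proposition 3.2 for ℓ = 0, k = 0): Suppose U¹, U² : ℝ² → ℝ are smooth solutions of the unit-viscosity Burgers equation ∂_T U = ∂_X² U − U·∂_X U on ℝ², and there is a constant C such that for j = 1, 2 and all (T,X) ∈ Qᶜ one has |Uʲ(T,X) − 𝔘(T,X)| ≤ C·𝔇(T,X)⁻³ and |∂_X Uʲ(T,X) − ∂_X 𝔘(T,X)| ≤ C·𝔇(T,X)⁻⁶. Then U¹ = U² on (−∞,0] × ℝ. -/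
open Set

/-- The function attains its maximum over `[a, S]` at the right endpoint `S`, so its derivative
there is nonnegative. -/
lemma HasDerivAt.nonneg_of_forall_le_right {f : ℝ → ℝ} {d a S : ℝ} (haS : a < S)
    (hf : HasDerivAt f d S) (hmax : ∀ s ∈ Icc a S, f s ≤ f S) : 0 ≤ d := by
  have h := (hasDerivAt_iff_tendsto_slope.1 hf).mono_left
    (nhdsWithin_mono S (show Iio S ⊆ {S}ᶜ from fun x hx => ne_of_lt hx))
  refine ge_of_tendsto h ?_
  filter_upwards [Ioo_mem_nhdsLT haS] with s hs
  rw [slope_def_field]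
  exact div_nonneg_of_nonpos (by linarith [hmax s ⟨hs.1.le, hs.2.le⟩]) (by linarith [hs.2])

lemma IsLocalMax.deriv_deriv_nonpos {f : ℝ → ℝ} {x : ℝ} (hf : ContinuousAt f x)
    (hmax : IsLocalMax f x) : deriv (deriv f) x ≤ 0 := by
  by_contra! hpos
  have hmin := isLocalMin_of_deriv_deriv_pos hpos hmax.deriv_eq_zero hf
  have hconst : f =ᶠ[nhds x] fun _ => f x := by
    filter_upwards [hmin, hmax] with y h₁ h₂ using le_antisymm h₂ h₁
  have h := hconst.deriv.deriv_eq
  simp at h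
  linarith

lemma contDiff_space_slice {U : ℝ → ℝ → ℝ}
    (hU : ContDiff ℝ (⊤ : ℕ∞) (fun p : ℝ × ℝ => U p.1 p.2)) (T : ℝ) : ContDiff ℝ (⊤ : ℕ∞) (fun X => U T X) :=
  hU.comp (contDiff_const.prodMk contDiff_id)

lemma contDiff_time_slice {U : ℝ → ℝ → ℝ}
    (hU : ContDiff ℝ (⊤ : ℕ∞) (fun p : ℝ × ℝ => U p.1 p.2)) (X : ℝ) : ContDiff ℝ (⊤ : ℕ∞) (fun T => U T X) :=
  hU.comp (contDiff_id.prodMk contDiff_const)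

lemma differentiable_deriv_space_slice {U : ℝ → ℝ → ℝ}
    (hU : ContDiff ℝ (⊤ : ℕ∞) (fun p : ℝ × ℝ => U p.1 p.2)) (T : ℝ) :
    Differentiable ℝ (deriv (fun X => U T X)) :=
  ((contDiff_infty_iff_deriv.1 (contDiff_space_slice hU T)).2).differentiable (by simp)

lemma continuous_deriv_space_slice {U : ℝ → ℝ → ℝ}
    (hU : ContDiff ℝ (⊤ : ℕ∞) (fun p : ℝ × ℝ => U p.1 p.2)) :
    Continuous (fun p : ℝ × ℝ => deriv (fun X => U p.1 X) p.2) := by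
  have h : (fun p : ℝ × ℝ => deriv (fun X => U p.1 X) p.2) =
      fun p => fderiv ℝ (fun p : ℝ × ℝ => U p.1 p.2) p (0, 1) := by
    ext ⟨T, X⟩
    have h₁ := (hU.differentiable (by simp) (T, X)).hasFDerivAt
    have h₂ : HasDerivAt (fun Y : ℝ => ((T, Y) : ℝ × ℝ)) (0, 1) X :=
      (hasDerivAt_const X T).prodMk (hasDerivAt_id X)
    exact (h₁.comp_hasDerivAt X h₂).deriv
  rw [h]
  exact (hU.continuous_fderiv (by simp)).clm_apply continuous_const

/-- Weighted maximum principle for the difference of two Burgers solutions: if `ψ` compensates the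
growth caused by `-∂_X U₂` and the difference decays like `|X|⁻¹`, then the weighted difference
does not exceed its initial bound. -/
lemma burgers_weighted_max_principle {U₁ U₂ : ℝ → ℝ → ℝ}
    (hsm₁ : ContDiff ℝ (⊤ : ℕ∞) (fun p : ℝ × ℝ => U₁ p.1 p.2))
    (hsm₂ : ContDiff ℝ (⊤ : ℕ∞) (fun p : ℝ × ℝ => U₂ p.1 p.2))
    (hpde₁ : ∀ T X : ℝ,
      deriv (fun S => U₁ S X) T
        = deriv (deriv (fun Y => U₁ T Y)) X - U₁ T X * deriv (fun Y => U₁ T Y) X)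
    (hpde₂ : ∀ T X : ℝ,
      deriv (fun S => U₂ S X) T
        = deriv (deriv (fun Y => U₂ T Y)) X - U₂ T X * deriv (fun Y => U₂ T Y) X)
    {a b A M : ℝ} (hM : 0 ≤ M) {ψ ψ' : ℝ → ℝ}
    (hψ : ∀ S ∈ Icc a b, HasDerivAt ψ (ψ' S) S) (hψpos : ∀ S ∈ Icc a b, 0 < ψ S)
    (hgrowth : ∀ S ∈ Icc a b, ∀ X, ψ' S - ψ S * deriv (fun Y => U₂ S Y) X < 0)
    (hdecay : ∀ S ∈ Icc a b, ∀ X, 1 ≤ |X| → (U₁ S X - U₂ S X) * |X| ≤ A)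
    (hinit : ∀ X, ψ a * (U₁ a X - U₂ a X) ≤ M) :
    ∀ T ∈ Icc a b, ∀ X, ψ T * (U₁ T X - U₂ T X) ≤ M := by
  intro T hT X
  by_contra! hlt
  set v := ψ T * (U₁ T X - U₂ T X) with hv
  have hv0 : 0 < v := hM.trans_lt hlt
  have hψc : ContinuousOn ψ (Icc a b) := fun S hS => (hψ S hS).continuousAt.continuousWithinAt
  obtain ⟨P, hP⟩ := isCompact_Icc.bddAbove_image hψc
  have hP' : ∀ S ∈ Icc a b, ψ S ≤ P := fun S hS => hP (mem_image_of_mem ψ hS)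
  have hP0 : 0 < P := (hψpos T hT).trans_le (hP' T hT)
  set R := max (max 1 |X|) (P * |A| / v) with hR
  have hR1 : 1 ≤ R := (le_max_left _ _).trans (le_max_left _ _)
  have hRX : |X| ≤ R := (le_max_right _ _).trans (le_max_left _ _)
  have hRA : P * |A| ≤ R * v := (div_le_iff₀ hv0).1 (le_max_right _ _)
  have houter : ∀ S ∈ Icc a b, ∀ Y, R ≤ |Y| → ψ S * (U₁ S Y - U₂ S Y) ≤ v := by
    intro S hS Y hY
    have hY0 : 0 < |Y| := by linarith
    have h₁ : ψ S * ((U₁ S Y - U₂ S Y) * |Y|) ≤ P * |A| :=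
      (mul_le_mul_of_nonneg_left ((hdecay S hS Y (hR1.trans hY)).trans (le_abs_self A))
        (hψpos S hS).le).trans (mul_le_mul_of_nonneg_right (hP' S hS) (abs_nonneg A))
    refine le_of_mul_le_mul_right ?_ hY0
    calc ψ S * (U₁ S Y - U₂ S Y) * |Y| = ψ S * ((U₁ S Y - U₂ S Y) * |Y|) := by ring
      _ ≤ R * v := h₁.trans hRA
      _ ≤ v * |Y| := by nlinarith
  have hcont : ContinuousOn (fun p : ℝ × ℝ => ψ p.1 * (U₁ p.1 p.2 - U₂ p.1 p.2))
      (Icc a b ×ˢ Icc (-R) R) :=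
    (hψc.comp continuousOn_fst fun p hp => hp.1).mul
      (hsm₁.continuous.sub hsm₂.continuous).continuousOn
  obtain ⟨⟨S, Y⟩, ⟨hS, -⟩, hmax⟩ := (isCompact_Icc.prod isCompact_Icc).exists_isMaxOn
    ⟨(T, X), hT, abs_le.1 hRX⟩ hcont
  have hSv : v ≤ ψ S * (U₁ S Y - U₂ S Y) :=
    hmax (show (T, X) ∈ Icc a b ×ˢ Icc (-R) R from ⟨hT, abs_le.1 hRX⟩)
  have hglobal : ∀ s ∈ Icc a b, ∀ y,
      ψ s * (U₁ s y - U₂ s y) ≤ ψ S * (U₁ S Y - U₂ S Y) := by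
    intro s hs y
    rcases le_total R |y| with h | h
    · exact (houter s hs y h).trans hSv
    · exact hmax (show (s, y) ∈ Icc a b ×ˢ Icc (-R) R from ⟨hs, abs_le.1 h⟩)
  change a ≤ S ∧ S ≤ b at hS
  have haS : a < S := by
    refine lt_of_le_of_ne hS.1 ?_
    rintro rfl
    linarith [hinit Y]
  have hψS := hψpos S hS
  have hW : 0 < U₁ S Y - U₂ S Y := pos_of_mul_pos_right (hv0.trans_le hSv) hψS.le
  have hd₁ := (contDiff_space_slice hsm₁ S).differentiable (by simp)
  have hd₂ := (contDiff_space_slice hsm₂ S).differentiable (by simp)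
  have hlocal : IsLocalMax (fun y => U₁ S y - U₂ S y) Y :=
    Filter.Eventually.of_forall fun y => le_of_mul_le_mul_left (hglobal S hS y) hψS
  have hderiv : deriv (fun y => U₁ S y - U₂ S y) =
      fun y => deriv (fun y => U₁ S y) y - deriv (fun y => U₂ S y) y :=
    funext fun y => deriv_fun_sub (hd₁ y) (hd₂ y)
  have hX : deriv (fun y => U₁ S y) Y - deriv (fun y => U₂ S y) Y = 0 := by
    simpa [hderiv] using hlocal.deriv_eq_zero
  have hXX : deriv (deriv (fun y => U₁ S y)) Y - deriv (deriv (fun y => U₂ S y)) Y ≤ 0 := by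
    have h := hlocal.deriv_deriv_nonpos (hd₁.fun_sub hd₂).continuous.continuousAt
    rwa [hderiv, deriv_fun_sub (differentiable_deriv_space_slice hsm₁ S Y)
      (differentiable_deriv_space_slice hsm₂ S Y)] at h
  have ht₁ := ((contDiff_time_slice hsm₁ Y).differentiable (by simp) S).hasDerivAt
  have ht₂ := ((contDiff_time_slice hsm₂ Y).differentiable (by simp) S).hasDerivAt
  have htime := ((hψ S hS).mul (ht₁.sub ht₂)).nonneg_of_forall_le_right haS
    fun s hs => hglobal s ⟨hs.1, hs.2.trans hS.2⟩ Y
  simp only [Pi.sub_apply] at htime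
  rw [hpde₁, hpde₂] at htime
  have h₁ := mul_neg_of_neg_of_pos (hgrowth S hS Y) hW
  have h₂ := mul_nonpos_of_nonneg_of_nonpos hψS.le hXX
  rw [sub_eq_zero] at hX
  rw [hX] at htime
  nlinarith

lemma profile_weight_sq {β₃ : ℝ} (hβ₃ : 0 < β₃) {UU DD : ℝ → ℝ → ℝ}
    (hDD : ∀ T X : ℝ, DD T X = Real.sqrt (|T| + 3 * β₃ * UU T X ^ 2))
    {T : ℝ} (hT : T < 0) (X : ℝ) :
    DD T X ^ 2 = -T + 3 * β₃ * UU T X ^ 2 := by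
  rw [hDD, Real.sq_sqrt (by positivity), abs_of_neg hT]

lemma neg_le_profile_weight_sq {β₃ : ℝ} (hβ₃ : 0 < β₃) {UU DD : ℝ → ℝ → ℝ}
    (hDD : ∀ T X : ℝ, DD T X = Real.sqrt (|T| + 3 * β₃ * UU T X ^ 2))
    {T : ℝ} (hT : T < 0) (X : ℝ) : -T ≤ DD T X ^ 2 := by
  rw [profile_weight_sq hβ₃ hDD hT]
  have : 0 ≤ 3 * β₃ * UU T X ^ 2 := by positivity
  linarith

lemma profile_weight_pos {β₃ : ℝ} (hβ₃ : 0 < β₃) {UU DD : ℝ → ℝ → ℝ}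
    (hDD : ∀ T X : ℝ, DD T X = Real.sqrt (|T| + 3 * β₃ * UU T X ^ 2))
    {T : ℝ} (hT : T < 0) (X : ℝ) : 0 < DD T X := by
  rw [hDD]
  have : 0 < |T| := abs_pos.2 hT.ne
  positivity

lemma sq_le_profile_weight_pow_six {β₃ : ℝ} (hβ₃ : 0 < β₃) {UU DD : ℝ → ℝ → ℝ}
    (hUU : ∀ T : ℝ, T < 0 → ∀ X : ℝ, T * UU T X - β₃ * UU T X ^ 3 = X)
    (hDD : ∀ T X : ℝ, DD T X = Real.sqrt (|T| + 3 * β₃ * UU T X ^ 2))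
    {T : ℝ} (hT : T < 0) (X : ℝ) :
    3 * β₃ / 4 * X ^ 2 ≤ DD T X ^ 6 := by
  set u := UU T X with hu
  have hX : X = T * u - β₃ * u ^ 3 := (hUU T hT X).symm
  have hs := profile_weight_sq hβ₃ hDD hT X
  rw [← hu] at hs
  have hu2 : 0 ≤ β₃ * u ^ 2 := by positivity
  have h₁ : 3 * β₃ * u ^ 2 ≤ DD T X ^ 2 := by linarith
  have h₂ : (-T + β₃ * u ^ 2) ^ 2 ≤ (DD T X ^ 2) ^ 2 :=
    pow_le_pow_left₀ (by linarith) (by linarith) 2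
  have h₃ : 0 ≤ (DD T X ^ 2) ^ 2 := by positivity
  calc 3 * β₃ / 4 * X ^ 2 = (3 * β₃ * u ^ 2) * (-T + β₃ * u ^ 2) ^ 2 / 4 := by rw [hX]; ring
    _ ≤ DD T X ^ 2 * (DD T X ^ 2) ^ 2 / 4 := by gcongr
    _ ≤ DD T X ^ 6 := by
      have : 0 ≤ DD T X ^ 6 := by positivity
      nlinarith

lemma abs_le_profile_weight_cube {β₃ : ℝ} (hβ₃ : 0 < β₃) {UU DD : ℝ → ℝ → ℝ}
    (hUU : ∀ T : ℝ, T < 0 → ∀ X : ℝ, T * UU T X - β₃ * UU T X ^ 3 = X)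
    (hDD : ∀ T X : ℝ, DD T X = Real.sqrt (|T| + 3 * β₃ * UU T X ^ 2))
    {T : ℝ} (hT : T < 0) (X : ℝ) :
    Real.sqrt (3 * β₃ / 4) * |X| ≤ DD T X ^ 3 := by
  have hD := profile_weight_pos hβ₃ hDD hT X
  refine le_of_sq_le_sq ?_ (by positivity)
  rw [mul_pow, Real.sq_sqrt (by positivity), sq_abs, ← pow_mul]
  exact sq_le_profile_weight_pow_six hβ₃ hUU hDD hT X

lemma neg_inv_le_deriv_profile {β₃ : ℝ} (hβ₃ : 0 < β₃) {UU DD : ℝ → ℝ → ℝ}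
    (hUU : ∀ T : ℝ, T < 0 → ∀ X : ℝ, T * UU T X - β₃ * UU T X ^ 3 = X)
    (hDD : ∀ T X : ℝ, DD T X = Real.sqrt (|T| + 3 * β₃ * UU T X ^ 2))
    {T : ℝ} (hT : T < 0) (X : ℝ) :
    -(1 / DD T X ^ 2) ≤ deriv (fun Y => UU T Y) X := by
  have hD := profile_weight_pos hβ₃ hDD hT X
  by_cases h : DifferentiableAt ℝ (fun Y => UU T Y) X
  · have h₁ := (h.hasDerivAt.const_mul T).sub ((h.hasDerivAt.pow 3).const_mul β₃)
    have h₂ := h₁.unique ((hasDerivAt_id X).congr_of_eventuallyEq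
      (Filter.Eventually.of_forall fun Y => hUU T hT Y))
    have hs := profile_weight_sq hβ₃ hDD hT X
    have h₃ : DD T X ^ 2 * deriv (fun Y => UU T Y) X = -1 := by
      rw [hs]
      norm_num at h₂
      linarith
    have : deriv (fun Y => UU T Y) X = -(1 / DD T X ^ 2) := by
      field_simp
      linarith
    exact this.ge
  · rw [deriv_zero_of_not_differentiableAt h]
    have : 0 ≤ 1 / DD T X ^ 2 := by positivity
    linarith

/-- One-sided comparison of two inner solutions asymptotic to the same profile. -/
lemma inner_solution_le {β₃ : ℝ} (hβ₃ : 0 < β₃) {UU DD : ℝ → ℝ → ℝ}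
    (hUU : ∀ T : ℝ, T < 0 → ∀ X : ℝ, T * UU T X - β₃ * UU T X ^ 3 = X)
    (hDD : ∀ T X : ℝ, DD T X = Real.sqrt (|T| + 3 * β₃ * UU T X ^ 2))
    {U₁ U₂ : ℝ → ℝ → ℝ}
    (hsm₁ : ContDiff ℝ (⊤ : ℕ∞) (fun p : ℝ × ℝ => U₁ p.1 p.2))
    (hsm₂ : ContDiff ℝ (⊤ : ℕ∞) (fun p : ℝ × ℝ => U₂ p.1 p.2))
    (hpde₁ : ∀ T X : ℝ,
      deriv (fun S => U₁ S X) T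
        = deriv (deriv (fun Y => U₁ T Y)) X - U₁ T X * deriv (fun Y => U₁ T Y) X)
    (hpde₂ : ∀ T X : ℝ,
      deriv (fun S => U₂ S X) T
        = deriv (deriv (fun Y => U₂ T Y)) X - U₂ T X * deriv (fun Y => U₂ T Y) X)
    {C : ℝ}
    (hbd₁ : ∀ T : ℝ, T < 0 → ∀ X : ℝ,
      (T, X) ∉ Set.Ioo (-1:ℝ) 0 ×ˢ Set.Ioo (-1:ℝ) 1 →
      |U₁ T X - UU T X| ≤ C / DD T X ^ 3)
    (hbd₂ : ∀ T : ℝ, T < 0 → ∀ X : ℝ,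
      (T, X) ∉ Set.Ioo (-1:ℝ) 0 ×ˢ Set.Ioo (-1:ℝ) 1 →
      |U₂ T X - UU T X| ≤ C / DD T X ^ 3 ∧
      |deriv (fun Y => U₂ T Y) X - deriv (fun Y => UU T Y) X| ≤ C / DD T X ^ 6)
    {T : ℝ} (hT : T < 0) (X : ℝ) : U₁ T X ≤ U₂ T X := by
  have hDpos : ∀ {S : ℝ}, S < 0 → ∀ Y, 0 < DD S Y := fun hS Y => profile_weight_pos hβ₃ hDD hS Y
  have hC : 0 ≤ C := by
    have h := (abs_nonneg _).trans (hbd₁ (-1) (by norm_num) 0 (by simp))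
    by_contra! hneg
    have := div_neg_of_neg_of_pos hneg (pow_pos (hDpos (S := -1) (by norm_num) 0) 3)
    linarith
  have hdiff : ∀ S : ℝ, S < 0 → ∀ Y : ℝ, (S, Y) ∉ Set.Ioo (-1:ℝ) 0 ×ˢ Set.Ioo (-1:ℝ) 1 →
      U₁ S Y - U₂ S Y ≤ 2 * C / DD S Y ^ 3 := by
    intro S hS Y hSY
    have h₁ := (abs_le.1 (hbd₁ S hS Y hSY)).2
    have h₂ := (abs_le.1 (hbd₂ S hS Y hSY).1).1
    rw [mul_div_assoc]
    linarith
  have hslope : ∀ S : ℝ, S < 0 → ∀ Y : ℝ, (S, Y) ∉ Set.Ioo (-1:ℝ) 0 ×ˢ Set.Ioo (-1:ℝ) 1 →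
      -deriv (fun Y => U₂ S Y) Y ≤ 1 / DD S Y ^ 2 + C / DD S Y ^ 6 := by
    intro S hS Y hSY
    have h₁ := (abs_le.1 (hbd₂ S hS Y hSY).2).1
    have h₂ := neg_inv_le_deriv_profile hβ₃ hUU hDD hS Y
    linarith
  set c := Real.sqrt (3 * β₃ / 4) with hc
  have hcpos : 0 < c := Real.sqrt_pos.2 (by positivity)
  have hdecay : ∀ S : ℝ, S < 0 → ∀ Y : ℝ, 1 ≤ |Y| →
      (U₁ S Y - U₂ S Y) * |Y| ≤ 2 * C / c := by
    intro S hS Y hY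
    have hSY : (S, Y) ∉ Set.Ioo (-1:ℝ) 0 ×ˢ Set.Ioo (-1:ℝ) 1 := fun h =>
      (abs_lt.2 h.2).not_ge hY
    have hY0 : 0 < |Y| := by linarith
    have h₁ := abs_le_profile_weight_cube hβ₃ hUU hDD hS Y
    calc (U₁ S Y - U₂ S Y) * |Y| ≤ 2 * C / (c * |Y|) * |Y| := by
          gcongr
          exact (hdiff S hS Y hSY).trans (by gcongr)
      _ = 2 * C / c := by field_simp
  have hearly : ∀ S : ℝ, S ≤ -1 → ∀ Y : ℝ, U₁ S Y ≤ U₂ S Y := by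
    intro S hS Y
    set ψ : ℝ → ℝ := fun s => -s * Real.exp ((C + 1) * s⁻¹) with hψdef
    have hψS : 0 < ψ S := mul_pos (by linarith) (Real.exp_pos _)
    have hout : ∀ s ≤ (-1 : ℝ), ∀ y : ℝ,
        (s, y) ∉ Set.Ioo (-1:ℝ) 0 ×ˢ Set.Ioo (-1:ℝ) 1 := fun s hs y h => hs.not_gt h.1.1
    have hbound : ∀ a ≤ S, ψ S * (U₁ S Y - U₂ S Y) ≤ 2 * C / Real.sqrt (-a) := by
      intro a ha
      have ha1 : a ≤ -1 := ha.trans hS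
      have hsq : 0 < Real.sqrt (-a) := Real.sqrt_pos.2 (by linarith)
      refine burgers_weighted_max_principle hsm₁ hsm₂ hpde₁ hpde₂ (a := a) (b := -1)
        (A := 2 * C / c) (ψ := ψ)
        (ψ' := fun s => ψ s * (1 / s - (C + 1) / s ^ 2)) (by positivity) ?_ ?_ ?_ ?_ ?_
        S ⟨ha, hS⟩ Y
      · rintro s ⟨-, hs⟩
        have hs0 : s ≠ 0 := by linarith
        have h := (hasDerivAt_neg s).mul (((hasDerivAt_inv hs0).const_mul (C + 1)).exp)
        refine h.congr_deriv ?_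
        simp only [hψdef]
        field_simp
        ring
      · rintro s ⟨-, hs⟩
        exact mul_pos (by linarith) (Real.exp_pos _)
      · rintro s ⟨-, hs⟩ y
        have hs0 : s < 0 := by linarith
        have hψs : 0 < ψ s := mul_pos (by linarith) (Real.exp_pos _)
        have hD := hDpos hs0 y
        have hsD := neg_le_profile_weight_sq hβ₃ hDD hs0 y
        have h₁ := hslope s hs0 y (hout s hs y)
        have h₂ : 1 / DD s y ^ 2 ≤ 1 / -s :=
          one_div_le_one_div_of_le (by linarith) hsD
        have h₃ : s ^ 2 ≤ DD s y ^ 6 := by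
          have : (-s) ^ 3 ≤ (DD s y ^ 2) ^ 3 := pow_le_pow_left₀ (by linarith) hsD 3
          nlinarith [sq_nonneg s]
        have h₄ : C / DD s y ^ 6 ≤ C / s ^ 2 := by
          have : 0 < s ^ 2 := sq_pos_of_neg hs0
          gcongr
        have h₅ : C / s ^ 2 < (C + 1) / s ^ 2 := by
          have : 0 < s ^ 2 := sq_pos_of_neg hs0
          gcongr
          linarith
        have h₆ : 1 / s = -(1 / -s) := by rw [div_neg, neg_neg]
        have h₇ : 1 / s - (C + 1) / s ^ 2 - deriv (fun Y => U₂ s Y) y < 0 := by linarith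
        rw [← mul_sub]
        exact mul_neg_of_pos_of_neg hψs h₇
      · rintro s ⟨-, hs⟩ y hy
        exact hdecay s (by linarith) y hy
      · intro y
        have ha0 : a < 0 := by linarith
        have hψa : ψ a ≤ -a := by
          have : Real.exp ((C + 1) * a⁻¹) ≤ 1 :=
            Real.exp_le_one_iff.2
              (mul_nonpos_of_nonneg_of_nonpos (by linarith) (inv_nonpos.2 ha0.le))
          simp only [hψdef]
          nlinarith
        have hD := hDpos ha0 y
        have hrt : Real.sqrt (-a) ≤ DD a y :=
          Real.sqrt_le_iff.2 ⟨hD.le, neg_le_profile_weight_sq hβ₃ hDD ha0 y⟩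
        have hψa0 : 0 < ψ a := mul_pos (by linarith) (Real.exp_pos _)
        calc ψ a * (U₁ a y - U₂ a y) ≤ ψ a * (2 * C / DD a y ^ 3) := by
              gcongr
              exact hdiff a ha0 y (hout a ha1 y)
          _ ≤ Real.sqrt (-a) ^ 2 * (2 * C / Real.sqrt (-a) ^ 3) := by
              rw [Real.sq_sqrt (by linarith)]
              gcongr
              linarith
          _ = 2 * C / Real.sqrt (-a) := by field_simp
    have hlim : Filter.Tendsto (fun a : ℝ => 2 * C / Real.sqrt (-a)) Filter.atBot (nhds 0) :=
      (Real.tendsto_sqrt_atTop.comp Filter.tendsto_neg_atBot_atTop).const_div_atTop _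
    have h := ge_of_tendsto hlim ((Filter.eventually_le_atBot S).mono hbound)
    linarith [nonpos_of_mul_nonpos_right h hψS]
  rcases le_total T (-1) with hT1 | hT1
  · exact hearly T hT1 X
  obtain ⟨B, hB⟩ := (isCompact_Icc.prod isCompact_Icc).exists_bound_of_continuousOn
    (s := Icc (-1:ℝ) 0 ×ˢ Icc (-1:ℝ) 1) (continuous_deriv_space_slice hsm₂).continuousOn
  set q := 3 * β₃ / 4 with hq
  have hqpos : 0 < q := by positivity
  set K := |B| + 1 + 1 / q + C / q with hK
  have hKbound : ∀ s ∈ Icc (-1) T, ∀ y, -deriv (fun Y => U₂ s Y) y ≤ K := by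
    rintro s ⟨hs, hsT⟩ y
    have hs0 : s < 0 := hsT.trans_lt hT
    have hq1 : 0 ≤ 1 / q := by positivity
    have hq2 : 0 ≤ C / q := by positivity
    by_cases hy : |y| ≤ 1
    · have h := hB (s, y) ⟨⟨hs, hs0.le⟩, abs_le.1 hy⟩
      have h' := (abs_le.1 h).1
      simp only at h'
      linarith [le_abs_self B]
    · push Not at hy
      have hD := hDpos hs0 y
      have hD6 : q ≤ DD s y ^ 6 := by
        refine le_trans ?_ (sq_le_profile_weight_pow_six hβ₃ hUU hDD hs0 y)
        rw [← sq_abs y]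
        exact le_mul_of_one_le_right hqpos.le (one_le_pow₀ hy.le)
      have h₁ := hslope s hs0 y fun h => (abs_lt.2 h.2).not_gt hy
      have h₂ : C / DD s y ^ 6 ≤ C / q := by gcongr
      have h₃ : 1 / DD s y ^ 2 ≤ 1 + 1 / q := by
        rcases le_total 1 (DD s y) with h | h
        · have : 1 / DD s y ^ 2 ≤ 1 := by
            rw [div_le_one (by positivity)]
            exact one_le_pow₀ h
          linarith
        · have h6 : q ≤ DD s y ^ 2 :=
            hD6.trans (pow_le_pow_of_le_one hD.le h (by norm_num))
          have : 1 / DD s y ^ 2 ≤ 1 / q := by gcongr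
          linarith
      linarith [abs_nonneg B]
  have hlate := burgers_weighted_max_principle hsm₁ hsm₂ hpde₁ hpde₂ (a := -1) (b := T)
    (A := 2 * C / c) (M := 0) le_rfl (ψ := fun s => Real.exp (-(K + 1) * s))
    (ψ' := fun s => Real.exp (-(K + 1) * s) * (-(K + 1))) ?_ ?_ ?_ ?_ ?_ T ⟨hT1, le_rfl⟩ X
  · linarith [nonpos_of_mul_nonpos_right hlate (Real.exp_pos _)]
  · intro s _
    simpa using ((hasDerivAt_id s).const_mul (-(K + 1))).exp
  · intro s _
    exact Real.exp_pos _
  · intro s hs y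
    rw [← mul_sub]
    exact mul_neg_of_pos_of_neg (Real.exp_pos _) (by linarith [hKbound s hs y])
  · rintro s ⟨-, hs⟩ y hy
    exact hdecay s (hs.trans_lt hT) y hy
  · intro y
    exact mul_nonpos_of_nonneg_of_nonpos (Real.exp_pos _).le
      (by linarith [hearly (-1) le_rfl y])

/-- Uniqueness of the leading inner profile (uniqueness part of Proposition 3.2
for `ℓ = 0`, `k = 0`). -/
theorem statement2
    (β₃ : ℝ) (hβ₃ : 0 < β₃)
    (UU : ℝ → ℝ → ℝ)
    (hUU : ∀ T : ℝ, T < 0 → ∀ X : ℝ, T * UU T X - β₃ * UU T X ^ 3 = X)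
    (DD : ℝ → ℝ → ℝ)
    (hDD : ∀ T X : ℝ, DD T X = Real.sqrt (|T| + 3 * β₃ * UU T X ^ 2))
    (U₁ U₂ : ℝ → ℝ → ℝ)
    (hsm₁ : ContDiff ℝ (⊤ : ℕ∞) (fun p : ℝ × ℝ => U₁ p.1 p.2))
    (hsm₂ : ContDiff ℝ (⊤ : ℕ∞) (fun p : ℝ × ℝ => U₂ p.1 p.2))
    (hpde₁ : ∀ T X : ℝ,
      deriv (fun S => U₁ S X) T
        = deriv (deriv (fun Y => U₁ T Y)) X - U₁ T X * deriv (fun Y => U₁ T Y) X)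
    (hpde₂ : ∀ T X : ℝ,
      deriv (fun S => U₂ S X) T
        = deriv (deriv (fun Y => U₂ T Y)) X - U₂ T X * deriv (fun Y => U₂ T Y) X)
    (C : ℝ)
    (hbd₁ : ∀ T : ℝ, T < 0 → ∀ X : ℝ,
      (T, X) ∉ Set.Ioo (-1:ℝ) 0 ×ˢ Set.Ioo (-1:ℝ) 1 →
      |U₁ T X - UU T X| ≤ C / DD T X ^ 3 ∧
      |deriv (fun Y => U₁ T Y) X - deriv (fun Y => UU T Y) X| ≤ C / DD T X ^ 6)
    (hbd₂ : ∀ T : ℝ, T < 0 → ∀ X : ℝ,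
      (T, X) ∉ Set.Ioo (-1:ℝ) 0 ×ˢ Set.Ioo (-1:ℝ) 1 →
      |U₂ T X - UU T X| ≤ C / DD T X ^ 3 ∧
      |deriv (fun Y => U₂ T Y) X - deriv (fun Y => UU T Y) X| ≤ C / DD T X ^ 6) :
    ∀ T : ℝ, T ≤ 0 → ∀ X : ℝ, U₁ T X = U₂ T X := by
  have hneg : ∀ T < (0 : ℝ), ∀ X : ℝ, U₁ T X = U₂ T X := fun T hT X => le_antisymm
    (inner_solution_le hβ₃ hUU hDD hsm₁ hsm₂ hpde₁ hpde₂
      (fun T hT X h => (hbd₁ T hT X h).1) hbd₂ hT X)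
    (inner_solution_le hβ₃ hUU hDD hsm₂ hsm₁ hpde₂ hpde₁
      (fun T hT X h => (hbd₂ T hT X h).1) hbd₁ hT X)
  intro T hT X
  have hclosed : IsClosed {S : ℝ | U₁ S X = U₂ S X} :=
    isClosed_eq (contDiff_time_slice hsm₁ X).continuous (contDiff_time_slice hsm₂ X).continuous
  have hsub : closure (Iio (0 : ℝ)) ⊆ {S : ℝ | U₁ S X = U₂ S X} :=
    hclosed.closure_subset_iff.2 fun S hS => hneg S hS X
  rw [closure_Iio] at hsub
  exact hsub hT
end

section
/- Explicit representation of the leading inner profile (Proposition A.1, Cole–Hopf step): φ is a positive smooth function on ℝ² solving the heat equation ∂_T φ = ∂_X² φ; moreover Φ = −2·(∂_X φ)/φ, and Φ is a smooth solution of the unit-viscosity Burgers equation ∂_T Φ = ∂_X² Φ − Φ·∂_X Φ on ℝ². -/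
open Set MeasureTheory

/-- The `n`-th moment of the weight `exp (X ζ / 2 + T ζ² / 4 - β ζ⁴ / 8)` at `p = (T, X)`. -/
noncomputable def quarticMoment (β : ℝ) (n : ℕ) (p : ℝ × ℝ) : ℝ :=
  ∫ ζ : ℝ, ζ ^ n * Real.exp (p.2 * ζ / 2 + p.1 * ζ ^ 2 / 4 - β / 8 * ζ ^ 4)

theorem integrable_abs_pow_mul_exp_neg_sq (n : ℕ) :
    Integrable (fun ζ : ℝ => |ζ| ^ n * Real.exp (-ζ ^ 2)) := by
  have h := integrable_rpow_mul_exp_neg_mul_sq (b := 1) one_pos (s := n)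
    (by linarith [n.cast_nonneg (α := ℝ)])
  refine h.norm.congr (Filter.Eventually.of_forall fun ζ => ?_)
  simp [Real.rpow_natCast]

/-- On bounded sets of parameters the quartic weight is dominated by a Gaussian. -/
theorem exists_exp_quartic_le {β : ℝ} (hβ : 0 < β) (A : ℝ) :
    ∃ K : ℝ, 0 ≤ K ∧ ∀ T X ζ : ℝ, |T| ≤ A → |X| ≤ A →
      Real.exp (X * ζ / 2 + T * ζ ^ 2 / 4 - β / 8 * ζ ^ 4) ≤ K * Real.exp (-ζ ^ 2) := by
  refine ⟨Real.exp (A + 2 * (2 * A + 1) ^ 2 / β), (Real.exp_pos _).le,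
    fun T X ζ hT hX => ?_⟩
  rw [← Real.exp_add, Real.exp_le_exp]
  have hA : 0 ≤ A := (abs_nonneg T).trans hT
  have h1 : X * ζ ≤ A * (1 + ζ ^ 2) := by
    calc X * ζ ≤ |X| * |ζ| := by rw [← abs_mul]; exact le_abs_self _
      _ ≤ A * (1 + ζ ^ 2) := by
        refine mul_le_mul hX ?_ (abs_nonneg _) hA
        nlinarith [sq_abs ζ, sq_nonneg (|ζ| - 1), abs_nonneg ζ]
  have h2 : T * ζ ^ 2 ≤ A * ζ ^ 2 :=
    mul_le_mul_of_nonneg_right ((le_abs_self T).trans hT) (sq_nonneg ζ)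
  have h3 : (2 * A + 1) * ζ ^ 2 ≤ 2 * (2 * A + 1) ^ 2 / β + β / 8 * ζ ^ 4 := by
    have h4 : 2 * (2 * A + 1) ^ 2 / β + β / 8 * ζ ^ 4 - (2 * A + 1) * ζ ^ 2
        = 2 * (2 * A + 1 - β * ζ ^ 2 / 4) ^ 2 / β := by
      field_simp
      ring
    have h5 : 0 ≤ 2 * (2 * A + 1 - β * ζ ^ 2 / 4) ^ 2 / β := by positivity
    linarith
  nlinarith [sq_nonneg ζ, mul_nonneg hA (sq_nonneg ζ)]

theorem integrable_pow_mul_exp_quartic {β : ℝ} (hβ : 0 < β) (n : ℕ) (p : ℝ × ℝ) :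
    Integrable (fun ζ : ℝ =>
      ζ ^ n * Real.exp (p.2 * ζ / 2 + p.1 * ζ ^ 2 / 4 - β / 8 * ζ ^ 4)) := by
  obtain ⟨K, -, hK⟩ := exists_exp_quartic_le hβ (max |p.1| |p.2|)
  refine ((integrable_abs_pow_mul_exp_neg_sq n).const_mul K).mono'
    (by fun_prop) (Filter.Eventually.of_forall fun ζ => ?_)
  rw [norm_mul, norm_pow, Real.norm_eq_abs, Real.norm_eq_abs, Real.abs_exp, mul_left_comm]
  exact mul_le_mul_of_nonneg_left (hK _ _ ζ (le_max_left _ _) (le_max_right _ _)) (by positivity)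

theorem hasFDerivAt_quarticMoment {β : ℝ} (hβ : 0 < β) (n : ℕ) (p : ℝ × ℝ) :
    HasFDerivAt (quarticMoment β n)
      ((quarticMoment β (n + 2) p / 4) • ContinuousLinearMap.fst ℝ ℝ ℝ +
        (quarticMoment β (n + 1) p / 2) • ContinuousLinearMap.snd ℝ ℝ ℝ) p := by
  set w : ℝ × ℝ → ℝ → ℝ := fun q ζ =>
    Real.exp (q.2 * ζ / 2 + q.1 * ζ ^ 2 / 4 - β / 8 * ζ ^ 4) with hw
  set F' : ℝ × ℝ → ℝ → (ℝ × ℝ →L[ℝ] ℝ) := fun q ζ =>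
    (ζ ^ (n + 2) * w q ζ / 4) • ContinuousLinearMap.fst ℝ ℝ ℝ +
      (ζ ^ (n + 1) * w q ζ / 2) • ContinuousLinearMap.snd ℝ ℝ ℝ with hF'
  have hint (k : ℕ) (q : ℝ × ℝ) : Integrable (fun ζ => ζ ^ k * w q ζ) :=
    integrable_pow_mul_exp_quartic hβ k q
  have hF'int : ∫ ζ, F' p ζ =
      (quarticMoment β (n + 2) p / 4) • ContinuousLinearMap.fst ℝ ℝ ℝ +
        (quarticMoment β (n + 1) p / 2) • ContinuousLinearMap.snd ℝ ℝ ℝ := by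
    rw [hF', integral_add (((hint _ p).div_const 4).smul_const _)
      (((hint _ p).div_const 2).smul_const _), integral_smul_const, integral_smul_const,
      integral_div, integral_div]
    rfl
  obtain ⟨K, hK0, hK⟩ := exists_exp_quartic_le hβ (‖p‖ + 1)
  rw [← hF'int]
  refine hasFDerivAt_integral_of_dominated_of_fderiv_le (F := fun q ζ => ζ ^ n * w q ζ)
    (bound := fun ζ => K * (|ζ| ^ (n + 2) * Real.exp (-ζ ^ 2)) +
      K * (|ζ| ^ (n + 1) * Real.exp (-ζ ^ 2)))
    (Metric.ball_mem_nhds p one_pos) ?_ (hint n p) ?_ ?_ ?_ ?_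
  · exact Filter.Eventually.of_forall fun q => (hint n q).aestronglyMeasurable
  · refine Continuous.aestronglyMeasurable ?_
    fun_prop
  · refine Filter.Eventually.of_forall fun ζ q hq => ?_
    have hq' : ‖q‖ ≤ ‖p‖ + 1 := by
      have := norm_le_norm_add_norm_sub' q p
      rw [Metric.mem_ball, dist_eq_norm] at hq
      linarith
    have hwK : w q ζ ≤ K * Real.exp (-ζ ^ 2) :=
      hK _ _ ζ ((norm_fst_le q).trans hq') ((norm_snd_le q).trans hq')
    have hw0 : 0 ≤ w q ζ := (Real.exp_pos _).le
    have key (k : ℕ) (c : ℝ) (hc : 1 ≤ c) (L : ℝ × ℝ →L[ℝ] ℝ) (hL : ‖L‖ ≤ 1) :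
        ‖(ζ ^ k * w q ζ / c) • L‖ ≤ K * (|ζ| ^ k * Real.exp (-ζ ^ 2)) := by
      have hnorm : ‖ζ ^ k * w q ζ / c‖ = |ζ| ^ k * w q ζ / c := by
        rw [norm_div, norm_mul, norm_pow, Real.norm_eq_abs, Real.norm_of_nonneg hw0,
          Real.norm_of_nonneg (by linarith : 0 ≤ c)]
      rw [norm_smul, hnorm]
      calc |ζ| ^ k * w q ζ / c * ‖L‖ ≤ |ζ| ^ k * w q ζ / c :=
            mul_le_of_le_one_right (by positivity) hL
        _ ≤ |ζ| ^ k * w q ζ := div_le_self (by positivity) hc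
        _ ≤ |ζ| ^ k * (K * Real.exp (-ζ ^ 2)) := by gcongr
        _ = K * (|ζ| ^ k * Real.exp (-ζ ^ 2)) := by ring
    exact (norm_add_le _ _).trans (add_le_add
      (key _ 4 (by norm_num) _ (ContinuousLinearMap.norm_fst_le ℝ ℝ ℝ))
      (key _ 2 (by norm_num) _ (ContinuousLinearMap.norm_snd_le ℝ ℝ ℝ)))
  · exact ((integrable_abs_pow_mul_exp_neg_sq _).const_mul K).add
      ((integrable_abs_pow_mul_exp_neg_sq _).const_mul K)
  · refine Filter.Eventually.of_forall fun ζ q _ => ?_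
    have h1 : HasFDerivAt (fun q : ℝ × ℝ => q.1) (ContinuousLinearMap.fst ℝ ℝ ℝ) q :=
      hasFDerivAt_fst
    have h2 : HasFDerivAt (fun q : ℝ × ℝ => q.2) (ContinuousLinearMap.snd ℝ ℝ ℝ) q :=
      hasFDerivAt_snd
    have h3 := ((((h2.mul_const (ζ / 2)).add (h1.mul_const (ζ ^ 2 / 4))).sub_const
      (β / 8 * ζ ^ 4)).exp).const_mul (ζ ^ n)
    simp only [Pi.add_apply, ← mul_div_assoc] at h3
    refine h3.congr_fderiv ?_
    ext <;> simp [hF', hw] <;> ring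

theorem contDiff_quarticMoment {β : ℝ} (hβ : 0 < β) (n : ℕ) :
    ContDiff ℝ (⊤ : ℕ∞) (quarticMoment β n) := by
  refine contDiff_infty.2 fun k => ?_
  induction k generalizing n with
  | zero =>
    exact contDiff_zero.2 (continuous_iff_continuousAt.2 fun p =>
      (hasFDerivAt_quarticMoment hβ n p).continuousAt)
  | succ k ih =>
    refine contDiff_succ_iff_hasFDerivAt.2 ⟨_, ?_, hasFDerivAt_quarticMoment hβ n⟩
    exact (((ih _).div_const 4).smul contDiff_const).add
      (((ih _).div_const 2).smul contDiff_const)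

theorem hasDerivAt_quarticMoment_fst {β : ℝ} (hβ : 0 < β) (n : ℕ) (T X : ℝ) :
    HasDerivAt (fun S => quarticMoment β n (S, X)) (quarticMoment β (n + 2) (T, X) / 4) T := by
  have h := (hasFDerivAt_quarticMoment hβ n (T, X)).comp_hasDerivAt T
    ((hasDerivAt_id T).prodMk (hasDerivAt_const T X))
  simpa [Function.comp_def] using h

theorem hasDerivAt_quarticMoment_snd {β : ℝ} (hβ : 0 < β) (n : ℕ) (T X : ℝ) :
    HasDerivAt (fun Y => quarticMoment β n (T, Y)) (quarticMoment β (n + 1) (T, X) / 2) X := by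
  have h := (hasFDerivAt_quarticMoment hβ n (T, X)).comp_hasDerivAt X
    ((hasDerivAt_const X T).prodMk (hasDerivAt_id X))
  simpa [Function.comp_def] using h

theorem quarticMoment_zero_pos {β : ℝ} (hβ : 0 < β) (p : ℝ × ℝ) :
    0 < quarticMoment β 0 p := by
  have h := integrable_pow_mul_exp_quartic hβ 0 p
  simp only [pow_zero, one_mul] at h
  simpa [quarticMoment] using integral_exp_pos h

/-- Proposition A.1 (Cole–Hopf step): `φ` is a positive smooth solution of the heat
equation, `Φ = -2 ∂_X φ / φ`, and `Φ` is a smooth solution of the unit-viscosity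
Burgers equation on `ℝ²`. -/
theorem statement3
    (β₃ : ℝ) (hβ₃ : 0 < β₃)
    (E : ℝ → ℝ → ℝ → ℝ)
    (hE : ∀ T X ζ : ℝ, E T X ζ = X * ζ / 2 + T * ζ ^ 2 / 4 - β₃ / 8 * ζ ^ 4)
    (hint : ∀ T X : ℝ, Integrable (fun ζ : ℝ => Real.exp (E T X ζ)))
    (hint' : ∀ T X : ℝ, Integrable (fun ζ : ℝ => ζ * Real.exp (E T X ζ)))
    (φ Φ : ℝ → ℝ → ℝ)
    (hφ : ∀ T X : ℝ, φ T X = ∫ ζ : ℝ, Real.exp (E T X ζ))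
    (hΦ : ∀ T X : ℝ,
      Φ T X = -(∫ ζ : ℝ, ζ * Real.exp (E T X ζ)) / ∫ ζ : ℝ, Real.exp (E T X ζ)) :
    (∀ T X : ℝ, 0 < φ T X) ∧
    ContDiff ℝ (⊤ : ℕ∞) (fun p : ℝ × ℝ => φ p.1 p.2) ∧
    (∀ T X : ℝ, deriv (fun S => φ S X) T = deriv (deriv (fun Y => φ T Y)) X) ∧
    (∀ T X : ℝ, Φ T X = -2 * deriv (fun Y => φ T Y) X / φ T X) ∧
    ContDiff ℝ (⊤ : ℕ∞) (fun p : ℝ × ℝ => Φ p.1 p.2) ∧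
    (∀ T X : ℝ,
      deriv (fun S => Φ S X) T
        = deriv (deriv (fun Y => Φ T Y)) X - Φ T X * deriv (fun Y => Φ T Y) X) := by
  have hφM : φ = fun T X => quarticMoment β₃ 0 (T, X) := by
    ext T X
    simp [hφ, hE, quarticMoment]
  have hΦM : Φ = fun T X => -quarticMoment β₃ 1 (T, X) / quarticMoment β₃ 0 (T, X) := by
    ext T X
    simp [hΦ, hE, quarticMoment]
  have hpos := quarticMoment_zero_pos hβ₃
  have hne (T X : ℝ) : quarticMoment β₃ 0 (T, X) ≠ 0 := (hpos (T, X)).ne'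
  have dT := hasDerivAt_quarticMoment_fst hβ₃
  have dX := hasDerivAt_quarticMoment_snd hβ₃
  subst hφM hΦM
  refine ⟨fun T X => hpos _, contDiff_quarticMoment hβ₃ 0, fun T X => ?_, fun T X => ?_,
    (contDiff_quarticMoment hβ₃ 1).neg.div (contDiff_quarticMoment hβ₃ 0) fun p => (hpos p).ne',
    fun T X => ?_⟩
  · have h : deriv (fun Y => quarticMoment β₃ 0 (T, Y)) =
        fun Y => quarticMoment β₃ 1 (T, Y) / 2 := funext fun Y => (dX 0 T Y).deriv
    rw [(dT 0 T X).deriv, h, ((dX 1 T X).div_const 2).deriv]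
    ring
  · rw [(dX 0 T X).deriv]
    ring
  · have hX (Y : ℝ) := (dX 1 T Y).neg.div (dX 0 T Y) (hne T Y)
    have h : deriv (fun Y => -quarticMoment β₃ 1 (T, Y) / quarticMoment β₃ 0 (T, Y)) = _ :=
      funext fun Y => (hX Y).deriv
    have hT := (dT 1 T X).neg.div (dT 0 T X) (hne T X)
    have hXX := (((((dX 2 T X).div_const 2).neg.mul (dX 0 T X)).sub
      ((dX 1 T X).neg.mul ((dX 1 T X).div_const 2))).div ((dX 0 T X).pow 2)
      (pow_ne_zero 2 (hne T X)))
    have hT' : deriv (fun S => -quarticMoment β₃ 1 (S, X) / quarticMoment β₃ 0 (S, X)) T = _ :=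
      hT.deriv
    have hXX' := hXX.deriv
    simp only [Pi.neg_apply, Pi.sub_apply, Pi.pow_apply,
      Pi.neg_def, Pi.mul_def, Pi.sub_def, Pi.pow_def, Pi.div_def] at h hT' hXX'
    simp only [h, hT', Nat.reduceAdd, zero_add] at hXX' ⊢
    rw [hXX']
    have := hne T X
    field_simp
    ring
end

section
/- Far-field matching of the explicit leading inner profile with the self-similar cubic (existence half of Proposition 3.2 for ℓ = 0 with i = 0, 1, combined with Proposition A.1): There exists a constant C, depending only on β₃, such that for all (T,X) ∈ Qᶜ (i.e. T < 0 and (T,X) ∉ (−1,0)×(−1,1)): |Φ(T,X) − 𝔘(T,X)| ≤ C·𝔇(T,X)⁻³ and |∂_X Φ(T,X) − ∂_X 𝔘(T,X)| ≤ C·𝔇(T,X)⁻⁶. -/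
open Set MeasureTheory

/-- If `ρ ≥ 0` has finite exponential moments of all orders, the integrals
`∫ ζ ^ n * (exp (t * ζ) * ρ ζ)` converge and can be differentiated in `t` under the integral. -/
lemma integrable_and_hasDerivAt_pow_mul_exp_mul {ρ : ℝ → ℝ} (hρ : Measurable ρ)
    (hρ0 : ∀ ζ, 0 ≤ ρ ζ) (hint : ∀ t : ℝ, Integrable fun ζ => Real.exp (t * ζ) * ρ ζ)
    (n : ℕ) (t : ℝ) :
    Integrable (fun ζ => ζ ^ n * (Real.exp (t * ζ) * ρ ζ)) ∧
    HasDerivAt (fun s => ∫ ζ, ζ ^ n * (Real.exp (s * ζ) * ρ ζ))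
      (∫ ζ, ζ ^ (n + 1) * (Real.exp (t * ζ) * ρ ζ)) t := by
  have hm : Measurable fun ζ => ENNReal.ofReal (ρ ζ) := hρ.ennreal_ofReal
  have hlt : ∀ᵐ ζ, ENNReal.ofReal (ρ ζ) < ⊤ := ae_of_all _ fun _ => ENNReal.ofReal_lt_top
  set μ := (volume : Measure ℝ).withDensity fun ζ => ENNReal.ofReal (ρ ζ) with hμ
  have hset : ProbabilityTheory.integrableExpSet (fun ζ : ℝ => ζ) μ = univ := by
    refine eq_univ_of_forall fun s => ?_
    change Integrable _ μ
    rw [hμ, integrable_withDensity_iff_integrable_smul' hm hlt]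
    refine (hint s).congr (ae_of_all _ fun ζ => ?_)
    simp only [ENNReal.toReal_ofReal (hρ0 ζ), smul_eq_mul]
    ring
  have hmem : ∀ s : ℝ, s ∈ interior (ProbabilityTheory.integrableExpSet (fun ζ : ℝ => ζ) μ) := by
    simp [hset]
  have hI : ∀ (k : ℕ) (s : ℝ),
      ∫ ζ, ζ ^ k * Real.exp (s * ζ) ∂μ = ∫ ζ, ζ ^ k * (Real.exp (s * ζ) * ρ ζ) := by
    intro k s
    rw [hμ, integral_withDensity_eq_integral_toReal_smul hm hlt]
    refine integral_congr_ae (ae_of_all _ fun ζ => ?_)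
    simp only [ENNReal.toReal_ofReal (hρ0 ζ), smul_eq_mul]
    ring
  constructor
  · have h := ProbabilityTheory.integrable_pow_mul_exp_of_mem_interior_integrableExpSet (hmem t) n
    rw [hμ, integrable_withDensity_iff_integrable_smul' hm hlt] at h
    refine h.congr (ae_of_all _ fun ζ => ?_)
    simp only [ENNReal.toReal_ofReal (hρ0 ζ), smul_eq_mul]
    ring
  · have h := ProbabilityTheory.hasDerivAt_integral_pow_mul_exp_real (hmem t) n
    simpa only [hI] using h

lemma integrable_polynomial_eval_mul {w : ℝ → ℝ}
    (hw : ∀ n : ℕ, Integrable fun ζ => ζ ^ n * w ζ) (p : Polynomial ℝ) :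
    Integrable fun ζ => p.eval ζ * w ζ := by
  induction p using Polynomial.induction_on' with
  | add p q hp hq =>
    simp only [Polynomial.eval_add, add_mul]
    exact hp.add hq
  | monomial n a =>
    simp only [Polynomial.eval_monomial, mul_assoc]
    exact (hw n).const_mul a

lemma integrable_sub_pow_mul {w : ℝ → ℝ}
    (hw : ∀ n : ℕ, Integrable fun ζ => ζ ^ n * w ζ) (v : ℝ) (n : ℕ) :
    Integrable fun ζ => (ζ - v) ^ n * w ζ :=
  (integrable_polynomial_eval_mul hw ((Polynomial.X - Polynomial.C v) ^ n)).congr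
    (ae_of_all _ fun ζ => by simp)

/-- The `n`-th moment of the weight `w` centred at `v`. -/
noncomputable def centredMoment (w : ℝ → ℝ) (v : ℝ) (n : ℕ) : ℝ := ∫ ζ, (ζ - v) ^ n * w ζ

/-- Integration by parts for the moments of a weight `w` centred at `v` whose logarithmic derivative
is cubic. -/
lemma centredMoment_recursion {w : ℝ → ℝ} {v α β γ : ℝ}
    (hw : ∀ n : ℕ, Integrable fun ζ => (ζ - v) ^ n * w ζ)
    (hd : ∀ ζ, HasDerivAt w
      (-(α * (ζ - v) + β * (ζ - v) ^ 2 + γ * (ζ - v) ^ 3) * w ζ) ζ) (n : ℕ) :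
    n * centredMoment w v (n - 1) =
      α * centredMoment w v (n + 1) + β * centredMoment w v (n + 2)
        + γ * centredMoment w v (n + 3) := by
  have i0 := (hw (n - 1)).const_mul (n : ℝ)
  have i1 := (hw (n + 1)).const_mul α
  have i2 := (hw (n + 2)).const_mul β
  have i3 := (hw (n + 3)).const_mul γ
  have h := integral_eq_zero_of_hasDerivAt_of_integrable (fun ζ => by
    change HasDerivAt (fun ζ => (ζ - v) ^ n * w ζ)
      (((fun x => n * ((x - v) ^ (n - 1) * w x)) - ((fun x => α * ((x - v) ^ (n + 1) * w x))
        + (fun x => β * ((x - v) ^ (n + 2) * w x))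
        + fun x => γ * ((x - v) ^ (n + 3) * w x))) ζ) ζ
    refine ((((hasDerivAt_id ζ).sub_const v).pow n).mul (hd ζ)).congr_deriv ?_
    simp only [id, Pi.pow_apply, Pi.sub_apply, Pi.add_apply]
    ring) (i0.sub ((i1.add i2).add i3)) (hw n)
  rw [integral_sub' i0 ((i1.add i2).add i3), integral_add' (i1.add i2) i3,
    integral_add' i1 i2] at h
  simp only [integral_const_mul] at h
  unfold centredMoment
  linarith

/-- Quadratic forms in the moments that are integrals of nonnegative functions are nonnegative. -/
lemma centredMoment_quadratic_nonneg {w : ℝ → ℝ} {v a b c : ℝ}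
    (hw : ∀ n : ℕ, Integrable fun ζ => (ζ - v) ^ n * w ζ) (hw0 : ∀ ζ, 0 ≤ w ζ)
    (habc : ∀ η : ℝ, 0 ≤ a + b * η + c * η ^ 2) (k : ℕ) :
    0 ≤ a * centredMoment w v (2 * k) + b * centredMoment w v (2 * k + 1)
      + c * centredMoment w v (2 * k + 2) := by
  have i0 := (hw (2 * k)).const_mul a
  have i1 := (hw (2 * k + 1)).const_mul b
  have i2 := (hw (2 * k + 2)).const_mul c
  simp only [centredMoment, ← integral_const_mul]
  rw [← integral_add' i0 i1, ← integral_add' (i0.add i1) i2]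
  refine integral_nonneg fun ζ => ?_
  have : 0 ≤ (a + b * (ζ - v) + c * (ζ - v) ^ 2) * (((ζ - v) ^ k) ^ 2 * w ζ) :=
    mul_nonneg (habc _) (mul_nonneg (sq_nonneg _) (hw0 ζ))
  refine this.trans_eq ?_
  simp only [Pi.add_apply]
  ring

/-- If `α η² + β η³ + γ η⁴ ≥ c η²`, the even centred moments decay. -/
lemma centredMoment_even_le {w : ℝ → ℝ} {v α β γ c : ℝ}
    (hw : ∀ n : ℕ, Integrable fun ζ => (ζ - v) ^ n * w ζ) (hw0 : ∀ ζ, 0 ≤ w ζ)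
    (hd : ∀ ζ, HasDerivAt w
      (-(α * (ζ - v) + β * (ζ - v) ^ 2 + γ * (ζ - v) ^ 3) * w ζ) ζ)
    (hc : ∀ η : ℝ, c ≤ α + β * η + γ * η ^ 2) (k : ℕ) :
    c * centredMoment w v (2 * k + 2) ≤ (2 * k + 1) * centredMoment w v (2 * k) := by
  have h := centredMoment_recursion hw hd (2 * k + 1)
  have h' := centredMoment_quadratic_nonneg (a := α - c) (b := β) (c := γ) hw hw0
    (fun η => by linarith [hc η]) (k + 1)
  simp only [Nat.add_sub_cancel] at h
  push_cast at h
  simp only [mul_add, mul_one] at h'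
  linarith

lemma centredMoment_odd_le {w : ℝ → ℝ} {v D : ℝ}
    (hw : ∀ n : ℕ, Integrable fun ζ => (ζ - v) ^ n * w ζ) (hw0 : ∀ ζ, 0 ≤ w ζ) (k : ℕ) :
    2 * D * |centredMoment w v (2 * k + 1)| ≤
      centredMoment w v (2 * k) + D ^ 2 * centredMoment w v (2 * k + 2) := by
  have key : ∀ d : ℝ, 0 ≤ 1 * centredMoment w v (2 * k) + 2 * d * centredMoment w v (2 * k + 1)
      + d ^ 2 * centredMoment w v (2 * k + 2) := fun d =>
    centredMoment_quadratic_nonneg hw hw0 (fun η => by nlinarith [sq_nonneg (1 + d * η)]) k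
  have h1 := key D
  have h2 := key (-D)
  rcases abs_cases (centredMoment w v (2 * k + 1)) with ⟨h, -⟩ | ⟨h, -⟩ <;> rw [h] <;> nlinarith

/-- Bounds for the first two rescaled moments out of the moment recursion. -/
lemma rescaled_moment_bounds {b P e₀ : ℝ} (hb : 0 ≤ b) (hP : 0 ≤ P) (he₀ : 0 ≤ e₀) :
    ∃ A B : ℝ, ∀ p e a₁ a₂ a₃ a₄ a₅ a₆ : ℝ, |p| ≤ P → 0 ≤ e → e ≤ e₀ →
      0 ≤ a₂ → a₂ ≤ 8 → 0 ≤ a₄ → a₄ ≤ 24 * a₂ → a₆ ≤ 40 * a₄ →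
      2 * |a₃| ≤ a₂ + a₄ → 2 * |a₅| ≤ a₄ + a₆ →
      0 = a₁ + 3 * p * e * a₂ + b * e ^ 2 * a₃ →
      2 = a₂ + 3 * p * e * a₃ + b * e ^ 2 * a₄ →
      4 * a₁ = a₃ + 3 * p * e * a₄ + b * e ^ 2 * a₅ →
      |a₁| ≤ A * e ∧ |a₂ - a₁ ^ 2 - 2| ≤ B * e ^ 2 := by
  set A := 24 * P + 100 * b * e₀ with hA
  set B := 4 * A + 576 * P + 3936 * b * e₀ with hB
  have hA0 : 0 ≤ A := by positivity
  have hB0 : 0 ≤ B := by positivity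
  refine ⟨A, 3 * P * B + 192 * b + A ^ 2, ?_⟩
  intro p e a₁ a₂ a₃ a₄ a₅ a₆ hp he hee h2 h2' h4 h4' h6 h3 h5 r0 r1 r2
  have term1 : ∀ x M : ℝ, |x| ≤ M → |3 * p * e * x| ≤ 3 * P * M * e := by
    intro x M hx
    rw [abs_mul, abs_mul, abs_mul, abs_of_nonneg he, abs_of_pos (by norm_num : (0 : ℝ) < 3)]
    have : |p| * |x| ≤ P * M := mul_le_mul hp hx (abs_nonneg _) hP
    nlinarith
  have term2 : ∀ x M : ℝ, |x| ≤ M → |b * e ^ 2 * x| ≤ b * M * e ^ 2 := by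
    intro x M hx
    rw [abs_mul, abs_of_nonneg (by positivity : 0 ≤ b * e ^ 2)]
    have := mul_le_mul_of_nonneg_left hx (by positivity : 0 ≤ b * e ^ 2)
    linarith
  have sq_le : ∀ M : ℝ, 0 ≤ M → b * M * e ^ 2 ≤ b * M * e₀ * e := by
    intro M hM
    have := mul_le_mul_of_nonneg_left hee (by positivity : 0 ≤ b * M * e)
    nlinarith
  have h3' : |a₃| ≤ 100 := by linarith
  have h5' : |a₅| ≤ 3936 := by linarith
  have h4a : |a₄| ≤ 192 := by rw [abs_of_nonneg h4]; linarith
  have h2a : |a₂| ≤ 8 := by rwa [abs_of_nonneg h2]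
  have b1 : |a₁| ≤ A * e := by
    have t1 := abs_le.1 (term1 _ _ h2a)
    have t2 := abs_le.1 (term2 _ _ h3')
    have t3 := sq_le 100 (by norm_num)
    rw [abs_le]
    constructor <;> nlinarith
  have b3 : |a₃| ≤ B * e := by
    have t1 := abs_le.1 (term1 _ _ h4a)
    have t2 := abs_le.1 (term2 _ _ h5')
    have t3 := sq_le 3936 (by norm_num)
    have t4 := abs_le.1 b1
    rw [abs_le]
    constructor <;> nlinarith
  refine ⟨b1, ?_⟩
  have t1 := abs_le.1 (term1 _ _ b3)
  have t2 := abs_le.1 (term2 _ _ h4a)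
  have t4 : a₁ ^ 2 ≤ A ^ 2 * e ^ 2 := by
    rw [← mul_pow]; exact sq_le_sq' (abs_le.1 b1).1 (abs_le.1 b1).2
  have t5 := sq_nonneg a₁
  rw [abs_le]
  constructor <;> nlinarith

/-- Mean and variance of a weight `w` with logarithmic derivative
`-(D²/2 η + (3bv/2) η² + (b/2) η³)`, where `η = ζ - v`, for `D` bounded below. -/
lemma mean_variance_bounds {b e₀ : ℝ} (hb : 0 < b) (he₀ : 0 ≤ e₀) :
    ∃ A B : ℝ, ∀ (w : ℝ → ℝ) (v D : ℝ), 0 < D → 1 / D ^ 2 ≤ e₀ → 3 * b * v ^ 2 ≤ D ^ 2 →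
      (∀ n : ℕ, Integrable fun ζ => (ζ - v) ^ n * w ζ) → (∀ ζ, 0 ≤ w ζ) →
      0 < centredMoment w v 0 →
      (∀ ζ, HasDerivAt w (-(D ^ 2 / 2 * (ζ - v) + 3 * b * v / 2 * (ζ - v) ^ 2
        + b / 2 * (ζ - v) ^ 3) * w ζ) ζ) →
      |centredMoment w v 1 / centredMoment w v 0| ≤ A / D ^ 3 ∧
      |centredMoment w v 2 / centredMoment w v 0
        - (centredMoment w v 1 / centredMoment w v 0) ^ 2 - 2 / D ^ 2| ≤ B / D ^ 6 := by
  obtain ⟨A, B, h⟩ := rescaled_moment_bounds hb.le (by positivity : 0 ≤ b + 1) he₀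
  refine ⟨A, B, ?_⟩
  intro w v D hD hDe hv hw hw0 hpos hd
  have hc : ∀ η : ℝ, D ^ 2 / 8 ≤ D ^ 2 / 2 + 3 * b * v / 2 * η + b / 2 * η ^ 2 := by
    intro η
    nlinarith [mul_nonneg hb.le (sq_nonneg (2 * η + 3 * v))]
  have r0 := centredMoment_recursion hw hd 0
  have r1 := centredMoment_recursion hw hd 1
  have r2 := centredMoment_recursion hw hd 2
  have e0 := centredMoment_even_le hw hw0 hd hc 0
  have e1 := centredMoment_even_le hw hw0 hd hc 1
  have e2 := centredMoment_even_le hw hw0 hd hc 2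
  have o1 := centredMoment_odd_le (D := D) hw hw0 1
  have o2 := centredMoment_odd_le (D := D) hw hw0 2
  have p2 : 0 ≤ centredMoment w v 2 :=
    integral_nonneg fun ζ => mul_nonneg (by positivity) (hw0 ζ)
  have p4 : 0 ≤ centredMoment w v 4 :=
    integral_nonneg fun ζ => mul_nonneg (by positivity) (hw0 ζ)
  norm_num only at r0 r1 r2 e0 e1 e2 o1 o2
  generalize centredMoment w v = N at *
  generalize N 0 = m at *
  have hP : |b * v / D| ≤ b + 1 := by
    apply abs_le_of_sq_le_sq _ (by positivity)
    rw [div_pow, div_le_iff₀ (by positivity)]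
    nlinarith [mul_le_mul_of_nonneg_left hv hb.le, mul_nonneg hb.le (sq_nonneg D),
      mul_nonneg (sq_nonneg b) (sq_nonneg D)]
  have hDm : ∀ k : ℕ, 0 < D ^ k / m := fun k => by positivity
  obtain ⟨h1, h2⟩ := h (b * v / D) (1 / D ^ 2) (N 1 * (D ^ 1 / m)) (N 2 * (D ^ 2 / m))
    (N 3 * (D ^ 3 / m)) (N 4 * (D ^ 4 / m)) (N 5 * (D ^ 5 / m)) (N 6 * (D ^ 6 / m))
    hP (by positivity) hDe (by positivity)
    (by rw [← mul_div_assoc, div_le_iff₀ hpos]; linarith)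
    (by positivity)
    (by linear_combination 8 * (D ^ 2 / m) * e1)
    (by linear_combination 8 * (D ^ 4 / m) * e2)
    (by rw [abs_mul, abs_of_pos (hDm 3)]; linear_combination (D ^ 2 / m) * o1)
    (by rw [abs_mul, abs_of_pos (hDm 5)]; linear_combination (D ^ 4 / m) * o2)
    (by field_simp; linear_combination 2 * r0)
    (by field_simp; linear_combination 2 * r1)
    (by field_simp; linear_combination 2 * r2)
  constructor
  · have : N 1 / m = N 1 * (D ^ 1 / m) / D := by field_simp
    rw [this, abs_div, abs_of_pos hD, div_le_iff₀ hD]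
    exact h1.trans_eq (by field_simp)
  · have : N 2 / m - (N 1 / m) ^ 2 - 2 / D ^ 2
        = (N 2 * (D ^ 2 / m) - (N 1 * (D ^ 1 / m)) ^ 2 - 2) / D ^ 2 := by field_simp
    rw [this, abs_div, abs_of_pos (pow_pos hD 2), div_le_iff₀ (pow_pos hD 2)]
    exact h2.trans_eq (by field_simp)

/-- A right inverse of the decreasing cubic `u ↦ T u - b u³` has the expected derivative. -/
lemma hasDerivAt_cubic_rightInverse {b T : ℝ} (hb : 0 ≤ b) (hT : T < 0) {u : ℝ → ℝ}
    (hu : ∀ x, T * u x - b * u x ^ 3 = x) (x : ℝ) :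
    HasDerivAt u (T - 3 * b * u x ^ 2)⁻¹ x := by
  have hlip : LipschitzWith (Real.toNNReal (-T)⁻¹) u := by
    refine LipschitzWith.of_dist_le_mul fun y z => ?_
    rw [Real.coe_toNNReal _ (inv_nonneg.2 (by linarith)), Real.dist_eq, Real.dist_eq,
      ← div_eq_inv_mul, le_div_iff₀ (by linarith)]
    have hq : 0 ≤ b * (u y ^ 2 + u y * u z + u z ^ 2) :=
      mul_nonneg hb (by nlinarith [sq_nonneg (u y + u z), sq_nonneg (u y), sq_nonneg (u z)])
    have : y - z = (u y - u z) * (T - b * (u y ^ 2 + u y * u z + u z ^ 2)) := by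
      linear_combination hu z - hu y
    rw [this, abs_mul]
    refine mul_le_mul_of_nonneg_left ?_ (abs_nonneg _)
    rw [abs_of_nonpos (by linarith)]
    linarith
  refine HasDerivAt.of_local_left_inverse (f := fun s => T * s - b * s ^ 3)
    hlip.continuous.continuousAt ?_ ?_ (Filter.Eventually.of_forall hu)
  · refine (((hasDerivAt_id (u x)).const_mul T).sub
      (((hasDerivAt_id (u x)).pow 3).const_mul b)).congr_deriv ?_
    simp only [id]
    norm_num
    ring
  · nlinarith [mul_nonneg hb (sq_nonneg (u x))]

/-- Away from the origin, `|T| + 3 b u²` is bounded below. -/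
lemma one_div_discriminant_le {b T X u : ℝ} (hb : 0 < b) (hT : T < 0)
    (hu : T * u - b * u ^ 3 = X) (hTX : T ≤ -1 ∨ 1 ≤ |X|) :
    1 / (-T + 3 * b * u ^ 2) ≤ 1 + 1 / (3 * b) := by
  have hu2 : 0 ≤ b * u ^ 2 := by positivity
  have hs : 0 < -T + 3 * b * u ^ 2 := by linarith
  by_cases h1 : 1 ≤ -T + 3 * b * u ^ 2
  · have : 1 / (-T + 3 * b * u ^ 2) ≤ 1 := by rw [div_le_one hs]; exact h1
    have : 0 ≤ 1 / (3 * b) := by positivity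
    linarith
  have hX : 1 ≤ |X| := hTX.resolve_left fun h => h1 (by linarith)
  push Not at h1
  set s := -T + 3 * b * u ^ 2 with hsdef
  have hXs : |X| ≤ s * |u| := by
    have : X = -((-T + b * u ^ 2) * u) := by rw [← hu]; ring
    rw [this, abs_neg, abs_mul, abs_of_pos (by linarith)]
    exact mul_le_mul_of_nonneg_right (by linarith) (abs_nonneg u)
  have h3 : 1 ≤ s ^ 2 * u ^ 2 := by
    rw [← sq_abs u, ← mul_pow]
    exact one_le_pow₀ (hX.trans hXs)
  have h4 : 3 * b ≤ s ^ 3 := by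
    nlinarith [mul_le_mul_of_nonneg_left h3 hb.le, mul_nonneg (neg_pos.2 hT).le (sq_nonneg s)]
  have h5 : 3 * b ≤ s := h4.trans (pow_le_of_le_one hs.le h1.le (by norm_num))
  have : 1 / s ≤ 1 / (3 * b) := one_div_le_one_div_of_le (by positivity) h5
  linarith

/-- Far-field matching of the explicit leading inner profile `Φ` with the
self-similar cubic `𝔘` (existence half of Proposition 3.2 for `ℓ = 0`, `i = 0, 1`,
combined with Proposition A.1). -/
theorem statement4
    (β₃ : ℝ) (hβ₃ : 0 < β₃)
    (UU : ℝ → ℝ → ℝ)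
    (hUU : ∀ T : ℝ, T < 0 → ∀ X : ℝ, T * UU T X - β₃ * UU T X ^ 3 = X)
    (DD : ℝ → ℝ → ℝ)
    (hDD : ∀ T X : ℝ, DD T X = Real.sqrt (|T| + 3 * β₃ * UU T X ^ 2))
    (E : ℝ → ℝ → ℝ → ℝ)
    (hE : ∀ T X ζ : ℝ, E T X ζ = X * ζ / 2 + T * ζ ^ 2 / 4 - β₃ / 8 * ζ ^ 4)
    (hint : ∀ T X : ℝ, Integrable (fun ζ : ℝ => Real.exp (E T X ζ)))
    (hint' : ∀ T X : ℝ, Integrable (fun ζ : ℝ => ζ * Real.exp (E T X ζ)))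
    (Φ : ℝ → ℝ → ℝ)
    (hΦ : ∀ T X : ℝ,
      Φ T X = -(∫ ζ : ℝ, ζ * Real.exp (E T X ζ)) / ∫ ζ : ℝ, Real.exp (E T X ζ)) :
    ∃ C : ℝ, ∀ T : ℝ, T < 0 → ∀ X : ℝ,
      (T, X) ∉ Set.Ioo (-1:ℝ) 0 ×ˢ Set.Ioo (-1:ℝ) 1 →
      |Φ T X - UU T X| ≤ C / DD T X ^ 3 ∧
      |deriv (fun Y => Φ T Y) X - deriv (fun Y => UU T Y) X| ≤ C / DD T X ^ 6 := by
  obtain ⟨A, B, h⟩ := mean_variance_bounds hβ₃ (by positivity : 0 ≤ 1 + 1 / (3 * β₃))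
  refine ⟨max A B, fun T hT X hTX => ?_⟩
  set v := -UU T X with hv
  set D := DD T X with hD
  have hu := hUU T hT X
  have hu2 : 0 ≤ β₃ * UU T X ^ 2 := by positivity
  have hs : 0 < -T + 3 * β₃ * UU T X ^ 2 := by linarith
  have hDeq : D = Real.sqrt (-T + 3 * β₃ * UU T X ^ 2) := by rw [hD, hDD, abs_of_neg hT]
  have hD2 : D ^ 2 = -T + 3 * β₃ * UU T X ^ 2 := by rw [hDeq, Real.sq_sqrt hs.le]
  have hD0 : 0 < D := by rw [hDeq]; exact Real.sqrt_pos.2 hs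
  have hout : T ≤ -1 ∨ 1 ≤ |X| := by
    by_contra! hc
    exact hTX ⟨⟨hc.1, hT⟩, abs_lt.1 hc.2⟩
  set ρ : ℝ → ℝ := fun ζ => Real.exp (T * ζ ^ 2 / 4 - β₃ / 8 * ζ ^ 4) with hρ
  have hw : ∀ Y ζ, Real.exp (E T Y ζ) = Real.exp (Y / 2 * ζ) * ρ ζ := by
    intro Y ζ
    rw [hE, hρ, ← Real.exp_add]
    ring_nf
  have hρint := integrable_and_hasDerivAt_pow_mul_exp_mul (ρ := ρ) (by fun_prop)
    (fun ζ => (Real.exp_pos _).le) (fun t => by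
      refine (hint T (2 * t)).congr (ae_of_all _ fun ζ => ?_)
      simp only [hw]
      ring_nf)
  set w : ℝ → ℝ := fun ζ => Real.exp (E T X ζ) with hwdef
  have hpow : ∀ n : ℕ, Integrable fun ζ => ζ ^ n * w ζ := fun n => by
    simp only [hwdef, hw]
    exact (hρint n (X / 2)).1
  have hwint := integrable_sub_pow_mul hpow v
  have hwd : ∀ ζ, HasDerivAt w (-(D ^ 2 / 2 * (ζ - v) + 3 * β₃ * v / 2 * (ζ - v) ^ 2
      + β₃ / 2 * (ζ - v) ^ 3) * w ζ) ζ := by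
    intro ζ
    have hEd : HasDerivAt (fun ζ => X * ζ / 2 + T * ζ ^ 2 / 4 - β₃ / 8 * ζ ^ 4)
        (X / 2 + T * ζ / 2 - β₃ / 2 * ζ ^ 3) ζ := by
      refine (((((hasDerivAt_id ζ).const_mul X).div_const 2).add
        ((((hasDerivAt_id ζ).pow 2).const_mul T).div_const 4)).sub
        (((hasDerivAt_id ζ).pow 4).const_mul (β₃ / 8))).congr_deriv ?_
      simp only [id]
      norm_num
      ring
    have hwe : w = fun ζ => Real.exp (X * ζ / 2 + T * ζ ^ 2 / 4 - β₃ / 8 * ζ ^ 4) := by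
      funext ζ
      simp only [hwdef, hE]
    rw [hwe]
    refine hEd.exp.congr_deriv ?_
    rw [mul_comm]
    congr 1
    rw [hD2, hv]
    linear_combination (-1 / 2) * hu
  have hN0 : centredMoment w v 0 = ∫ ζ, w ζ := by simp [centredMoment]
  have hpos : 0 < ∫ ζ, w ζ := integral_exp_pos (hint T X)
  obtain ⟨h1, h2⟩ := h w v D hD0
    (by rw [hD2]; exact one_div_discriminant_le hβ₃ hT hu hout)
    (by rw [hD2, hv, neg_sq]; linarith) hwint (fun ζ => (Real.exp_pos _).le)
    (hN0 ▸ hpos) hwd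
  rw [hN0] at h1 h2
  have i0 : Integrable w := hint T X
  have i1 : Integrable fun ζ => ζ * w ζ := hint' T X
  have i2 := hpow 2
  have hN1 : centredMoment w v 1 = (∫ ζ, ζ * w ζ) - v * ∫ ζ, w ζ := by
    rw [centredMoment, ← integral_const_mul, ← integral_sub i1 (i0.const_mul v)]
    congr 1 with ζ
    ring
  have hN2 : centredMoment w v 2
      = (∫ ζ, ζ ^ 2 * w ζ) - 2 * v * (∫ ζ, ζ * w ζ) + v ^ 2 * ∫ ζ, w ζ := by
    rw [centredMoment, ← integral_const_mul, ← integral_const_mul,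
      ← integral_sub' i2 (i1.const_mul _), ← integral_add' (i2.sub (i1.const_mul _))
      (i0.const_mul _)]
    congr 1 with ζ
    simp only [Pi.add_apply, Pi.sub_apply]
    ring
  have hΦd : HasDerivAt (fun Y => Φ T Y) (-(1 / 2) * ((∫ ζ, ζ ^ 2 * w ζ) / (∫ ζ, w ζ)
      - ((∫ ζ, ζ * w ζ) / ∫ ζ, w ζ) ^ 2)) X := by
    have hhalf : HasDerivAt (fun Y : ℝ => Y / 2) (1 / 2) X := (hasDerivAt_id X).div_const 2
    have d0 := (hρint 0 (X / 2)).2.comp X hhalf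
    have d1 := (hρint 1 (X / 2)).2.comp X hhalf
    simp only [Function.comp_def, ← hw, pow_zero, one_mul, zero_add, pow_one,
      Nat.reduceAdd] at d0 d1
    have hΦ' : (fun Y => Φ T Y) = fun Y =>
        -(∫ ζ : ℝ, ζ * Real.exp (E T Y ζ)) / ∫ ζ : ℝ, Real.exp (E T Y ζ) := funext (hΦ T)
    rw [hΦ']
    refine (d1.neg.div d0 hpos.ne').congr_deriv ?_
    simp only [Pi.neg_apply]
    change (_ * (∫ ζ, w ζ) - _) / (∫ ζ, w ζ) ^ 2 = _
    field_simp
    ring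
  have hUd := hasDerivAt_cubic_rightInverse hβ₃.le hT (hUU T hT) X
  constructor
  · have : Φ T X - UU T X = -(centredMoment w v 1 / ∫ ζ, w ζ) := by
      rw [hΦ, hN1, hv]
      change -(∫ ζ, ζ * w ζ) / (∫ ζ, w ζ) - _ = _
      field_simp
      ring
    rw [this, abs_neg]
    exact h1.trans (by gcongr; exact le_max_left _ _)
  · have : deriv (fun Y => Φ T Y) X - deriv (fun Y => UU T Y) X
        = -(1 / 2) * (centredMoment w v 2 / (∫ ζ, w ζ)
          - (centredMoment w v 1 / ∫ ζ, w ζ) ^ 2 - 2 / D ^ 2) := by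
      have hinv : (T - 3 * β₃ * UU T X ^ 2)⁻¹ = -(1 / D ^ 2) := by
        rw [hD2, ← neg_inj, neg_neg, ← inv_neg, one_div]
        congr 1
        ring
      rw [hΦd.deriv, hUd.deriv, hinv, hN1, hN2]
      field_simp
      ring
    rw [this, abs_mul]
    have h0 := abs_nonneg (centredMoment w v 2 / (∫ ζ, w ζ)
          - (centredMoment w v 1 / ∫ ζ, w ζ) ^ 2 - 2 / D ^ 2)
    have : B / D ^ 6 ≤ max A B / D ^ 6 := by gcongr; exact le_max_right _ _
    norm_num
    linarith
end
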